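/- arXiv:2410.04502 — 3 statements merged into one kernel-verified Lean document; each statement's English description precedes it below -/
import Mathlib

section
/- In U = U_q(A(0,2)^{(4)})^+, for every n ≥ 1: L̃_n commutes with L₁² (L̃_nL₁² = L₁²L̃_n), L_n commutes with L₁² (L_nL₁² = L₁²L_n), and L̃₂ commutes with L̃_{2n} (L̃₂L̃_{2n} = L̃_{2n}L̃₂). -/
noncomputable section

namespace QAff

abbrev F : Type := FreeAlgebra ℂ (Fin 2)

def x1 : F := FreeAlgebra.ι ℂ 0
def x2 : F := FreeAlgebra.ι ℂ 1

def θ (q : ℂ) : ℂ := q - q⁻¹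

def L1F (q : ℂ) : F := x1 * x2 - q⁻¹ • (x2 * x1)

def X2F (q : ℂ) : F := x1 * L1F q - L1F q * x1

def Y2F (q : ℂ) : F := L1F q * x2 + x2 * L1F q

/-- the quantum Serre relator `[x₁,[x₁,[x₁,x₂]]]` (braided brackets w.r.t. the bicharacter
`χ((a,b),(c,d)) = (-1)^(bd) q^(ac-ad-bc+bd)`). -/
def serre1 (q : ℂ) : F := x1 * X2F q - q • (X2F q * x1)

/-- the quantum Serre relator `[[[x₁,x₂],x₂],x₂]` (braided brackets). -/
def serre2 (q : ℂ) : F := Y2F q * x2 - q • (x2 * Y2F q)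

inductive Rel (q : ℂ) : F → F → Prop
  | one : Rel q (serre1 q) 0
  | two : Rel q (serre2 q) 0

/-- `U = U_q(A(0,2)^{(4)})^+`, the free algebra on `x₁, x₂` modulo the two-sided ideal
generated by the quantum Serre relators. -/
abbrev U (q : ℂ) : Type := RingQuot (Rel q)

def π (q : ℂ) : F →ₐ[ℂ] U q := RingQuot.mkAlgHom ℂ (Rel q)

/-- `L₁ = [X₁,Y₁] = x₁x₂ - q⁻¹ x₂x₁` in `U`. -/
def L1U (q : ℂ) : U q := π q x1 * π q x2 - q⁻¹ • (π q x2 * π q x1)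

/-- real root vectors `X_n`, `n ≥ 1` (`X 0 := 0` is junk):
`X₁ = x₁`, `X_{n+1} = [X_n, L₁] = X_n L₁ - (-1)^(n-1) L₁ X_n`
(the braiding scalar is `χ((n,n-1),(1,1)) = (-1)^(n-1)`). -/
def X (q : ℂ) : ℕ → U q
  | 0 => 0
  | 1 => π q x1
  | (n+2) => X q (n+1) * L1U q - ((-1 : ℂ)^n) • (L1U q * X q (n+1))

/-- real root vectors `Y_n`, `n ≥ 1` (`Y 0 := 0` is junk):
`Y₁ = x₂`, `Y_{n+1} = [L₁, Y_n] = L₁ Y_n - (-1)^n Y_n L₁`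
(the braiding scalar is `χ((1,1),(n-1,n)) = (-1)^n`). -/
def Y (q : ℂ) : ℕ → U q
  | 0 => 0
  | 1 => π q x2
  | (n+2) => L1U q * Y q (n+1) - ((-1 : ℂ)^(n+1)) • (Y q (n+1) * L1U q)

/-- `L₀ = θ⁻¹·1`, and `L_n = [X₁, Y_n] = X₁Y_n - q⁻¹ Y_n X₁` for `n ≥ 1`
(the braiding scalar is `χ((1,0),(n-1,n)) = q⁻¹`). -/
def L (q : ℂ) : ℕ → U q
  | 0 => (θ q)⁻¹ • 1
  | (n+1) => X q 1 * Y q (n+1) - q⁻¹ • (Y q (n+1) * X q 1)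

/-- `L₀′ = θ⁻¹·1`, `L₁′ = L₁`, and
`L_n′ = [X₂, Y_{n-1}] = X₂Y_{n-1} - (-1)^(n-1) q⁻¹ Y_{n-1}X₂` for `n ≥ 2`
(the braiding scalar is `χ((2,1),(n-2,n-1)) = (-1)^(n-1) q⁻¹`). -/
def L' (q : ℂ) : ℕ → U q
  | 0 => (θ q)⁻¹ • 1
  | 1 => L q 1
  | (n+2) => X q 2 * Y q (n+1) - ((-1 : ℂ)^(n+1) * q⁻¹) • (Y q (n+1) * X q 2)

/-- `M q n` is the element `M_{2n+1}`:  `M₁ = L₁`, `M_{2n+1} = [L₂, M_{2n-1}]`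
(a plain commutator, the braiding scalar being `1`). -/
def M (q : ℂ) : ℕ → U q
  | 0 => L q 1
  | (n+1) => L q 2 * M q n - M q n * L q 2

/-- `L̃_n = (L_n + L_n′)/2`, with the convention `L̃_n = 0` for `n < 0`
(note `L̃₀ = θ⁻¹·1`). -/
def Lt (q : ℂ) (n : ℤ) : U q :=
  if 0 ≤ n then ((2 : ℂ)⁻¹) • (L q n.toNat + L' q n.toNat) else 0

/-- `L̂_{n+1} = [L_n, L₁] = L_n L₁ - (-1)^n L₁ L_n`
(the braiding scalar is `χ((n,n),(1,1)) = (-1)^n`); in particular `L̂₁ = 0`. -/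
def Lhat (q : ℂ) : ℕ → U q
  | 0 => 0
  | (n+1) => L q n * L q 1 - ((-1 : ℂ)^n) • (L q 1 * L q n)

/-- the sequence `P₀ = 1`, `P_n = q^n + q^(n-1) + (-1)^(n-1) P_(n-1)`. -/
def P (q : ℂ) : ℕ → ℂ
  | 0 => 1
  | (n+1) => q^(n+1) + q^n + (-1 : ℂ)^n * P q n

/-- the sequence `Q₀ = 1`, `Q_n = q^n - q^(n-1) + (-1)^n Q_(n-1)`. -/
def Q (q : ℂ) : ℕ → ℂ
  | 0 => 1
  | (n+1) => q^(n+1) - q^n + (-1 : ℂ)^(n+1) * Q q n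

/-- `q` is not a root of unity. -/
def NotRootOfUnity (q : ℂ) : Prop := ∀ n : ℕ, n ≠ 0 → q ^ n ≠ 1

end QAff

open QAff

set_option linter.unusedSimpArgs false

namespace QAff

/-- The relations among the real root vectors `X_{2i+1}, X_{2i+2}, Y_{2j+1}, Y_{2j+2}`
(here `xe i, xo i, yo j, ye j`) and `L₁` (here `l`). -/
structure Currents (q : ℂ) (R : Type*) [Ring R] [Algebra ℂ R] where
  xe : ℕ → R
  xo : ℕ → R
  yo : ℕ → R
  ye : ℕ → R
  l : R
  xe_l (i : ℕ) : xe i * l - l * xe i = xo i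
  xo_l (i : ℕ) : xo i * l + l * xo i = xe (i + 1)
  yo_l (j : ℕ) : l * yo j + yo j * l = ye j
  ye_l (j : ℕ) : l * ye j - ye j * l = yo (j + 1)
  serre_x : xe 0 * xo 0 = q • (xo 0 * xe 0)
  serre_y : ye 0 * yo 0 = q • (yo 0 * ye 0)
  l_eq : l = xe 0 * yo 0 - q⁻¹ • (yo 0 * xe 0)

namespace Currents

section

variable {q : ℂ} {R : Type*} [Ring R] [Algebra ℂ R] (S : Currents q R)

/-- The bracket of `X_{2i+1}` and `Y_{2j+1}`. -/
def cA (i j : ℕ) : R := S.xe i * S.yo j - q⁻¹ • (S.yo j * S.xe i)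

/-- The bracket of `X_{2i+2}` and `Y_{2j+2}`. -/
def cA' (i j : ℕ) : R := S.xo i * S.ye j - q⁻¹ • (S.ye j * S.xo i)

/-- The bracket of `X_{2i+1}` and `Y_{2j+2}`. -/
def cB (i j : ℕ) : R := S.xe i * S.ye j - q⁻¹ • (S.ye j * S.xe i)

/-- The bracket of `X_{2i+2}` and `Y_{2j+1}`. -/
def cB' (i j : ℕ) : R := S.xo i * S.yo j + q⁻¹ • (S.yo j * S.xo i)

lemma xe_K (i : ℕ) : S.xe i * (S.l * S.l) - S.l * S.l * S.xe i = S.xe (i + 1) := by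
  linear_combination (norm := noncomm_ring) S.xo_l i + S.xe_l i * S.l + S.l * S.xe_l i

lemma xo_K (i : ℕ) : S.xo i * (S.l * S.l) - S.l * S.l * S.xo i = S.xo (i + 1) := by
  linear_combination (norm := noncomm_ring) S.xe_l (i + 1) + S.xo_l i * S.l - S.l * S.xo_l i

lemma yo_K (j : ℕ) : S.l * S.l * S.yo j - S.yo j * (S.l * S.l) = S.yo (j + 1) := by
  linear_combination (norm := noncomm_ring) S.ye_l j - S.yo_l j * S.l + S.l * S.yo_l j

lemma ye_K (j : ℕ) : S.l * S.l * S.ye j - S.ye j * (S.l * S.l) = S.ye (j + 1) := by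
  linear_combination (norm := noncomm_ring) S.yo_l (j + 1) + S.ye_l j * S.l + S.l * S.ye_l j

lemma cA_l (i j : ℕ) : S.cA i j * S.l + S.l * S.cA i j = S.cB i j - S.cB' i j := by
  simp only [cA, cB, cB', ← S.xe_l, ← S.yo_l, sub_mul, add_mul, mul_sub, mul_add,
    smul_mul_assoc, mul_smul_comm, mul_assoc]
  module

lemma cB_l (i j : ℕ) : S.cB i j * S.l - S.l * S.cB i j = S.cA' i j - S.cA i (j + 1) := by
  simp only [cA, cB, cA', ← S.xe_l, ← S.ye_l, sub_mul, add_mul, mul_sub, mul_add,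
    smul_mul_assoc, mul_smul_comm, mul_assoc]
  module

lemma cB'_l (i j : ℕ) : S.cB' i j * S.l - S.l * S.cB' i j = S.cA' i j - S.cA (i + 1) j := by
  simp only [cA, cB', cA', ← S.xo_l, ← S.yo_l, sub_mul, add_mul, mul_sub, mul_add,
    smul_mul_assoc, mul_smul_comm, mul_assoc]
  module

lemma cA'_l (i j : ℕ) :
    S.cA' i j * S.l + S.l * S.cA' i j = S.cB (i + 1) j - S.cB' i (j + 1) := by
  simp only [cB, cB', cA', ← S.xo_l, ← S.ye_l, sub_mul, add_mul, mul_sub, mul_add,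
    smul_mul_assoc, mul_smul_comm, mul_assoc]
  module

lemma cA_K (i j : ℕ) : S.cA i j * (S.l * S.l) - S.l * S.l * S.cA i j =
    S.cA (i + 1) j - S.cA i (j + 1) := by
  linear_combination (norm := noncomm_ring) S.cA_l i j * S.l - S.l * S.cA_l i j
    + S.cB_l i j - S.cB'_l i j

lemma cA'_K (i j : ℕ) : S.cA' i j * (S.l * S.l) - S.l * S.l * S.cA' i j =
    S.cA' (i + 1) j - S.cA' i (j + 1) := by
  linear_combination (norm := noncomm_ring) S.cA'_l i j * S.l - S.l * S.cA'_l i j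
    + S.cB_l (i + 1) j - S.cB'_l i (j + 1)

lemma cB_K (i j : ℕ) : S.cB i j * (S.l * S.l) - S.l * S.l * S.cB i j =
    S.cB (i + 1) j - S.cB i (j + 1) := by
  linear_combination (norm := noncomm_ring) S.cB_l i j * S.l + S.l * S.cB_l i j
    + S.cA'_l i j - S.cA_l i (j + 1)

lemma cB'_K (i j : ℕ) : S.cB' i j * (S.l * S.l) - S.l * S.l * S.cB' i j =
    S.cB' (i + 1) j - S.cB' i (j + 1) := by
  linear_combination (norm := noncomm_ring) S.cB'_l i j * S.l + S.l * S.cB'_l i j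
    + S.cA'_l i j - S.cA_l (i + 1) j

lemma cA_zero : S.cA 0 0 = S.l := S.l_eq.symm

/-- Consequences of the Serre relations. -/
lemma xe_cB' (hq : q ≠ 0) (j : ℕ) : S.xe 0 * S.cB' 0 j - S.cB' 0 j * S.xe 0 =
    q⁻¹ • (S.cA 0 j * S.xo 0) + q • (S.xo 0 * S.cA 0 j) := by
  simp only [cA, cB']
  linear_combination (norm := skip) S.serre_x * S.yo j + (q⁻¹ ^ 2) • (S.yo j * S.serre_x)
  simp only [sub_mul, add_mul, mul_sub, mul_add, smul_mul_assoc, mul_smul_comm, mul_assoc]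
  match_scalars <;> field_simp <;> ring

lemma xe_cA' (hq : q ≠ 0) (j : ℕ) : S.xe 0 * S.cA' 0 j - S.cA' 0 j * S.xe 0 =
    q • (S.xo 0 * S.cB 0 j) - q⁻¹ • (S.cB 0 j * S.xo 0) := by
  simp only [cB, cA']
  linear_combination (norm := skip) S.serre_x * S.ye j - (q⁻¹ ^ 2) • (S.ye j * S.serre_x)
  simp only [sub_mul, add_mul, mul_sub, mul_add, smul_mul_assoc, mul_smul_comm, mul_assoc]
  match_scalars <;> field_simp <;> ring

lemma cB_yo (hq : q ≠ 0) (i : ℕ) : S.cB i 0 * S.yo 0 - S.yo 0 * S.cB i 0 =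
    q • (S.cA i 0 * S.ye 0) - q⁻¹ • (S.ye 0 * S.cA i 0) := by
  simp only [cA, cB]
  linear_combination (norm := skip) S.xe i * S.serre_y - (q⁻¹ ^ 2) • (S.serre_y * S.xe i)
  simp only [sub_mul, add_mul, mul_sub, mul_add, smul_mul_assoc, mul_smul_comm, mul_assoc]
  match_scalars <;> field_simp <;> ring

lemma cA'_yo (hq : q ≠ 0) (i : ℕ) : S.cA' i 0 * S.yo 0 + S.yo 0 * S.cA' i 0 =
    q • (S.cB' i 0 * S.ye 0) - q⁻¹ • (S.ye 0 * S.cB' i 0) := by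
  simp only [cA', cB']
  linear_combination (norm := skip) S.xo i * S.serre_y + (q⁻¹ ^ 2) • (S.serre_y * S.xo i)
  simp only [sub_mul, add_mul, mul_sub, mul_add, smul_mul_assoc, mul_smul_comm, mul_assoc]
  match_scalars <;> field_simp <;> ring

/-- The element `L̃₂`. -/
def t : R := S.cB 0 0 - S.l * S.l

lemma cB_zero : S.cB 0 0 = S.t + S.l * S.l := by simp [t]

lemma cB'_zero : S.cB' 0 0 = S.t - S.l * S.l := by
  have h := S.cA_l 0 0
  rw [cA_zero, cB_zero] at h
  linear_combination (norm := noncomm_ring) h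

lemma t_xe_zero (hq : q ≠ 0) : S.t * S.xe 0 - S.xe 0 * S.t =
    (q - q⁻¹) • (S.l * S.xo 0) - (q + 1) • S.xe 1 := by
  have h := S.xe_cB' hq 0
  rw [cA_zero, cB'_zero] at h
  linear_combination (norm := skip) -h - S.xe_K 0 - q • S.xo_l 0
  simp only [sub_mul, add_mul, mul_sub, mul_add, smul_mul_assoc, mul_smul_comm, mul_assoc]
  module

lemma t_yo_zero (hq : q ≠ 0) : S.t * S.yo 0 - S.yo 0 * S.t =
    (q - q⁻¹) • (S.ye 0 * S.l) + (q - 1) • S.yo 1 := by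
  have h := S.cB_yo hq 0
  rw [cA_zero, cB_zero] at h
  linear_combination (norm := skip) h - S.yo_K 0 + q • S.ye_l 0
  simp only [sub_mul, add_mul, mul_sub, mul_add, smul_mul_assoc, mul_smul_comm, mul_assoc]
  module

lemma cA_one : S.cA 1 0 = S.cA 0 1 := by
  have h := S.cA_K 0 0
  rw [cA_zero] at h
  linear_combination (norm := noncomm_ring) -h

lemma t_l_aux (hq : q ≠ 0) : S.t * S.l - S.l * S.t =
    (q - q⁻¹) • (S.l * S.cB' 0 0 + S.cB 0 0 * S.l) - (2 : ℂ) • S.cA 0 1 := by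
  have h : S.t * S.cA 0 0 - S.cA 0 0 * S.t =
      (q - q⁻¹) • (S.l * S.cB' 0 0 + S.cB 0 0 * S.l) - (q + 1) • S.cA 1 0
        + (q - 1) • S.cA 0 1 := by
    simp only [cA, cB, cB']
    linear_combination (norm := skip) S.t_xe_zero hq * S.yo 0 + S.xe 0 * S.t_yo_zero hq
      - q⁻¹ • (S.t_yo_zero hq * S.xe 0 + S.yo 0 * S.t_xe_zero hq)
      - (q⁻¹ * (q - q⁻¹)) • (S.yo_l 0 * S.xo 0 - S.ye 0 * S.xe_l 0)
    simp only [sub_mul, add_mul, mul_sub, mul_add, smul_mul_assoc, mul_smul_comm, mul_assoc]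
    module
  rw [cA_one, cA_zero] at h
  rw [h]
  module

lemma t_l (hq : q ≠ 0) : S.t * S.l - S.l * S.t =
    (2 : ℂ) • S.cA' 0 0 - (q - q⁻¹) • (S.l * S.t + S.t * S.l) := by
  have h := S.t_l_aux hq
  have h2 := S.cB_l 0 0
  rw [cB'_zero, cB_zero] at h
  rw [cB_zero] at h2
  linear_combination (norm := skip) -h + (2 : ℂ) • h2
  simp only [sub_mul, add_mul, mul_sub, mul_add, smul_mul_assoc, mul_smul_comm, mul_assoc]
  module

lemma t_xo_zero (hq : q ≠ 0) (hs : 1 + q + q⁻¹ ≠ 0) : S.t * S.xo 0 - S.xo 0 * S.t =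
    -((q - q⁻¹) • (S.l * S.xe 1)) - (q - 1) • S.xo 1 := by
  have e1 := S.t_xe_zero hq
  have e2 := S.t_l hq
  have e3 := S.xe_cA' hq 0
  rw [cB_zero] at e3
  have e4 := S.xe_l 0
  have h1 : S.t * S.xo 0 - S.xo 0 * S.t = (q - q⁻¹) • (S.l * S.xo 0 * S.l - S.l * S.l * S.xo 0)
      - (q + 1) • S.xo 1 + (2 : ℂ) • (S.xe 0 * S.cA' 0 0 - S.cA' 0 0 * S.xe 0)
      - (q - q⁻¹) • (S.xe 0 * (S.l * S.t + S.t * S.l) - (S.l * S.t + S.t * S.l) * S.xe 0) := by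
    linear_combination (norm := skip) e1 * S.l - S.l * e1 + S.xe 0 * e2 - e2 * S.xe 0
      - S.t * e4 + e4 * S.t - (q + 1) • S.xe_l 1
    simp only [sub_mul, add_mul, mul_sub, mul_add, smul_mul_assoc, mul_smul_comm, mul_assoc]
    module
  suffices h : (1 + q + q⁻¹) • (S.t * S.xo 0 - S.xo 0 * S.t) =
      (1 + q + q⁻¹) • (-((q - q⁻¹) • (S.l * S.xe 1)) - (q - 1) • S.xo 1) from
    smul_right_injective R hs h
  linear_combination (norm := skip) h1 + (2 : ℂ) • e3 - (q - q⁻¹) • (e4 * S.t + S.t * e4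
    - S.l * e1 - e1 * S.l) + ((q - q⁻¹) + (q - q⁻¹) ^ 2) • (S.l * S.xo_l 0)
    + (2 * q) • S.xo_K 0 - ((q - q⁻¹) * (q + 1)) • S.xe_l 1
  simp only [sub_mul, add_mul, mul_sub, mul_add, smul_mul_assoc, mul_smul_comm, mul_assoc]
  match_scalars <;> field_simp <;> ring

lemma t_ye_zero (hq : q ≠ 0) (hs : 1 - q - q⁻¹ ≠ 0) : S.t * S.ye 0 - S.ye 0 * S.t =
    -((q - q⁻¹) • (S.yo 1 * S.l)) + (q + 1) • S.ye 1 := by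
  have e1 := S.t_yo_zero hq
  have e2 := S.t_l hq
  have e3 := S.cA'_yo hq 0
  rw [cB'_zero] at e3
  have e4 := S.yo_l 0
  have h1 : S.t * S.ye 0 - S.ye 0 * S.t = (q - q⁻¹) • (S.l * S.ye 0 * S.l + S.ye 0 * S.l * S.l)
      + (q - 1) • S.ye 1 + (2 : ℂ) • (S.yo 0 * S.cA' 0 0 + S.cA' 0 0 * S.yo 0)
      - (q - q⁻¹) • (S.yo 0 * (S.l * S.t + S.t * S.l) + (S.l * S.t + S.t * S.l) * S.yo 0) := by
    linear_combination (norm := skip) e1 * S.l + S.l * e1 + S.yo 0 * e2 + e2 * S.yo 0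
      - S.t * e4 + e4 * S.t + (q - 1) • S.yo_l 1
    simp only [sub_mul, add_mul, mul_sub, mul_add, smul_mul_assoc, mul_smul_comm, mul_assoc]
    module
  suffices h : (1 - q - q⁻¹) • (S.t * S.ye 0 - S.ye 0 * S.t) =
      (1 - q - q⁻¹) • (-((q - q⁻¹) • (S.yo 1 * S.l)) + (q + 1) • S.ye 1) from
    smul_right_injective R hs h
  linear_combination (norm := skip) h1 + (2 : ℂ) • e3 - (q - q⁻¹) • (e4 * S.t + S.t * e4
    + S.l * e1 - e1 * S.l) + ((q - q⁻¹) - (q - q⁻¹) ^ 2) • (S.ye_l 0 * S.l)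
    - (2 * q) • S.ye_K 0 - ((q - q⁻¹) * (q - 1)) • S.yo_l 1
  simp only [sub_mul, add_mul, mul_sub, mul_add, smul_mul_assoc, mul_smul_comm, mul_assoc]
  match_scalars <;> field_simp <;> ring

/-- The commutation relations of `L̃₂` with `X_{2i+1}` and `X_{2i+2}`. -/
def TX (i : ℕ) : Prop :=
  S.t * S.xe i - S.xe i * S.t = (q - q⁻¹) • (S.l * S.xo i) - (q + 1) • S.xe (i + 1) ∧
  S.t * S.xo i - S.xo i * S.t = -((q - q⁻¹) • (S.l * S.xe (i + 1))) - (q - 1) • S.xo (i + 1)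

/-- The commutation relations of `L̃₂` with `Y_{2j+1}` and `Y_{2j+2}`. -/
def TY (j : ℕ) : Prop :=
  S.t * S.yo j - S.yo j * S.t = (q - q⁻¹) • (S.ye j * S.l) + (q - 1) • S.yo (j + 1) ∧
  S.t * S.ye j - S.ye j * S.t = -((q - q⁻¹) • (S.yo (j + 1) * S.l)) + (q + 1) • S.ye (j + 1)

variable {S} in
lemma t_cA {i j : ℕ} (hx : S.TX i) (hy : S.TY j) : S.t * S.cA i j - S.cA i j * S.t =
    (q - q⁻¹) • (S.l * S.cB' i j + S.cB i j * S.l) - (q + 1) • S.cA (i + 1) j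
      + (q - 1) • S.cA i (j + 1) := by
  simp only [cA, cB, cB']
  linear_combination (norm := skip) hx.1 * S.yo j + S.xe i * hy.1
    - q⁻¹ • (hy.1 * S.xe i + S.yo j * hx.1)
    - (q⁻¹ * (q - q⁻¹)) • (S.yo_l j * S.xo i - S.ye j * S.xe_l i)
  simp only [sub_mul, add_mul, mul_sub, mul_add, smul_mul_assoc, mul_smul_comm, mul_assoc]
  module

variable {S} in
lemma t_cB {i j : ℕ} (hx : S.TX i) (hy : S.TY j) : S.t * S.cB i j - S.cB i j * S.t =
    (q - q⁻¹) • (S.l * S.cA' i j - S.cA i (j + 1) * S.l) - (q + 1) • S.cB (i + 1) j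
      + (q + 1) • S.cB i (j + 1) := by
  simp only [cA, cB, cA']
  linear_combination (norm := skip) hx.1 * S.ye j + S.xe i * hy.2
    - q⁻¹ • (hy.2 * S.xe i + S.ye j * hx.1)
    + (q⁻¹ * (q - q⁻¹)) • (S.ye_l j * S.xo i - S.yo (j + 1) * S.xe_l i)
  simp only [sub_mul, add_mul, mul_sub, mul_add, smul_mul_assoc, mul_smul_comm, mul_assoc,
    mul_neg, neg_mul]
  module

variable {S} in
lemma t_cB' {i j : ℕ} (hx : S.TX i) (hy : S.TY j) : S.t * S.cB' i j - S.cB' i j * S.t =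
    (q - q⁻¹) • (S.cA' i j * S.l - S.l * S.cA (i + 1) j) - (q - 1) • S.cB' (i + 1) j
      + (q - 1) • S.cB' i (j + 1) := by
  simp only [cA, cB', cA']
  linear_combination (norm := skip) hx.2 * S.yo j + S.xo i * hy.1
    + q⁻¹ • (hy.1 * S.xo i + S.yo j * hx.2)
    - (q⁻¹ * (q - q⁻¹)) • (S.yo_l j * S.xe (i + 1) - S.ye j * S.xo_l i)
  simp only [sub_mul, add_mul, mul_sub, mul_add, smul_mul_assoc, mul_smul_comm, mul_assoc,
    mul_neg, neg_mul]
  module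

variable {S} in
lemma t_cA' {i j : ℕ} (hx : S.TX i) (hy : S.TY j) : S.t * S.cA' i j - S.cA' i j * S.t =
    -((q - q⁻¹) • (S.l * S.cB (i + 1) j + S.cB' i (j + 1) * S.l)) - (q - 1) • S.cA' (i + 1) j
      + (q + 1) • S.cA' i (j + 1) := by
  simp only [cA', cB, cB']
  linear_combination (norm := skip) hx.2 * S.ye j + S.xo i * hy.2
    - q⁻¹ • (hy.2 * S.xo i + S.ye j * hx.2)
    + (q⁻¹ * (q - q⁻¹)) • (S.yo (j + 1) * S.xo_l i - S.ye_l j * S.xe (i + 1))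
  simp only [sub_mul, add_mul, mul_sub, mul_add, smul_mul_assoc, mul_smul_comm, mul_assoc,
    mul_neg, neg_mul]
  module

lemma tx_zero (hq : q ≠ 0) (hs : 1 + q + q⁻¹ ≠ 0) : S.TX 0 :=
  ⟨S.t_xe_zero hq, S.t_xo_zero hq hs⟩

lemma ty_zero (hq : q ≠ 0) (hs : 1 - q - q⁻¹ ≠ 0) : S.TY 0 :=
  ⟨S.t_yo_zero hq, S.t_ye_zero hq hs⟩

variable {S} in
/-- If `L₂` and `L₂′` satisfy the commutation relation with `L₁²` measured by a common defect,
then the sum of the commutators with `L̃₂` detects this defect. -/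
lemma t_add {i j : ℕ} (hx : S.TX i) (hy : S.TY j) (hA : S.cA (i + 1) j = S.cA i (j + 1)) :
    S.t * (S.cB i j + S.cB' i j) - (S.cB i j + S.cB' i j) * S.t =
      -((q + q⁻¹) • (S.cB (i + 1) j - S.cB i (j + 1))) := by
  have h1 := t_cB hx hy
  have h2 := t_cB' hx hy
  have h3 := S.cA'_l i j
  have h4 := S.cA_l i (j + 1)
  have h5 := S.cB_K i j
  have h6 := S.cB'_K i j
  have h7 := S.cA_l i j
  have h8 := S.cA_K i j
  rw [hA] at h2 h8
  have h9 : (S.cB (i + 1) j - S.cB i (j + 1)) = (S.cB' (i + 1) j - S.cB' i (j + 1)) := by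
    linear_combination (norm := noncomm_ring) h6 - h5 + h8 * S.l + S.l * h8
      - h7 * S.l * S.l + S.l * S.l * h7
  linear_combination (norm := skip) h1 + h2 + (q - q⁻¹) • (h3 - h4) + (q - 1) • h9
  simp only [sub_mul, add_mul, mul_sub, mul_add]
  module

lemma t_K (hx : S.TX 0) (hy : S.TY 0) (hs : q + q⁻¹ ≠ 0) :
    S.t * (S.l * S.l) = S.l * S.l * S.t := by
  have h := t_add hx hy S.cA_one
  rw [cB'_zero, cB_zero, ← S.cB_K, cB_zero] at h
  have h2 : (q + q⁻¹) • (S.t * (S.l * S.l) - S.l * S.l * S.t) = 0 := by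
    linear_combination (norm := skip) h
    simp only [sub_mul, add_mul, mul_sub, mul_add, mul_assoc]
    module
  exact sub_eq_zero.1 ((smul_eq_zero_iff_right hs).1 h2)

variable {S} in
lemma tx (hK : S.t * (S.l * S.l) = S.l * S.l * S.t) (h0 : S.TX 0) (i : ℕ) : S.TX i := by
  induction i with
  | zero => exact h0
  | succ i ih =>
    obtain ⟨h1, h2⟩ := ih
    constructor
    · have e1 := S.xe_K i
      have e2 := S.xe_K (i + 1)
      have e3 := S.xo_K i
      linear_combination (norm := skip) h1 * (S.l * S.l) - S.l * S.l * h1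
        - S.t * e1 + e1 * S.t + (q - q⁻¹) • (S.l * e3) - (q + 1) • e2
        + S.xe i * hK - hK * S.xe i
      simp only [sub_mul, add_mul, mul_sub, mul_add, smul_mul_assoc, mul_smul_comm, mul_assoc]
      module
    · have e1 := S.xo_K i
      have e2 := S.xo_K (i + 1)
      have e3 := S.xe_K (i + 1)
      linear_combination (norm := skip) h2 * (S.l * S.l) - S.l * S.l * h2
        - S.t * e1 + e1 * S.t - (q - q⁻¹) • (S.l * e3) - (q - 1) • e2
        + S.xo i * hK - hK * S.xo i
      simp only [sub_mul, add_mul, mul_sub, mul_add, smul_mul_assoc, mul_smul_comm, mul_assoc,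
        neg_mul, mul_neg]
      module

variable {S} in
lemma ty (hK : S.t * (S.l * S.l) = S.l * S.l * S.t) (h0 : S.TY 0) (j : ℕ) : S.TY j := by
  induction j with
  | zero => exact h0
  | succ j ih =>
    obtain ⟨h1, h2⟩ := ih
    constructor
    · have e1 := S.yo_K j
      have e2 := S.yo_K (j + 1)
      have e3 := S.ye_K j
      linear_combination (norm := skip) S.l * S.l * h1 - h1 * (S.l * S.l)
        - S.t * e1 + e1 * S.t + (q - q⁻¹) • (e3 * S.l) + (q - 1) • e2
        - S.yo j * hK + hK * S.yo j
      simp only [sub_mul, add_mul, mul_sub, mul_add, smul_mul_assoc, mul_smul_comm, mul_assoc]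
      module
    · have e1 := S.ye_K j
      have e2 := S.ye_K (j + 1)
      have e3 := S.yo_K (j + 1)
      linear_combination (norm := skip) S.l * S.l * h2 - h2 * (S.l * S.l)
        - S.t * e1 + e1 * S.t - (q - q⁻¹) • (e3 * S.l) + (q + 1) • e2
        - S.ye j * hK + hK * S.ye j
      simp only [sub_mul, add_mul, mul_sub, mul_add, smul_mul_assoc, mul_smul_comm, mul_assoc,
        neg_mul, mul_neg]
      module

end

section

variable {q : ℂ} {R : Type*} [Ring R] [Algebra ℂ R] (S : Currents q R)

/-- `L_{2m+1}`. -/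
def A (m : ℕ) : R := S.cA 0 m

/-- `L′_{2m+1}`. -/
def A' : ℕ → R
  | 0 => S.l
  | m + 1 => S.cA' 0 m

/-- `L_{2m}`. -/
def B : ℕ → R
  | 0 => (q - q⁻¹)⁻¹ • 1
  | m + 1 => S.cB 0 m

/-- `L′_{2m}`. -/
def B' : ℕ → R
  | 0 => (q - q⁻¹)⁻¹ • 1
  | m + 1 => S.cB' 0 m

/-- Up to level `k`, the brackets of real root vectors depend only on the sum of the indices. -/
structure Inv (k : ℕ) : Prop where
  cA : ∀ i j, i + j ≤ k + 1 → S.cA i j = S.cA 0 (i + j)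
  cB : ∀ i j, i + j ≤ k → S.cB i j = S.cB 0 (i + j)
  cB' : ∀ i j, i + j ≤ k → S.cB' i j = S.cB' 0 (i + j)
  cA' : ∀ i j, i + j ≤ k → S.cA' i j = S.cA' 0 (i + j)

variable {S}

lemma Inv.A_K {k m : ℕ} (h : S.Inv k) (hm : m ≤ k) : Commute (S.A m) (S.l * S.l) := by
  have e := S.cA_K 0 m
  rw [h.cA (0 + 1) m (by omega), show 0 + 1 + m = m + 1 by omega, sub_self] at e
  exact sub_eq_zero.1 e

lemma Inv.A'_K {k m : ℕ} (h : S.Inv k) (hm : m ≤ k) : Commute (S.A' m) (S.l * S.l) := by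
  cases m with
  | zero => exact ((Commute.refl S.l).mul_right (Commute.refl S.l))
  | succ m =>
    have e := S.cA'_K 0 m
    rw [h.cA' (0 + 1) m (by omega), show 0 + 1 + m = m + 1 by omega, sub_self] at e
    exact sub_eq_zero.1 e

lemma Inv.B_K {k m : ℕ} (h : S.Inv k) (hm : m ≤ k) : Commute (S.B m) (S.l * S.l) := by
  cases m with
  | zero => exact (Commute.one_left _).smul_left _
  | succ m =>
    have e := S.cB_K 0 m
    rw [h.cB (0 + 1) m (by omega), show 0 + 1 + m = m + 1 by omega, sub_self] at e
    exact sub_eq_zero.1 e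

lemma Inv.B'_K {k m : ℕ} (h : S.Inv k) (hm : m ≤ k) : Commute (S.B' m) (S.l * S.l) := by
  cases m with
  | zero => exact (Commute.one_left _).smul_left _
  | succ m =>
    have e := S.cB'_K 0 m
    rw [h.cB' (0 + 1) m (by omega), show 0 + 1 + m = m + 1 by omega, sub_self] at e
    exact sub_eq_zero.1 e

variable (S) in
lemma A_l (m : ℕ) : S.A m * S.l + S.l * S.A m = S.B (m + 1) - S.B' (m + 1) := S.cA_l 0 m

lemma A_zero : S.A 0 = S.l := S.cA_zero

variable (S) in
lemma B_l (m : ℕ) : S.B m * S.l - S.l * S.B m = S.A' m - S.A m := by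
  cases m with
  | zero => simp [B, A', A_zero]
  | succ m => exact S.cB_l 0 m

lemma Inv.B'_l {k m : ℕ} (h : S.Inv k) (hm : m ≤ k + 1) :
    S.B' m * S.l - S.l * S.B' m = S.A' m - S.A m := by
  cases m with
  | zero => simp [B', A', A_zero]
  | succ m =>
    have e := S.cB'_l 0 m
    rwa [h.cA (0 + 1) m (by omega), show 0 + 1 + m = m + 1 by omega] at e

lemma Inv.A'_l {k m : ℕ} (h : S.Inv k) (hm : m ≤ k) :
    S.A' m * S.l + S.l * S.A' m = S.B (m + 1) - S.B' (m + 1) := by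
  cases m with
  | zero => rw [← S.A_l, A_zero]; rfl
  | succ m =>
    have e := S.cA'_l 0 m
    rwa [h.cB (0 + 1) m (by omega), show 0 + 1 + m = m + 1 by omega] at e

variable (S) in
/-- The commutation relations of `L̃₂` with all real root vectors. -/
def T : Prop := (∀ i, S.TX i) ∧ ∀ j, S.TY j

lemma Inv.t_A {k m : ℕ} (h : S.Inv k) (hT : S.T) (hm : m ≤ k) : S.t * S.A m - S.A m * S.t =
    (q - q⁻¹) • (S.l * S.B' (m + 1) + S.B (m + 1) * S.l) - (2 : ℂ) • S.A (m + 1) := by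
  have e := t_cA (hT.1 0) (hT.2 m)
  rw [h.cA (0 + 1) m (by omega), show 0 + 1 + m = m + 1 by omega] at e
  simp only [A, B, B']
  rw [e]
  module

lemma Inv.t_A' {k m : ℕ} (h : S.Inv k) (hq : q ≠ 0) (hT : S.T) (hm : m ≤ k) :
    S.t * S.A' m - S.A' m * S.t = (2 : ℂ) • S.A' (m + 1)
      - (q - q⁻¹) • (S.l * S.B (m + 1) + S.B' (m + 1) * S.l) := by
  cases m with
  | zero =>
    have e := S.t_l hq
    simp only [A', B, B', cB_zero, cB'_zero]
    rw [e]
    simp only [mul_add, sub_mul, mul_assoc]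
    module
  | succ m =>
    have e := t_cA' (hT.1 0) (hT.2 m)
    rw [h.cA' (0 + 1) m (by omega), h.cB (0 + 1) m (by omega),
      show 0 + 1 + m = m + 1 by omega] at e
    simp only [A', B, B']
    rw [e]
    module

lemma Inv.t_B {k m : ℕ} (h : S.Inv k) (hT : S.T) (hm : m ≤ k) :
    S.t * S.B m - S.B m * S.t = (q - q⁻¹) • (S.l * S.A' m - S.A m * S.l) := by
  cases m with
  | zero => simp [B, A', A_zero]
  | succ m =>
    have e := t_cB (hT.1 0) (hT.2 m)
    rw [h.cB (0 + 1) m (by omega), show 0 + 1 + m = m + 1 by omega] at e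
    simp only [A', A, B]
    rw [e]
    module

lemma Inv.t_B' {k m : ℕ} (h : S.Inv k) (hT : S.T) (hm : m ≤ k) :
    S.t * S.B' m - S.B' m * S.t = (q - q⁻¹) • (S.A' m * S.l - S.l * S.A m) := by
  cases m with
  | zero => simp [B', A', A_zero]
  | succ m =>
    have e := t_cB' (hT.1 0) (hT.2 m)
    rw [h.cB' (0 + 1) m (by omega), h.cA (0 + 1) m (by omega),
      show 0 + 1 + m = m + 1 by omega] at e
    simp only [A', A, B']
    rw [e]
    module

/-- A relation between `u`, `v` and two sequences generated by the derivation `[·, k]` propagates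
along the sequences when `u` and `v` commute with `k`. -/
lemma shift {k u v : R} {f g : ℕ → R} (hf : ∀ i, f i * k - k * f i = f (i + 1))
    (hg : ∀ i, g i * k - k * g i = g (i + 1)) (hu : Commute u k) (hv : Commute v k) {a b c : ℂ}
    (h0 : u * f 0 + a • (f 0 * u) = b • (v * g 0) + c • (g 0 * v)) (i : ℕ) :
    u * f i + a • (f i * u) = b • (v * g i) + c • (g i * v) := by
  induction i with
  | zero => exact h0
  | succ i ih =>
    have hu := hu.eq
    have hv := hv.eq
    rw [← hf, ← hg]
    linear_combination (norm := skip) ih * k - k * ih - hu * f i - a • (f i * hu)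
      + b • (hv * g i) + c • (g i * hv)
    simp only [sub_mul, add_mul, mul_sub, mul_add, smul_mul_assoc, mul_smul_comm, mul_assoc]
    module

lemma A'_xe (hθ : q - q⁻¹ ≠ 0) (hq : q ≠ 0) (m : ℕ) :
    S.A' m * S.xe 0 - S.xe 0 * S.A' m = q⁻¹ • (S.B m * S.xo 0) - q • (S.xo 0 * S.B m) := by
  cases m with
  | zero =>
    have e := S.xe_l 0
    simp only [A', B, smul_mul_assoc, mul_smul_comm, one_mul, mul_one]
    have hc : S.xo 0 = (q - q⁻¹) • (q - q⁻¹)⁻¹ • S.xo 0 := (smul_inv_smul₀ hθ _).symm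
    linear_combination (norm := module) -e - hc
  | succ m =>
    have e := S.xe_cA' hq m
    simp only [A', B]
    linear_combination (norm := module) -e

variable (S) in
lemma B'_xe (hq : q ≠ 0) (m : ℕ) : S.B' (m + 1) * S.xe 0 - S.xe 0 * S.B' (m + 1) =
    -(q⁻¹ • (S.A m * S.xo 0)) - q • (S.xo 0 * S.A m) := by
  have e := S.xe_cB' hq m
  simp only [A, B']
  linear_combination (norm := module) -e

lemma Inv.A'_xe_one {k m : ℕ} (h : S.Inv k) (hθ : q - q⁻¹ ≠ 0) (hq : q ≠ 0) (hm : m ≤ k) :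
    S.A' m * S.xe 1 - S.xe 1 * S.A' m = q⁻¹ • (S.B m * S.xo 1) - q • (S.xo 1 * S.B m) := by
  have e := S.A'_xe hθ hq m
  linear_combination (norm := module) shift (a := -1) (b := q⁻¹) (c := -q)
    S.xe_K S.xo_K (h.A'_K hm) (h.B_K hm) (by linear_combination (norm := module) e) 1

lemma Inv.B'_xe_one {k m : ℕ} (h : S.Inv k) (hq : q ≠ 0) (hm : m + 1 ≤ k) :
    S.B' (m + 1) * S.xe 1 - S.xe 1 * S.B' (m + 1) =
      -(q⁻¹ • (S.A m * S.xo 1)) - q • (S.xo 1 * S.A m) := by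
  have e := S.B'_xe hq m
  linear_combination (norm := module) shift (a := -1) (b := -q⁻¹) (c := -q)
    S.xe_K S.xo_K (h.B'_K hm) (h.A_K (m := m) (by omega))
    (by linear_combination (norm := module) e) 1

lemma Inv.B_yo {k m : ℕ} (h : S.Inv k) (hq : q ≠ 0) (hm : m + 1 ≤ k) (j : ℕ) :
    S.B (m + 1) * S.yo j - S.yo j * S.B (m + 1) =
      q • (S.A m * S.ye j) - q⁻¹ • (S.ye j * S.A m) := by
  have e := S.cB_yo hq m
  rw [h.cB m 0 (by omega), h.cA m 0 (by omega)] at e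
  change S.B (m + 1) * S.yo 0 - S.yo 0 * S.B (m + 1) =
    q • (S.A m * S.ye 0) - q⁻¹ • (S.ye 0 * S.A m) at e
  linear_combination (norm := module) shift (a := -1) (b := q) (c := -q⁻¹) (k := -(S.l * S.l))
      (f := S.yo) (g := S.ye)
    (fun i => by rw [mul_neg, neg_mul, ← S.yo_K]; abel)
    (fun i => by rw [mul_neg, neg_mul, ← S.ye_K]; abel)
    (h.B_K hm).neg_right (h.A_K (m := m) (by omega)).neg_right
    (by linear_combination (norm := module) e) j

lemma Inv.A'_yo {k m : ℕ} (h : S.Inv k) (hθ : q - q⁻¹ ≠ 0) (hq : q ≠ 0) (hm : m ≤ k) (j : ℕ) :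
    S.A' m * S.yo j + S.yo j * S.A' m =
      q • (S.B' m * S.ye j) - q⁻¹ • (S.ye j * S.B' m) := by
  cases m with
  | zero =>
    have e := S.yo_l j
    simp only [A', B', smul_mul_assoc, mul_smul_comm, one_mul, mul_one]
    have hc : S.ye j = (q - q⁻¹) • (q - q⁻¹)⁻¹ • S.ye j := (smul_inv_smul₀ hθ _).symm
    linear_combination (norm := module) e + hc
  | succ m =>
    have e := S.cA'_yo hq m
    rw [h.cB' m 0 (by omega), h.cA' m 0 (by omega)] at e
    change S.A' (m + 1) * S.yo 0 + S.yo 0 * S.A' (m + 1) =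
      q • (S.B' (m + 1) * S.ye 0) - q⁻¹ • (S.ye 0 * S.B' (m + 1)) at e
    linear_combination (norm := module) shift (a := 1) (b := q) (c := -q⁻¹) (k := -(S.l * S.l))
      (f := S.yo) (g := S.ye)
      (fun i => by rw [mul_neg, neg_mul, ← S.yo_K]; abel)
      (fun i => by rw [mul_neg, neg_mul, ← S.ye_K]; abel)
      (h.A'_K hm).neg_right (h.B'_K hm).neg_right
      (by linear_combination (norm := module) e) j

end

section

variable {q : ℂ} {R : Type*} [Ring R] [Algebra ℂ R] {S : Currents q R}

lemma Inv.B_xo {k m : ℕ} (h : S.Inv k) (hθ : q - q⁻¹ ≠ 0) (hq : q ≠ 0) (hs : q + q⁻¹ ≠ 0)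
    (hT : S.T) (hm : m ≤ k) : S.B (m + 1) * S.xo 0 - S.xo 0 * S.B (m + 1) =
      q⁻¹ • (S.A' m * S.xe 1) - q • (S.xe 1 * S.A' m) := by
  have h1 := S.A'_xe hθ hq m
  have h1s := h.A'_xe_one hθ hq hm
  have h1p := S.A'_xe hθ hq (m + 1)
  have h2 := S.B'_xe hq m
  have da := h.A'_l hm
  have db := S.B_l m
  have ta := h.t_A' hq hT hm
  have tb := h.t_B hT hm
  have tx : S.t * S.xe 0 - S.xe 0 * S.t = _ := (hT.1 0).1
  have ty : S.t * S.xo 0 - S.xo 0 * S.t = _ := (hT.1 0).2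
  have lx := S.xe_l 0
  have ly := S.xo_l 0
  rw [zero_add] at tx ty ly
  have h5 : S.B (m + 1) * S.xe 0 - S.xe 0 * S.B (m + 1) =
      q⁻¹ • (S.B m * S.xe 1) - q • (S.xe 1 * S.B m) - (1 + q⁻¹) • (S.A' m * S.xo 0)
        - (1 + q) • (S.xo 0 * S.A' m) := by
    linear_combination (norm := skip) h2 - da * S.xe 0 + S.xe 0 * da - S.A' m * lx - lx * S.A' m
      + h1 * S.l + S.l * h1 + q⁻¹ • (S.B m * ly - db * S.xo 0) - q • (S.xo 0 * db + ly * S.B m)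
    simp only [sub_mul, add_mul, mul_sub, mul_add, smul_mul_assoc, mul_smul_comm, mul_assoc,
      neg_mul, mul_neg]
    module
  refine smul_right_injective R hs (?_ : (q + q⁻¹) • _ = (q + q⁻¹) • _)
  linear_combination (norm := skip) (S.t * h1 - h1 * S.t) - (ta * S.xe 0 + S.A' m * tx
    - tx * S.A' m - S.xe 0 * ta - q⁻¹ • (tb * S.xo 0 + S.B m * ty)
    + q • (ty * S.B m + S.xo 0 * tb)) - (2 : ℂ) • h1p + (q - 1) • h1s
    + (q - q⁻¹) • (S.l * h5 + h2 * S.l - lx * S.B (m + 1) - S.B' (m + 1) * lx - da * S.xo 0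
      - q • (ly * S.A' m) - q⁻¹ • (S.A m * ly + db * S.xe 1))
  simp only [sub_mul, add_mul, mul_sub, mul_add, smul_mul_assoc, mul_smul_comm, mul_assoc,
    neg_mul, mul_neg]
  match_scalars <;> field_simp <;> ring

lemma Inv.A_xo {k m : ℕ} (h : S.Inv k) (hθ : q - q⁻¹ ≠ 0) (hq : q ≠ 0) (hs : q + q⁻¹ ≠ 0)
    (hT : S.T) (hm : m ≤ k) : S.A m * S.xo 0 + S.xo 0 * S.A m =
      q • (S.xe 1 * S.B' m) - q⁻¹ • (S.B' m * S.xe 1) := by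
  cases m with
  | zero =>
    have e := S.xo_l 0
    rw [A_zero]
    simp only [B', smul_mul_assoc, mul_smul_comm, one_mul, mul_one]
    have hc : S.xe 1 = (q - q⁻¹) • (q - q⁻¹)⁻¹ • S.xe 1 := (smul_inv_smul₀ hθ _).symm
    linear_combination (norm := module) e + hc
  | succ m =>
  have h2 := S.B'_xe hq m
  have h2s := h.B'_xe_one hq hm
  have h1p := S.A'_xe hθ hq (m + 1)
  have dc := h.B'_l (m := m + 1) (by omega)
  have da := S.A_l m
  have tc := h.t_B' hT hm
  have ta := h.t_A (m := m) hT (by omega)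
  have tx : S.t * S.xe 0 - S.xe 0 * S.t = _ := (hT.1 0).1
  have ty : S.t * S.xo 0 - S.xo 0 * S.t = _ := (hT.1 0).2
  have lx := S.xe_l 0
  have ly := S.xo_l 0
  rw [zero_add] at tx ty ly
  have h6 : S.A (m + 1) * S.xe 0 - S.xe 0 * S.A (m + 1) =
      (1 + q⁻¹) • (S.B' (m + 1) * S.xo 0) - (1 + q) • (S.xo 0 * S.B' (m + 1))
        + q⁻¹ • (S.A m * S.xe 1) - q • (S.xe 1 * S.A m) := by
    linear_combination (norm := skip) h1p - (h2 * S.l - S.l * h2 - S.B' (m + 1) * lx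
      + lx * S.B' (m + 1) - dc * S.xe 0 + S.xe 0 * dc - q⁻¹ • (S.A m * ly - da * S.xo 0)
      - q • (S.xo 0 * da - ly * S.A m))
    simp only [sub_mul, add_mul, mul_sub, mul_add, smul_mul_assoc, mul_smul_comm, mul_assoc,
      neg_mul, mul_neg]
    module
  refine smul_right_injective R hs (?_ : (q + q⁻¹) • _ = (q + q⁻¹) • _)
  linear_combination (norm := skip) -((S.t * h2 - h2 * S.t) - (tc * S.xe 0 + S.B' (m + 1) * tx
    - tx * S.B' (m + 1) - S.xe 0 * tc + q⁻¹ • (ta * S.xo 0 + S.A m * ty)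
    + q • (ty * S.A m + S.xo 0 * ta)) + (q - 1) • h2s
    + (q - q⁻¹) • (S.A' (m + 1) * lx - lx * S.A (m + 1) - h1p * S.l + S.l * h6
      - q⁻¹ • (S.B (m + 1) * ly) - dc * S.xo 0 - q • (ly * S.B' (m + 1)) + q⁻¹ • (da * S.xe 1)))
  simp only [sub_mul, add_mul, mul_sub, mul_add, smul_mul_assoc, mul_smul_comm, mul_assoc,
    neg_mul, mul_neg]
  match_scalars <;> field_simp <;> ring

lemma Inv.A_ye {k m : ℕ} (h : S.Inv k) (hθ : q - q⁻¹ ≠ 0) (hq : q ≠ 0) (hs : q + q⁻¹ ≠ 0)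
    (hT : S.T) (hm : m ≤ k) (j : ℕ) : S.A m * S.ye j - S.ye j * S.A m =
      q • (S.B m * S.yo (j + 1)) - q⁻¹ • (S.yo (j + 1) * S.B m) := by
  cases m with
  | zero =>
    have e := S.ye_l j
    rw [A_zero]
    simp only [B, smul_mul_assoc, mul_smul_comm, one_mul, mul_one]
    have hc : S.yo (j + 1) = (q - q⁻¹) • (q - q⁻¹)⁻¹ • S.yo (j + 1) := (smul_inv_smul₀ hθ _).symm
    linear_combination (norm := module) e + hc
  | succ m =>
  have g1 := h.B_yo hq hm j
  have g1s := h.B_yo hq hm (j + 1)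
  have g2p := h.A'_yo hθ hq hm j
  have db := S.B_l (m + 1)
  have da := S.A_l m
  have tb := h.t_B hT hm
  have ta := h.t_A (m := m) hT (by omega)
  have tw := (hT.2 j).1
  have tz := (hT.2 j).2
  have lw := S.yo_l j
  have lz := S.ye_l j
  have g6 : S.A (m + 1) * S.yo j + S.yo j * S.A (m + 1) =
      (q - 1) • (S.B (m + 1) * S.ye j) + (1 - q⁻¹) • (S.ye j * S.B (m + 1))
        - q • (S.A m * S.yo (j + 1)) - q⁻¹ • (S.yo (j + 1) * S.A m) := by
    linear_combination (norm := skip) g2p + (S.l * g1 + g1 * S.l + db * S.yo j + S.yo j * db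
      - S.B (m + 1) * lw + lw * S.B (m + 1) + q • (da * S.ye j - S.A m * lz)
      - q⁻¹ • (lz * S.A m + S.ye j * da))
    simp only [sub_mul, add_mul, mul_sub, mul_add, smul_mul_assoc, mul_smul_comm, mul_assoc,
      neg_mul, mul_neg]
    module
  refine smul_right_injective R hs (?_ : (q + q⁻¹) • _ = (q + q⁻¹) • _)
  linear_combination (norm := skip) (S.t * g1 - g1 * S.t) - (tb * S.yo j + S.B (m + 1) * tw
    - tw * S.B (m + 1) - S.yo j * tb - q • (ta * S.ye j + S.A m * tz)
    + q⁻¹ • (tz * S.A m + S.ye j * ta)) - (q + 1) • g1s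
    + (q - q⁻¹) • (S.A (m + 1) * lw + lw * S.A' (m + 1) - S.l * g2p - g6 * S.l
      + q⁻¹ • (lz * S.B' (m + 1)) + q • (S.B (m + 1) * lz) - S.ye j * db
      + q⁻¹ • (S.yo (j + 1) * da))
  simp only [sub_mul, add_mul, mul_sub, mul_add, smul_mul_assoc, mul_smul_comm, mul_assoc,
    neg_mul, mul_neg]
  match_scalars <;> field_simp <;> ring

lemma Inv.B'_ye {k m : ℕ} (h : S.Inv k) (hθ : q - q⁻¹ ≠ 0) (hq : q ≠ 0) (hs : q + q⁻¹ ≠ 0)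
    (hT : S.T) (hm : m + 1 ≤ k) (j : ℕ) : S.B' (m + 1) * S.ye j - S.ye j * S.B' (m + 1) =
      q • (S.A' m * S.yo (j + 1)) + q⁻¹ • (S.yo (j + 1) * S.A' m) := by
  have hm' : m ≤ k := by omega
  have g1 := h.B_yo hq hm j
  have g2 := h.A'_yo hθ hq hm' j
  have g2s := h.A'_yo hθ hq hm' (j + 1)
  have g2p := h.A'_yo hθ hq hm j
  have dc := h.B'_l (m := m) (by omega)
  have da := h.A'_l hm'
  have tc := h.t_B' hT hm'
  have ta := h.t_A' hq hT hm'
  have tw := (hT.2 j).1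
  have tz := (hT.2 j).2
  have lw := S.yo_l j
  have lz := S.ye_l j
  have g5 : S.B' (m + 1) * S.yo j - S.yo j * S.B' (m + 1) =
      (q - 1) • (S.A' m * S.ye j) + (1 - q⁻¹) • (S.ye j * S.A' m)
        - q • (S.B' m * S.yo (j + 1)) + q⁻¹ • (S.yo (j + 1) * S.B' m) := by
    linear_combination (norm := skip) g1 + da * S.yo j - S.yo j * da - S.A' m * lw + lw * S.A' m
      + g2 * S.l - S.l * g2 + q • (dc * S.ye j - S.B' m * lz)
      - q⁻¹ • (S.ye j * dc - lz * S.B' m)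
    simp only [sub_mul, add_mul, mul_sub, mul_add, smul_mul_assoc, mul_smul_comm, mul_assoc,
      neg_mul, mul_neg]
    module
  refine smul_right_injective R hs (?_ : (q + q⁻¹) • _ = (q + q⁻¹) • _)
  linear_combination (norm := skip) (S.t * g2 - g2 * S.t) - (ta * S.yo j + S.A' m * tw
    + tw * S.A' m + S.yo j * ta - q • (tc * S.ye j + S.B' m * tz)
    + q⁻¹ • (tz * S.B' m + S.ye j * tc)) - (2 : ℂ) • g2p - (q + 1) • g2s
    + (q - q⁻¹) • (S.B' (m + 1) * lw + lw * S.B (m + 1) + S.l * g1 - g5 * S.l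
      - q⁻¹ • (lz * S.A m) + q • (S.A' m * lz) - S.ye j * da - q⁻¹ • (S.yo (j + 1) * dc))
  simp only [sub_mul, add_mul, mul_sub, mul_add, smul_mul_assoc, mul_smul_comm, mul_assoc,
    neg_mul, mul_neg]
  match_scalars <;> field_simp <;> ring

lemma Inv.B_comm_cB' {k m : ℕ} (h : S.Inv k) (hθ : q - q⁻¹ ≠ 0) (hq : q ≠ 0) (hs : q + q⁻¹ ≠ 0)
    (hT : S.T) (hm : m + 1 ≤ k) (j : ℕ) :
    S.B (m + 1) * S.cB' 0 j - S.cB' 0 j * S.B (m + 1) =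
      q⁻¹ • (S.A' m * S.cA 1 j) + q • (S.cA 1 j * S.A' m) - q • (S.A m * S.cA' 0 j)
        - q⁻¹ • (S.cA' 0 j * S.A m) + (S.cB 1 j * S.B' m - S.B' m * S.cB 1 j) := by
  have h3 := h.B_xo hθ hq hs hT (m := m) (by omega)
  have h4 := h.A_xo hθ hq hs hT (m := m) (by omega)
  have g1 := h.B_yo hq hm j
  have g2 := h.A'_yo hθ hq (m := m) (by omega) j
  simp only [Currents.cA, Currents.cA', Currents.cB, Currents.cB']
  linear_combination (norm := skip) h3 * S.yo j + S.xo 0 * g1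
    + q⁻¹ • (g1 * S.xo 0 + S.yo j * h3) - q • (S.xe 1 * g2) + q⁻¹ ^ 2 • (g2 * S.xe 1)
    + q • (h4 * S.ye j) - q⁻¹ ^ 2 • (S.ye j * h4)
  simp only [sub_mul, add_mul, mul_sub, mul_add, smul_mul_assoc, mul_smul_comm, mul_assoc,
    neg_mul, mul_neg]
  match_scalars <;> field_simp <;> ring

lemma Inv.B'_comm_cB {k m : ℕ} (h : S.Inv k) (hθ : q - q⁻¹ ≠ 0) (hq : q ≠ 0) (hs : q + q⁻¹ ≠ 0)
    (hT : S.T) (hm : m + 1 ≤ k) (j : ℕ) :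
    S.B' (m + 1) * S.cB 0 j - S.cB 0 j * S.B' (m + 1) =
      q • (S.A' m * S.cA 0 (j + 1)) + q⁻¹ • (S.cA 0 (j + 1) * S.A' m)
        - q⁻¹ • (S.A m * S.cA' 0 j) - q • (S.cA' 0 j * S.A m)
        + (S.cB' 0 (j + 1) * S.B m - S.B m * S.cB' 0 (j + 1)) := by
  have h1 := S.A'_xe hθ hq m
  have h2 := S.B'_xe hq m
  have g3 := h.A_ye hθ hq hs hT (m := m) (by omega) j
  have g4 := h.B'_ye hθ hq hs hT hm j
  simp only [Currents.cA, Currents.cA', Currents.cB, Currents.cB']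
  linear_combination (norm := skip) h2 * S.ye j + S.xe 0 * g4
    - q⁻¹ • (g4 * S.xe 0 + S.ye j * h2) - q • (S.xo 0 * g3) - q⁻¹ ^ 2 • (g3 * S.xo 0)
    - q • (h1 * S.yo (j + 1)) - q⁻¹ ^ 2 • (S.yo (j + 1) * h1)
  simp only [sub_mul, add_mul, mul_sub, mul_add, smul_mul_assoc, mul_smul_comm, mul_assoc,
    neg_mul, mul_neg]
  match_scalars <;> field_simp <;> ring

lemma Inv.A'_comm_cA {k m : ℕ} (h : S.Inv k) (hθ : q - q⁻¹ ≠ 0) (hq : q ≠ 0)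
    (hm : m + 1 ≤ k) (j : ℕ) :
    S.A' (m + 1) * S.cA 0 j + S.cA 0 j * S.A' (m + 1) =
      q⁻¹ • (S.B (m + 1) * S.cB' 0 j) - q • (S.cB' 0 j * S.B (m + 1))
        + q • (S.B' (m + 1) * S.cB 0 j) - q⁻¹ • (S.cB 0 j * S.B' (m + 1))
        + (S.A m * S.cA' 0 j + S.cA' 0 j * S.A m) := by
  have h1 := S.A'_xe hθ hq (m + 1)
  have h2 := S.B'_xe hq m
  have g1 := h.B_yo hq hm j
  have g2 := h.A'_yo hθ hq hm j
  simp only [Currents.cA, Currents.cA', Currents.cB, Currents.cB']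
  linear_combination (norm := skip) h1 * S.yo j + S.xe 0 * g2
    - q⁻¹ • (g2 * S.xe 0 - S.yo j * h1) - q • (S.xo 0 * g1) - q • (h2 * S.ye j)
    - q⁻¹ ^ 2 • (g1 * S.xo 0) + q⁻¹ ^ 2 • (S.ye j * h2)
  simp only [sub_mul, add_mul, mul_sub, mul_add, smul_mul_assoc, mul_smul_comm, mul_assoc,
    neg_mul, mul_neg]
  match_scalars <;> field_simp <;> ring

lemma Inv.A_comm_cA' {k m : ℕ} (h : S.Inv k) (hθ : q - q⁻¹ ≠ 0) (hq : q ≠ 0) (hs : q + q⁻¹ ≠ 0)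
    (hT : S.T) (hm : m + 1 ≤ k) (j : ℕ) :
    S.A (m + 1) * S.cA' 0 j + S.cA' 0 j * S.A (m + 1) =
      q • (S.cB 1 j * S.B' (m + 1)) - q⁻¹ • (S.B' (m + 1) * S.cB 1 j)
        + q⁻¹ • (S.cB' 0 (j + 1) * S.B (m + 1)) - q • (S.B (m + 1) * S.cB' 0 (j + 1))
        + (S.A' m * S.cA 1 (j + 1) + S.cA 1 (j + 1) * S.A' m) := by
  have h3 := h.B_xo hθ hq hs hT (m := m) (by omega)
  have h4 := h.A_xo hθ hq hs hT hm
  have g3 := h.A_ye hθ hq hs hT hm j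
  have g4 := h.B'_ye hθ hq hs hT hm j
  simp only [Currents.cA, Currents.cA', Currents.cB, Currents.cB']
  linear_combination (norm := skip) h4 * S.ye j - S.xo 0 * g3
    - q⁻¹ • (g3 * S.xo 0 + S.ye j * h4) + q • (S.xe 1 * g4) - q⁻¹ ^ 2 • (g4 * S.xe 1)
    + q • (h3 * S.yo (j + 1)) + q⁻¹ ^ 2 • (S.yo (j + 1) * h3)
  simp only [sub_mul, add_mul, mul_sub, mul_add, smul_mul_assoc, mul_smul_comm, mul_assoc,
    neg_mul, mul_neg]
  match_scalars <;> field_simp <;> ring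

end

section

variable {q : ℂ} {R : Type*} [Ring R] [Algebra ℂ R] {S : Currents q R}

omit [Algebra ℂ R] in
lemma extend {c : ℕ → ℕ → R} {x : R} (hc : ∀ i j, c i j * x - x * c i j = c (i + 1) j - c i (j + 1))
    {k : ℕ} (h : ∀ i j, i + j ≤ k → c i j = c 0 (i + j)) (hx : Commute (c 0 k) x) :
    ∀ i j, i + j ≤ k + 1 → c i j = c 0 (i + j) := by
  intro i
  induction i with
  | zero => intro j _; rw [zero_add]
  | succ i ih =>
    intro j hij
    obtain hlt | heq : i + 1 + j ≤ k ∨ i + j = k := by omega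
    · exact h _ _ hlt
    · have e := hc i j
      rw [h i j heq.le, heq, hx.eq, sub_self, eq_comm, sub_eq_zero] at e
      rw [e, ih (j + 1) (by omega)]
      congr 1
      omega

/-- Passing to the next level once `L_{2k+2}` is known to commute with `L₁²`. -/
lemma Inv.succ {k : ℕ} (h : S.Inv k) (hT : S.T) (hK : Commute S.t (S.l * S.l))
    (hB : Commute (S.B (k + 1)) (S.l * S.l)) : S.Inv (k + 1) := by
  have hl : Commute S.l (S.l * S.l) := (Commute.refl S.l).mul_right (Commute.refl S.l)
  have hA := h.A_K le_rfl
  have hB' : Commute (S.B' (k + 1)) (S.l * S.l) := by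
    have e : S.B' (k + 1) = S.B (k + 1) - (S.A k * S.l + S.l * S.A k) := by
      rw [S.A_l]; abel
    rw [e]
    exact hB.sub_left ((hA.mul_left hl).add_left (hl.mul_left hA))
  have hA1 : Commute (S.A (k + 1)) (S.l * S.l) := by
    have e : S.A (k + 1) = (2 : ℂ)⁻¹ • ((q - q⁻¹) • (S.l * S.B' (k + 1) + S.B (k + 1) * S.l)
        - (S.t * S.A k - S.A k * S.t)) := by
      rw [h.t_A hT le_rfl]
      module
    rw [e]
    exact ((((hl.mul_left hB').add_left (hB.mul_left hl)).smul_left _).sub_left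
      ((hK.mul_left hA).sub_left (hA.mul_left hK))).smul_left _
  have hA' : Commute (S.A' (k + 1)) (S.l * S.l) := by
    have e : S.A' (k + 1) = S.A (k + 1) + (S.B (k + 1) * S.l - S.l * S.B (k + 1)) := by
      rw [S.B_l]; abel
    rw [e]
    exact hA1.add_left ((hB.mul_left hl).sub_left (hl.mul_left hB))
  exact ⟨extend S.cA_K h.cA hA1, extend S.cB_K h.cB hB, extend S.cB'_K h.cB' hB',
    extend S.cA'_K h.cA' hA'⟩

variable (S) in
lemma inv_zero : S.Inv 0 where
  cA i j hij := by
    obtain ⟨rfl, hj⟩ | ⟨rfl, rfl⟩ : (i = 0 ∧ j ≤ 1) ∨ (i = 1 ∧ j = 0) := by omega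
    · rw [zero_add]
    · exact S.cA_one
  cB i j hij := by
    obtain ⟨rfl, rfl⟩ : i = 0 ∧ j = 0 := by omega
    rfl
  cB' i j hij := by
    obtain ⟨rfl, rfl⟩ : i = 0 ∧ j = 0 := by omega
    rfl
  cA' i j hij := by
    obtain ⟨rfl, rfl⟩ : i = 0 ∧ j = 0 := by omega
    rfl

variable (S) in
/-- The antisymmetrized commutator of `L_{2m}` and `L′_{2(k+2-m)}`. -/
def fe (k m : ℕ) : R :=
  (S.B m * S.B' (k + 2 - m) - S.B' (k + 2 - m) * S.B m) -
    (S.B (k + 2 - m) * S.B' m - S.B' m * S.B (k + 2 - m))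

variable (S) in
/-- The antisymmetrized anticommutator of `L′_{2m+1}` and `L_{2(k+1-m)+1}`. -/
def fo (k m : ℕ) : R :=
  (S.A' m * S.A (k + 1 - m) + S.A (k + 1 - m) * S.A' m) -
    (S.A' (k + 1 - m) * S.A m + S.A m * S.A' (k + 1 - m))

lemma Inv.fe_succ {k m : ℕ} (h : S.Inv k) (hθ : q - q⁻¹ ≠ 0) (hq : q ≠ 0) (hs : q + q⁻¹ ≠ 0)
    (hT : S.T) (hm : m + 1 ≤ k) : S.fe k (m + 1) + S.fe k m = (q + q⁻¹) • S.fo k m := by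
  obtain ⟨d, rfl⟩ := Nat.exists_eq_add_of_le hm
  have e1 := h.B_comm_cB' hθ hq hs hT hm (d + 1)
  have e2 := h.B'_comm_cB hθ hq hs hT hm (d + 1)
  have e3 : S.cA 1 (d + 1) = S.A (d + 2) := by
    rw [h.cA 1 (d + 1) (by omega), add_comm]; rfl
  have e4 : S.cB 1 (d + 1) * S.B' m - S.B' m * S.cB 1 (d + 1) =
      S.B (d + 3) * S.B' m - S.B' m * S.B (d + 3) := by
    cases m with
    | zero => simp [B']
    | succ m =>
      rw [h.cB 1 (d + 1) (by omega), add_comm 1 (d + 1)]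
      rfl
  change S.B (m + 1) * S.B' (d + 2) - S.B' (d + 2) * S.B (m + 1) =
    q⁻¹ • (S.A' m * S.cA 1 (d + 1)) + q • (S.cA 1 (d + 1) * S.A' m)
      - q • (S.A m * S.A' (d + 2)) - q⁻¹ • (S.A' (d + 2) * S.A m) + _ at e1
  change S.B' (m + 1) * S.B (d + 2) - S.B (d + 2) * S.B' (m + 1) =
    q • (S.A' m * S.A (d + 2)) + q⁻¹ • (S.A (d + 2) * S.A' m)
      - q⁻¹ • (S.A m * S.A' (d + 2)) - q • (S.A' (d + 2) * S.A m)
      + (S.B' (d + 3) * S.B m - S.B m * S.B' (d + 3)) at e2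
  rw [e3, e4] at e1
  simp only [fe, fo, show m + 1 + d + 2 - (m + 1) = d + 2 by omega,
    show m + 1 + d + 2 - m = d + 3 by omega, show m + 1 + d + 1 - m = d + 2 by omega]
  linear_combination (norm := module) e1 + e2

lemma Inv.fo_succ {k m : ℕ} (h : S.Inv k) (hθ : q - q⁻¹ ≠ 0) (hq : q ≠ 0) (hs : q + q⁻¹ ≠ 0)
    (hT : S.T) (hm : m + 1 ≤ k) : S.fo k (m + 1) + S.fo k m = (q + q⁻¹) • S.fe k (m + 1) := by
  obtain ⟨d, rfl⟩ := Nat.exists_eq_add_of_le hm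
  have e1 := h.A'_comm_cA hθ hq hm (d + 1)
  have e2 := h.A_comm_cA' hθ hq hs hT hm d
  have e3 : S.cA 1 (d + 1) = S.A (d + 2) := by
    rw [h.cA 1 (d + 1) (by omega), add_comm]; rfl
  have e4 : S.cB 1 d = S.B (d + 2) := by
    rw [h.cB 1 d (by omega), add_comm]; rfl
  change S.A' (m + 1) * S.A (d + 1) + S.A (d + 1) * S.A' (m + 1) =
    q⁻¹ • (S.B (m + 1) * S.B' (d + 2)) - q • (S.B' (d + 2) * S.B (m + 1))
      + q • (S.B' (m + 1) * S.B (d + 2)) - q⁻¹ • (S.B (d + 2) * S.B' (m + 1))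
      + (S.A m * S.A' (d + 2) + S.A' (d + 2) * S.A m) at e1
  rw [e3, e4] at e2
  change S.A (m + 1) * S.A' (d + 1) + S.A' (d + 1) * S.A (m + 1) =
    q • (S.B (d + 2) * S.B' (m + 1)) - q⁻¹ • (S.B' (m + 1) * S.B (d + 2))
      + q⁻¹ • (S.B' (d + 2) * S.B (m + 1)) - q • (S.B (m + 1) * S.B' (d + 2))
      + _ at e2
  simp only [fe, fo, show m + 1 + d + 2 - (m + 1) = d + 2 by omega,
    show m + 1 + d + 1 - (m + 1) = d + 1 by omega, show m + 1 + d + 1 - m = d + 2 by omega]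
  linear_combination (norm := module) e1 - e2

variable (S) in
lemma fe_zero (k : ℕ) : S.fe k 0 = 0 := by simp [fe, B, B']

variable (S) in
lemma fo_zero (k : ℕ) : S.fo k 0 =
    -(S.B (k + 1) * (S.l * S.l) - S.l * S.l * S.B (k + 1)) := by
  have e := S.B_l (k + 1)
  have h0 : S.A' 0 = S.l := rfl
  simp only [fo, A_zero, h0, Nat.sub_zero]
  linear_combination (norm := noncomm_ring) e * S.l + S.l * e

lemma Inv.fe_fo_eq {k m : ℕ} (h : S.Inv k) (hθ : q - q⁻¹ ≠ 0) (hq : q ≠ 0) (hs : q + q⁻¹ ≠ 0)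
    (hT : S.T) (hm : m ≤ k) :
    (q - q⁻¹) • S.fe k m = (q ^ (2 * m) - q⁻¹ ^ (2 * m)) • S.fo k 0 ∧
    (q - q⁻¹) • S.fo k m = (q ^ (2 * m + 1) - q⁻¹ ^ (2 * m + 1)) • S.fo k 0 := by
  induction m with
  | zero => simp [fe_zero]
  | succ m ih =>
    obtain ⟨h1, h2⟩ := ih (by omega)
    have e1 := h.fe_succ hθ hq hs hT hm
    have e2 := h.fo_succ hθ hq hs hT hm
    have hfe : (q - q⁻¹) • S.fe k (m + 1) =
        (q ^ (2 * (m + 1)) - q⁻¹ ^ (2 * (m + 1))) • S.fo k 0 := by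
      linear_combination (norm := skip) (q - q⁻¹) • e1 + (q + q⁻¹) • h2 - h1
      simp only [inv_pow]
      match_scalars <;> field_simp <;> ring
    refine ⟨hfe, ?_⟩
    linear_combination (norm := skip) (q - q⁻¹) • e2 + (q + q⁻¹) • hfe - h2
    simp only [inv_pow]
    match_scalars <;> field_simp <;> ring

lemma pow_sub_inv_pow_ne_zero (hq : q ≠ 0) (hr : NotRootOfUnity q) {n : ℕ} (hn : n ≠ 0) :
    q ^ n - q⁻¹ ^ n ≠ 0 := by
  intro h
  refine hr (2 * n) (by omega) ?_
  rw [inv_pow] at h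
  have := pow_ne_zero n hq
  field_simp at h
  linear_combination h

/-- `L_{2k+2}` commutes with `L₁²`. -/
lemma Inv.B_succ_K {k : ℕ} (h : S.Inv k) (hθ : q - q⁻¹ ≠ 0) (hq : q ≠ 0) (hs : q + q⁻¹ ≠ 0)
    (hr : NotRootOfUnity q) (hT : S.T) (hk : k ≠ 0) : Commute (S.B (k + 1)) (S.l * S.l) := by
  suffices hz : S.fo k 0 = 0 by
    rw [fo_zero, neg_eq_zero, sub_eq_zero] at hz
    exact hz
  obtain ⟨r, rfl | rfl⟩ := Nat.even_or_odd' k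
  · have e := (h.fe_fo_eq hθ hq hs hT (m := r + 1) (by omega)).1
    have e0 : S.fe (2 * r) (r + 1) = 0 := by
      simp only [fe, show 2 * r + 2 - (r + 1) = r + 1 by omega, sub_self]
    rw [e0, smul_zero] at e
    exact (smul_eq_zero_iff_right (pow_sub_inv_pow_ne_zero hq hr (by omega))).1 e.symm
  · have e := (h.fe_fo_eq hθ hq hs hT (m := r + 1) (by omega)).2
    have e0 : S.fo (2 * r + 1) (r + 1) = 0 := by
      simp only [fo, show 2 * r + 1 + 1 - (r + 1) = r + 1 by omega, sub_self]
    rw [e0, smul_zero] at e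
    exact (smul_eq_zero_iff_right (pow_sub_inv_pow_ne_zero hq hr (by omega))).1 e.symm

lemma q_sub_inv_ne_zero (hq : q ≠ 0) (hr : NotRootOfUnity q) : q - q⁻¹ ≠ 0 := by
  simpa using pow_sub_inv_pow_ne_zero hq hr one_ne_zero

lemma q_add_inv_ne_zero (hq : q ≠ 0) (hr : NotRootOfUnity q) : q + q⁻¹ ≠ 0 := by
  intro h
  refine hr 4 (by omega) ?_
  field_simp at h
  linear_combination (q ^ 2 - 1) * h

variable (S) in
lemma tx_ty_zero (hq : q ≠ 0) (hr : NotRootOfUnity q) : S.TX 0 ∧ S.TY 0 := by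
  refine ⟨S.tx_zero hq fun h => hr 3 (by omega) ?_, S.ty_zero hq fun h => hr 6 (by omega) ?_⟩
  · field_simp at h
    linear_combination (q - 1) * h
  · field_simp at h
    linear_combination -(q + 1) * (q ^ 3 - 1) * h

variable (S) in
lemma commute_t (hq : q ≠ 0) (hr : NotRootOfUnity q) : Commute S.t (S.l * S.l) :=
  S.t_K (S.tx_ty_zero hq hr).1 (S.tx_ty_zero hq hr).2 (q_add_inv_ne_zero hq hr)

variable (S) in
lemma T_holds (hq : q ≠ 0) (hr : NotRootOfUnity q) : S.T :=
  ⟨tx (S.commute_t hq hr) (S.tx_ty_zero hq hr).1, ty (S.commute_t hq hr) (S.tx_ty_zero hq hr).2⟩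

variable (S) in
lemma inv (hq : q ≠ 0) (hr : NotRootOfUnity q) (k : ℕ) : S.Inv k := by
  have hK := S.commute_t hq hr
  have hT := S.T_holds hq hr
  induction k with
  | zero => exact S.inv_zero
  | succ k ih =>
    refine ih.succ hT hK ?_
    obtain rfl | hk := eq_or_ne k 0
    · change Commute (S.cB 0 0) _
      rw [cB_zero]
      exact hK.add_left (Commute.refl _)
    · exact ih.B_succ_K (q_sub_inv_ne_zero hq hr) hq (q_add_inv_ne_zero hq hr) hr hT hk

variable (S) in
lemma t_comm (hq : q ≠ 0) (hr : NotRootOfUnity q) (m : ℕ) : Commute S.t (S.B m + S.B' m) := by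
  cases m with
  | zero => exact ((Commute.one_right _).smul_right _).add_right ((Commute.one_right _).smul_right _)
  | succ m =>
    have hT := S.T_holds hq hr
    have h := S.inv hq hr (m + 1)
    have e := t_add (hT.1 0) (hT.2 m) (by rw [h.cA (0 + 1) m (by omega)]; congr 1; omega)
    rw [h.cB (0 + 1) m (by omega), show 0 + 1 + m = m + 1 by omega, sub_self, smul_zero,
      neg_zero, sub_eq_zero] at e
    exact e

end

end Currents

lemma neg_one_pow_even (i : ℕ) : (-1 : ℂ) ^ (2 * i) = 1 := by simp [pow_mul]

lemma neg_one_pow_odd (i : ℕ) : (-1 : ℂ) ^ (2 * i + 1) = -1 := by simp [pow_succ, pow_mul]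

lemma neg_smul_U {q : ℂ} (c : ℂ) (u : U q) : (-c) • u = -(c • u) := neg_smul c u

/-- The real root vectors of `U_q(A(0,2)^{(4)})^+`. -/
def currents (q : ℂ) : Currents q (U q) where
  xe i := X q (2 * i + 1)
  xo i := X q (2 * i + 2)
  yo j := Y q (2 * j + 1)
  ye j := Y q (2 * j + 2)
  l := L1U q
  xe_l i := by
    rw [X, neg_one_pow_even, one_smul]
  xo_l i := by
    change _ = X q (2 * i + 1 + 2)
    rw [X.eq_3 q (2 * i + 1), neg_one_pow_odd, neg_smul_U, one_smul, sub_neg_eq_add]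
  yo_l j := by
    rw [Y, neg_one_pow_odd, neg_smul_U, one_smul, sub_neg_eq_add]
  ye_l j := by
    change _ = Y q (2 * j + 1 + 2)
    rw [Y.eq_3 q (2 * j + 1), show 2 * j + 1 + 1 = 2 * (j + 1) by ring, neg_one_pow_even, one_smul]
  serre_x := by
    have h := RingQuot.mkAlgHom_rel ℂ (Rel.one (q := q))
    change π q (serre1 q) = π q 0 at h
    simpa [serre1, X2F, L1F, X, L1U, sub_eq_zero] using h
  serre_y := by
    have h := RingQuot.mkAlgHom_rel ℂ (Rel.two (q := q))
    change π q (serre2 q) = π q 0 at h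
    simpa [serre2, Y2F, L1F, Y, L1U, sub_eq_zero, neg_smul_U] using h
  l_eq := rfl

lemma L_odd (q : ℂ) (m : ℕ) : L q (2 * m + 1) = (currents q).A m := rfl

lemma L_even (q : ℂ) (m : ℕ) : L q (2 * m) = (currents q).B m := by
  cases m <;> rfl

lemma L'_odd (q : ℂ) (m : ℕ) : L' q (2 * m + 1) = (currents q).A' m := by
  cases m with
  | zero => rfl
  | succ m =>
    rw [show 2 * (m + 1) + 1 = 2 * m + 1 + 2 by ring, L',
      show 2 * m + 1 + 1 = 2 * (m + 1) by ring, neg_one_pow_even, one_mul]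
    rfl

lemma L'_even (q : ℂ) (m : ℕ) : L' q (2 * m) = (currents q).B' m := by
  cases m with
  | zero => rfl
  | succ m =>
    rw [show 2 * (m + 1) = 2 * m + 2 by ring, L', neg_one_pow_odd, neg_one_mul, neg_smul_U,
      sub_neg_eq_add]
    rfl

lemma Lt_natCast (q : ℂ) (n : ℕ) : Lt q (n : ℤ) = (2 : ℂ)⁻¹ • (L q n + L' q n) := by
  simp [Lt]

lemma Lt_two (q : ℂ) : Lt q 2 = (currents q).t := by
  have h := Lt_natCast q (2 * 1)
  rw [L_even, L'_even] at h
  change Lt q 2 = (2 : ℂ)⁻¹ • ((currents q).cB 0 0 + (currents q).cB' 0 0) at h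
  rw [h, Currents.cB_zero, Currents.cB'_zero]
  module

lemma commute_L {q : ℂ} (hq0 : q ≠ 0) (hq : NotRootOfUnity q) (n : ℕ) :
    Commute (L q n) (L q 1 ^ 2) ∧ Commute (L' q n) (L q 1 ^ 2) := by
  have hl : L q 1 ^ 2 = (currents q).l * (currents q).l := sq _
  have h := (currents q).inv hq0 hq n
  rw [hl]
  obtain ⟨m, rfl | rfl⟩ := Nat.even_or_odd' n
  · rw [L_even, L'_even]
    exact ⟨h.B_K (by omega), h.B'_K (by omega)⟩
  · rw [L_odd, L'_odd]
    exact ⟨h.A_K (by omega), h.A'_K (by omega)⟩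

lemma commute_Lt_two {q : ℂ} (hq0 : q ≠ 0) (hq : NotRootOfUnity q) (n : ℕ) :
    Commute (Lt q 2) (Lt q (2 * (n : ℤ))) := by
  have h : Lt q (2 * (n : ℤ)) = (2 : ℂ)⁻¹ • ((currents q).B n + (currents q).B' n) := by
    rw [← L_even, ← L'_even, ← Lt_natCast]
    push_cast
    rfl
  rw [h, Lt_two]
  exact ((currents q).t_comm hq0 hq n).smul_right _

end QAff

/-- In `U = U_q(A(0,2)^{(4)})^+`, for every `n ≥ 1`: `L̃_n` commutes with `L₁²`,
`L_n` commutes with `L₁²`, and `L̃₂` commutes with `L̃_{2n}`. -/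
theorem stmt11 (q : ℂ) (hq0 : q ≠ 0) (hq : NotRootOfUnity q) (n : ℕ) (hn : 1 ≤ n) :
    Lt q (n : ℤ) * (L q 1)^2 = (L q 1)^2 * Lt q (n : ℤ) ∧
    L q n * (L q 1)^2 = (L q 1)^2 * L q n ∧
    Lt q 2 * Lt q (2*(n : ℤ)) = Lt q (2*(n : ℤ)) * Lt q 2 := by
  obtain ⟨h, h'⟩ := commute_L hq0 hq n
  refine ⟨?_, h, commute_Lt_two hq0 hq n⟩
  rw [Lt_natCast]
  exact (h.add_left h').smul_left _
end
end

section
/- In U = U_q(A(0,2)^{(4)})^+, for all m, n ≥ 0: if m + n is odd then M_{2m+1}M_{2n+1} + M_{2n+1}M_{2m+1} = 0; if m + n is even then M_{2m+1}M_{2n+1} + M_{2n+1}M_{2m+1} = (−1)^{(m−n)/2}·2·M_{m+n+1}² (note m+n+1 is odd, so M_{m+n+1} is defined). Moreover, for every m ≥ 0 and every n ≥ 1, M_{2m+1}² commutes with L_n: M_{2m+1}²L_n = L_nM_{2m+1}². -/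
noncomputable section

open QAff

namespace QAffAux

section RootVectors
variable {R : Type*} [Ring R]

/-- The odd-indexed root vectors `Y_{2k+1}`. -/
def Yo (l y : R) : ℕ → R
  | 0 => y
  | k + 1 => l * l * Yo l y k - Yo l y k * (l * l)

/-- The even-indexed root vectors `Y_{2k+2}`. -/
def Ye (l y : R) (k : ℕ) : R := l * Yo l y k + Yo l y k * l

theorem Yo_succ (l y : R) (k : ℕ) : Yo l y (k + 1) = l * Ye l y k - Ye l y k * l := by
  rw [Yo, Ye]; noncomm_ring

theorem Ye_succ (l y : R) (k : ℕ) :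
    Ye l y (k + 1) = l * l * Ye l y k - Ye l y k * (l * l) := by
  rw [Ye, Yo_succ]; noncomm_ring

end RootVectors

section Generic
variable {R : Type*} [Ring R] [Algebra ℂ R]

theorem eq_of_smul_sub {c : ℂ} (hc : c ≠ 0) {u v : R} (h : c • (u - v) = 0) : u = v :=
  sub_eq_zero.1 ((smul_eq_zero.1 h).resolve_left hc)

/-- The `c`-commutator `ab - c·ba`. -/
def br (c : ℂ) (a b : R) : R := a * b - c • (b * a)

/-- `x` and `y` satisfy the quantum Serre relations, `l = [x,y]`, `X2 = [x,l]`, `X3 = [X2,l]` and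
`L = [x,[l,y]]`; the scalars that get divided by are nonzero. -/
structure Serre (q : ℂ) (x y l X2 X3 L : R) : Prop where
  hq0 : q ≠ 0
  hq2 : q ^ 2 + q + 1 ≠ 0
  hq3 : q ^ 2 - q + 1 ≠ 0
  hq4 : q ^ 2 + 1 ≠ 0
  hl : l = x * y - q⁻¹ • (y * x)
  hX2 : X2 = x * l - l * x
  hX3 : X3 = X2 * l + l * X2
  hL : L = x * (l * y + y * l) - q⁻¹ • ((l * y + y * l) * x)
  s1 : x * X2 = q • (X2 * x)
  s2 : (l * y + y * l) * y = q • (y * (l * y + y * l))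

variable {q : ℂ} {x y l X2 X3 L : R}

namespace Serre

theorem L_eq (h : Serre q x y l X2 X3 L) :
    L = X2 * y + q⁻¹ • (y * X2) + (2 : ℂ) • (l * l) := by
  rw [h.hL, h.hX2]
  linear_combination (norm := skip) (-(1 : ℂ)) • (l * h.hl + h.hl * l)
  simp only [mul_add, add_mul, mul_sub, sub_mul, smul_mul_assoc, mul_smul_comm, mul_assoc,
    smul_sub, smul_add]
  module

theorem ad_x (h : Serre q x y l X2 X3 L) :
    L * x - x * L = -(q • (X2 * l) + q⁻¹ • (l * X2) + (2 : ℂ) • X3) := by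
  have hq := h.hq0
  rw [h.L_eq, h.hX3]
  linear_combination (norm := skip) (-(1 : ℂ)) • (h.s1 * y) + (- q⁻¹ ^ 2) • (y * h.s1)
    + q • (X2 * h.hl) + q⁻¹ • (h.hl * X2) + (2 : ℂ) • (l * h.hX2 + h.hX2 * l)
  simp only [mul_add, add_mul, mul_sub, sub_mul, smul_mul_assoc, mul_smul_comm, mul_assoc,
    smul_sub, smul_add]
  match_scalars <;> field_simp <;> ring

theorem ad_y (h : Serre q x y l X2 X3 L) :
    L * y - y * L = q • (l * (l * y + y * l)) - q⁻¹ • ((l * y + y * l) * l) := by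
  have hq := h.hq0
  have e := h.s2
  rw [h.hL]
  linear_combination (norm := skip) x * e - (q⁻¹ ^ 2) • (e * x)
    - q • (h.hl * (l * y + y * l)) + q⁻¹ • ((l * y + y * l) * h.hl)
  simp only [mul_add, add_mul, mul_sub, sub_mul, smul_mul_assoc, mul_smul_comm, mul_assoc,
    smul_sub, smul_add]
  match_scalars <;> field_simp <;> ring

/-- `[ℓ², [x,u]] = [x,[ℓ²,u]] - [[x,ℓ²],u]` for odd and even `u`. -/
theorem ad_sq_br (h : Serre q x y l X2 X3 L) (u : R) :
    l * l * br q⁻¹ x u - br q⁻¹ x u * (l * l)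
      = br q⁻¹ x (l * l * u - u * (l * l)) - br q⁻¹ X3 u := by
  rw [h.hX3, h.hX2]
  simp only [br, mul_add, add_mul, mul_sub, sub_mul, smul_mul_assoc, mul_smul_comm, mul_assoc,
    smul_sub, smul_add]
  module

theorem brX3_y (h : Serre q x y l X2 X3 L) :
    br q⁻¹ X3 y = br q⁻¹ x (l * l * y - y * (l * l)) := by
  have e := h.ad_sq_br y
  have : br q⁻¹ x y = l := h.hl.symm
  rw [this, mul_assoc, sub_self] at e
  exact (sub_eq_zero.1 e.symm).symm

/-- `[L,[x,u]]` when `[L,u] = qℓv - q⁻¹vℓ`, `v = ℓu+uℓ`. -/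
theorem ad_br_x_odd (h : Serre q x y l X2 X3 L) {u v : R} (hv : v = l * u + u * l)
    (hu : L * u - u * L = q • (l * v) - q⁻¹ • (v * l)) :
    L * br q⁻¹ x u - br q⁻¹ x u * L = q • (br (-q⁻¹) X2 u * l) - q⁻¹ • (l * br (-q⁻¹) X2 u)
      + q • (l * br q⁻¹ x v) - q⁻¹ • (br q⁻¹ x v * l) - (2 : ℂ) • br q⁻¹ X3 u := by
  have hq := h.hq0
  have e := h.ad_x
  subst hv
  rw [h.hX3] at e ⊢
  simp only [br]
  linear_combination (norm := skip) e * u - q⁻¹ • (u * e) + x * hu - q⁻¹ • (hu * x)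
    - q • (h.hX2 * (l * u + u * l)) + q⁻¹ ^ 2 • ((l * u + u * l) * h.hX2)
  simp only [mul_add, add_mul, mul_sub, sub_mul, smul_mul_assoc, mul_smul_comm, mul_assoc,
    smul_sub, smul_add, smul_neg, mul_neg, neg_mul, neg_smul]
  match_scalars <;> field_simp <;> ring

/-- `[L,[x,u]]` when `[L,u] = qℓv + q⁻¹vℓ + 2w`, `v = ℓu-uℓ`. -/
theorem ad_br_x_even (h : Serre q x y l X2 X3 L) {u v w : R} (hv : v = l * u - u * l)
    (hu : L * u - u * L = q • (l * v) + q⁻¹ • (v * l) + (2 : ℂ) • w) :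
    L * br q⁻¹ x u - br q⁻¹ x u * L = -(q • (br q⁻¹ X2 u * l)) - q⁻¹ • (l * br q⁻¹ X2 u)
      + q • (l * br q⁻¹ x v) + q⁻¹ • (br q⁻¹ x v * l) - (2 : ℂ) • br q⁻¹ X3 u
      + (2 : ℂ) • br q⁻¹ x w := by
  have hq := h.hq0
  have e := h.ad_x
  subst hv
  rw [h.hX3] at e ⊢
  simp only [br]
  linear_combination (norm := skip) e * u - q⁻¹ • (u * e) + x * hu - q⁻¹ • (hu * x)
    - q • (h.hX2 * (l * u - u * l)) - q⁻¹ ^ 2 • ((l * u - u * l) * h.hX2)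
  simp only [mul_add, add_mul, mul_sub, sub_mul, smul_mul_assoc, mul_smul_comm, mul_assoc,
    smul_sub, smul_add, smul_neg, mul_neg, neg_mul]
  match_scalars <;> field_simp <;> ring

theorem two_smul_L3 (h : Serre q x y l X2 X3 L) :
    (2 : ℂ) • br q⁻¹ x (l * (l * y + y * l) - (l * y + y * l) * l)
      = -(L * l - l * L) + (q - q⁻¹) • (L * l + l * L) - (2 * (q - q⁻¹)) • (l * l * l) := by
  have e := h.ad_br_x_odd rfl h.ad_y
  have e0 : l * (l * y + y * l) - (l * y + y * l) * l = l * l * y - y * (l * l) := by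
    noncomm_ring
  have e1 : br q⁻¹ x y = l := h.hl.symm
  have e2 : br q⁻¹ x (l * y + y * l) = L := h.hL.symm
  have e3 : br (-q⁻¹) X2 y = L - (2 : ℂ) • (l * l) := by
    rw [h.L_eq, br]; module
  rw [e1, e2, e3, h.brX3_y, ← e0] at e
  linear_combination (norm := skip) e
  simp only [mul_add, add_mul, mul_sub, sub_mul, smul_mul_assoc, mul_smul_comm, mul_assoc,
    smul_sub, smul_add]
  module

theorem ad_l (h : Serre q x y l X2 X3 L) :
    L * l - l * L = br q⁻¹ X2 (l * y + y * l)
      - br q⁻¹ x (l * (l * y + y * l) - (l * y + y * l) * l) := by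
  rw [h.hL, h.hX2]
  simp only [br, mul_add, add_mul, mul_sub, sub_mul, smul_mul_assoc, mul_smul_comm, mul_assoc,
    smul_sub, smul_add]
  module

theorem two_smul_brX2_Y2 (h : Serre q x y l X2 X3 L) :
    (2 : ℂ) • br q⁻¹ X2 (l * y + y * l)
      = (L * l - l * L) + (q - q⁻¹) • (L * l + l * L) - (2 * (q - q⁻¹)) • (l * l * l) := by
  linear_combination (norm := skip) (-2 : ℂ) • h.ad_l + h.two_smul_L3
  module

theorem ad_X2 (h : Serre q x y l X2 X3 L) :
    L * X2 - X2 * L = -(q • (X3 * l) - q⁻¹ • (l * X3)) := by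
  have hq := h.hq0
  have hm := h.two_smul_brX2_Y2
  have Ax := h.ad_x
  have hX2 := h.hX2
  have e1 : x * br q⁻¹ X2 (l * y + y * l) - br q⁻¹ X2 (l * y + y * l) * x
      = q • (X2 * L) - q⁻¹ • (L * X2) := by
    rw [h.hL]
    linear_combination (norm := skip) h.s1 * (l * y + y * l) - q⁻¹ ^ 2 • ((l * y + y * l) * h.s1)
    simp only [br, mul_add, add_mul, mul_sub, sub_mul, smul_mul_assoc, mul_smul_comm, mul_assoc,
      smul_sub, smul_add]
    match_scalars <;> field_simp <;> ring
  generalize br q⁻¹ X2 (l * y + y * l) = K at *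
  rw [h.hX3] at Ax ⊢
  have hc : q + q⁻¹ + 1 ≠ 0 := by
    have := h.hq2
    contrapose! this
    field_simp at this
    linear_combination this
  refine eq_of_smul_sub hc ?_
  linear_combination (norm := skip) (2 : ℂ) • e1 - (x * hm - hm * x) + (Ax * l - l * Ax)
    + (L * hX2 - hX2 * L) + (q - q⁻¹) • (Ax * l + l * Ax + L * hX2 + hX2 * L)
    - (2 * (q - q⁻¹)) • (hX2 * l * l + l * hX2 * l + l * l * hX2)
  simp only [mul_add, add_mul, mul_sub, sub_mul, smul_mul_assoc, mul_smul_comm, mul_assoc,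
    smul_sub, smul_add, mul_neg, neg_mul]
  match_scalars <;> field_simp <;> ring

theorem ad_Y2 (h : Serre q x y l X2 X3 L) {Y2 Y3 : R} (hY2 : Y2 = l * y + y * l)
    (hY3 : Y3 = l * Y2 - Y2 * l) :
    L * Y2 - Y2 * L = q • (l * Y3) + q⁻¹ • (Y3 * l) + (2 : ℂ) • (l * Y3 + Y3 * l) := by
  have hq := h.hq0
  have hm := h.two_smul_brX2_Y2
  have E := h.ad_y
  have hk : br q⁻¹ X2 (l * y + y * l) * y + y * br q⁻¹ X2 (l * y + y * l)
      = q • ((L - (2 : ℂ) • (l * l)) * (l * y + y * l))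
        - q⁻¹ • ((l * y + y * l) * (L - (2 : ℂ) • (l * l))) := by
    rw [h.L_eq]
    have e := h.s2
    linear_combination (norm := skip) X2 * e + q⁻¹ ^ 2 • (e * X2)
    simp only [br, mul_add, add_mul, mul_sub, sub_mul, smul_mul_assoc, mul_smul_comm, mul_assoc,
      smul_sub, smul_add]
    match_scalars <;> field_simp <;> ring
  generalize br q⁻¹ X2 (l * y + y * l) = K at *
  have hc : 1 - (q + q⁻¹) ≠ 0 := by
    have := h.hq3
    contrapose! this
    field_simp at this
    linear_combination -this
  subst hY2 hY3
  refine eq_of_smul_sub hc ?_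
  linear_combination (norm := skip) E * l + l * E - (hm * y + y * hm) + (2 : ℂ) • hk
    - (q - q⁻¹) • (l * E - E * l)
  simp only [mul_add, add_mul, mul_sub, sub_mul, smul_mul_assoc, mul_smul_comm, mul_assoc,
    smul_sub, smul_add]
  match_scalars <;> field_simp <;> ring

theorem commute_sq_L (h : Serre q x y l X2 X3 L) : l * l * L = L * (l * l) := by
  have hq := h.hq0
  have e := h.ad_br_x_even rfl (h.ad_Y2 rfl rfl)
  have e2 := h.ad_sq_br (l * y + y * l)
  have e3 := h.two_smul_L3
  have e4 := h.ad_l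
  have hL : br q⁻¹ x (l * y + y * l) = L := h.hL.symm
  have e0 : l * l * (l * y + y * l) - (l * y + y * l) * (l * l)
    = l * (l * (l * y + y * l) - (l * y + y * l) * l)
      + (l * (l * y + y * l) - (l * y + y * l) * l) * l := by noncomm_ring
  rw [hL, e0] at e2
  rw [hL] at e
  generalize br q⁻¹ x (l * (l * (l * y + y * l) - (l * y + y * l) * l)
      + (l * (l * y + y * l) - (l * y + y * l) * l) * l) = A at *
  generalize br q⁻¹ x (l * (l * y + y * l) - (l * y + y * l) * l) = B at *
  generalize br q⁻¹ X2 (l * y + y * l) = K at *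
  generalize br q⁻¹ X3 (l * y + y * l) = K' at *
  have hc : (q + q⁻¹) * (q + q⁻¹ + 1) ≠ 0 := by
    refine mul_ne_zero ?_ ?_
    · have := h.hq4
      contrapose! this
      field_simp at this
      linear_combination this
    · have := h.hq2
      contrapose! this
      field_simp at this
      linear_combination this
  refine eq_of_smul_sub hc ?_
  linear_combination (norm := skip) (4 : ℂ) • e2 - (2 : ℂ) • e - (q - q⁻¹) • (l * e3 - e3 * l)
    - (2 * q) • (e4 * l) - (2 * q⁻¹) • (l * e4)
  simp only [mul_add, add_mul, mul_sub, sub_mul, smul_mul_assoc, mul_smul_comm, mul_assoc,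
    smul_sub, smul_add, mul_neg, neg_mul]
  match_scalars <;> field_simp <;> ring

theorem ad_brX2_odd (h : Serre q x y l X2 X3 L) {u v : R} (hv : v = l * u + u * l)
    (hu : L * u - u * L = q • (l * v) - q⁻¹ • (v * l)) :
    L * br (-q⁻¹) X2 u - br (-q⁻¹) X2 u * L = q • (br q⁻¹ X3 u * l) + q⁻¹ • (l * br q⁻¹ X3 u)
      - q • (l * br q⁻¹ X2 v) - q⁻¹ • (br q⁻¹ X2 v * l) := by
  have hq := h.hq0
  have e := h.ad_X2
  subst hv
  rw [h.hX3] at e ⊢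
  simp only [br]
  linear_combination (norm := skip) e * u + q⁻¹ • (u * e) + X2 * hu + q⁻¹ • (hu * X2)
  simp only [mul_add, add_mul, mul_sub, sub_mul, smul_mul_assoc, mul_smul_comm, mul_assoc,
    smul_sub, smul_add, smul_neg, mul_neg, neg_mul]
  match_scalars <;> field_simp <;> ring

theorem ad_brX2_even (h : Serre q x y l X2 X3 L) {u v w : R} (hv : v = l * u - u * l)
    (hu : L * u - u * L = q • (l * v) + q⁻¹ • (v * l) + (2 : ℂ) • w) :
    L * br q⁻¹ X2 u - br q⁻¹ X2 u * L = -(q • (br q⁻¹ X3 u * l)) + q⁻¹ • (l * br q⁻¹ X3 u)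
      - q • (l * br (-q⁻¹) X2 v) + q⁻¹ • (br (-q⁻¹) X2 v * l) + (2 : ℂ) • br q⁻¹ X2 w := by
  have hq := h.hq0
  have e := h.ad_X2
  subst hv
  rw [h.hX3] at e ⊢
  simp only [br]
  linear_combination (norm := skip) e * u - q⁻¹ • (u * e) + X2 * hu - q⁻¹ • (hu * X2)
  simp only [mul_add, add_mul, mul_sub, sub_mul, smul_mul_assoc, mul_smul_comm, mul_assoc,
    smul_sub, smul_add, smul_neg, mul_neg, neg_mul]
  match_scalars <;> field_simp <;> ring

theorem brX2_odd (h : Serre q x y l X2 X3 L) (u : R) :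
    br (-q⁻¹) X2 u = br q⁻¹ x (l * u + u * l) - (br q⁻¹ x u * l + l * br q⁻¹ x u) := by
  rw [h.hX2]
  simp only [br, mul_add, add_mul, mul_sub, sub_mul, smul_mul_assoc, mul_smul_comm, mul_assoc,
    smul_sub, smul_add]
  module

theorem brX2_even (h : Serre q x y l X2 X3 L) (u : R) :
    br q⁻¹ X2 u = br q⁻¹ x (l * u - u * l) + (br q⁻¹ x u * l - l * br q⁻¹ x u) := by
  rw [h.hX2]
  simp only [br, mul_sub, sub_mul, smul_mul_assoc, mul_smul_comm, mul_assoc, smul_sub]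
  module
theorem ad_Yo (h : Serre q x y l X2 X3 L) (k : ℕ) :
    L * Yo l y k - Yo l y k * L = q • (l * Ye l y k) - q⁻¹ • (Ye l y k * l) := by
  induction k with
  | zero => exact h.ad_y
  | succ k ih =>
    have hc := h.commute_sq_L
    rw [Ye_succ, Yo]
    generalize Yo l y k = u at *
    generalize Ye l y k = v at *
    linear_combination (norm := skip) l * l * ih - ih * (l * l) - (hc * u - u * hc)
    simp only [mul_sub, sub_mul, smul_mul_assoc, mul_smul_comm, mul_assoc, smul_sub]
    module

theorem ad_Ye (h : Serre q x y l X2 X3 L) (k : ℕ) :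
    L * Ye l y k - Ye l y k * L = q • (l * Yo l y (k + 1)) + q⁻¹ • (Yo l y (k + 1) * l)
      + (2 : ℂ) • Ye l y (k + 1) := by
  induction k with
  | zero => exact h.ad_Y2 rfl (Yo_succ l y 0)
  | succ k ih =>
    have hc := h.commute_sq_L
    rw [Yo, Ye_succ, Ye_succ l y (k + 1)]
    generalize Ye l y (k + 1) = w at *
    generalize Yo l y (k + 1) = v at *
    generalize Ye l y k = u at *
    linear_combination (norm := skip) l * l * ih - ih * (l * l) - (hc * u - u * hc)
    simp only [mul_add, add_mul, mul_sub, sub_mul, smul_mul_assoc, mul_smul_comm, mul_assoc,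
      smul_sub]
    module

end Serre

/-- Relations among `A1 k = L_{2k+2}`, `A2 k = L'_{2k+2}`, `B1 k = L_{2k+1}`, `B2 k = L'_{2k+3}`,
`K1 k = [X₃, Y_{2k+1}]`, `K2 k = [X₃, Y_{2k+2}]`. -/
structure Tower (q : ℂ) (l L : R) (A1 A2 B1 B2 K1 K2 : ℕ → R) : Prop where
  hq0 : q ≠ 0
  sq : l * l * L = L * (l * l)
  hB : B1 0 = l
  hA : A1 0 = L
  t1 : ∀ k, A2 k = A1 k - (B1 k * l + l * B1 k)
  t2 : ∀ k, B2 k = B1 (k + 1) + (A1 k * l - l * A1 k)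
  p1 : ∀ k, l * l * B1 k - B1 k * (l * l) = B1 (k + 1) - K1 k
  p2 : ∀ k, l * l * A1 k - A1 k * (l * l) = A1 (k + 1) - K2 k
  d1 : ∀ k, L * B1 k - B1 k * L = q • (A2 k * l) - q⁻¹ • (l * A2 k)
    + q • (l * A1 k) - q⁻¹ • (A1 k * l) - (2 : ℂ) • K1 k
  d2 : ∀ k, L * A1 k - A1 k * L = -(q • (B2 k * l)) - q⁻¹ • (l * B2 k)
    + q • (l * B1 (k + 1)) + q⁻¹ • (B1 (k + 1) * l) - (2 : ℂ) • K2 k + (2 : ℂ) • A1 (k + 1)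
  d3 : ∀ k, L * B2 k - B2 k * L = -(q • (K2 k * l)) + q⁻¹ • (l * K2 k)
    - q • (l * A2 (k + 1)) + q⁻¹ • (A2 (k + 1) * l) + (2 : ℂ) • B2 (k + 1)
  d4 : ∀ k, L * A2 k - A2 k * L = q • (K1 k * l) + q⁻¹ • (l * K1 k)
    - q • (l * B2 k) - q⁻¹ • (B2 k * l)

theorem Serre.tower (h : Serre q x y l X2 X3 L) :
    Tower q l L (fun k => br q⁻¹ x (Ye l y k)) (fun k => br (-q⁻¹) X2 (Yo l y k))
      (fun k => br q⁻¹ x (Yo l y k)) (fun k => br q⁻¹ X2 (Ye l y k))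
      (fun k => br q⁻¹ X3 (Yo l y k)) (fun k => br q⁻¹ X3 (Ye l y k)) where
  hq0 := h.hq0
  sq := h.commute_sq_L
  hB := h.hl.symm
  hA := h.hL.symm
  t1 k := h.brX2_odd _
  t2 k := by simpa only [Yo_succ] using h.brX2_even (Ye l y k)
  p1 k := h.ad_sq_br _
  p2 k := by simpa only [Ye_succ] using h.ad_sq_br (Ye l y k)
  d1 k := h.ad_br_x_odd rfl (h.ad_Yo k)
  d2 k := h.ad_br_x_even (Yo_succ l y k) (h.ad_Ye k)
  d3 k := h.ad_brX2_even (Yo_succ l y k) (h.ad_Ye k)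
  d4 k := h.ad_brX2_odd rfl (h.ad_Yo k)

end Generic

section Abstract
variable {R : Type*} [Ring R] [Algebra ℂ R]

/-- `ρ_j = (q^{2j} - q^{-2j}) / (q² - q⁻²)` when `t = q - q⁻¹`. -/
def rho (t : ℂ) : ℕ → ℂ
  | 0 => 0
  | 1 => 1
  | (j + 2) => (t ^ 2 + 2) * rho t (j + 1) - rho t j

/-- The quadratic relations among `m`, `a`, `b` in total degree below `n`, together with the
relations that link `a` and `b` up to degree `n`. -/
structure Step (D : R →ₗ[ℂ] R) (t : ℂ) (m : ℕ → R) (a b : ℤ → R) (n : ℤ) : Prop where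
  leib : ∀ u v, D (u * v) = D u * v + u * D v
  dm : ∀ k, D (m k) = m (k + 1)
  ht : t ≠ 0
  a_zero : a 0 = t⁻¹ • 1
  a_neg : ∀ i < 0, a i = 0
  b_neg : ∀ i < 0, b i = 0
  r1 : ∀ i ≤ n, a i * m 0 - m 0 * a i = D (b (i - 1))
  r2 : ∀ i ≤ n, b i = (t / 2) • (a i * m 0 + m 0 * a i) + (1 / 4 : ℂ) • D (D (b (i - 2)))
  da : ∀ i < n, D (a i) = 0
  h2 : ∀ (i : ℤ) (k : ℕ), i + 2 * k < n → a i * (m k * m k) - m k * m k * a i = 0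
  h3 : ∀ k : ℕ, 2 * (k : ℤ) + 1 < n → m k * m (k + 1) + m (k + 1) * m k = 0

namespace Step
variable {D : R →ₗ[ℂ] R} {t : ℂ} {m : ℕ → R} {a b : ℤ → R} {n : ℤ}

theorem iter_r1 (h : Step D t m a b n) (k : ℕ) (i : ℤ) (hi : i ≤ n) (hk : i = n → k = 0) :
    a i * m k - m k * a i = D^[k + 1] (b (i - 1)) := by
  obtain rfl | hlt := hi.eq_or_lt
  · rw [hk rfl]; exact h.r1 i le_rfl
  have key : ∀ j : ℕ, a i * m j - m j * a i = D^[j + 1] (b (i - 1)) := by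
    intro j
    induction j with
    | zero => exact h.r1 i (by omega)
    | succ j ih =>
      rw [Function.iterate_succ_apply', ← ih, map_sub, h.leib, h.leib, h.dm, h.da i (by omega)]
      noncomm_ring
  exact key k

theorem iter_r2 (h : Step D t m a b n) (k : ℕ) (i : ℤ) (hi : i ≤ n) (hk : i = n → k = 0) :
    D^[k] (b i) = (t / 2) • (a i * m k + m k * a i) + (1 / 4 : ℂ) • D^[k + 2] (b (i - 2)) := by
  obtain rfl | hlt := hi.eq_or_lt
  · rw [hk rfl]; exact h.r2 i le_rfl
  have key : ∀ j : ℕ, D^[j] (b i) = (t / 2) • (a i * m j + m j * a i)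
      + (1 / 4 : ℂ) • D^[j + 2] (b (i - 2)) := by
    intro j
    induction j with
    | zero => exact h.r2 i (by omega)
    | succ j ih =>
      rw [Function.iterate_succ_apply', ih, map_add, map_smul, map_smul, map_add, h.leib, h.leib,
        h.dm, h.da i (by omega), ← Function.iterate_succ_apply' D]
      simp only [zero_mul, mul_zero, zero_add, add_zero]
  exact key k

theorem shift (h : Step D t m a b n) (k : ℕ) (i : ℤ) (hi : i ≤ n) (hk : i = n → k = 0) :
    a i * m k - m k * a i = (t / 2) • (a (i - 1) * m (k + 1) + m (k + 1) * a (i - 1))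
      + (1 / 4 : ℂ) • (a (i - 2) * m (k + 2) - m (k + 2) * a (i - 2)) := by
  rw [h.iter_r1 k i hi hk, h.iter_r2 (k + 1) (i - 1) (by omega) (by omega),
    h.iter_r1 (k + 2) (i - 2) (by omega) (by omega), show i - 1 - 2 = i - 2 - 1 by ring]

theorem square (h : Step D t m a b n) (k : ℕ) (i : ℤ) (hi : i + 2 * k = n) :
    a i * (m k * m k) - m k * m k * a i
      = (t / 2) • (a (i - 1) * (m k * m (k + 1) + m (k + 1) * m k)
          + (m k * m (k + 1) + m (k + 1) * m k) * a (i - 1))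
        - (t ^ 2 / 4) • (a (i - 2) * (m (k + 1) * m (k + 1)) - m (k + 1) * m (k + 1) * a (i - 2))
        + (1 / 4 : ℂ) • (a (i - 2) * (m k * m (k + 2) + m (k + 2) * m k)
          - (m k * m (k + 2) + m (k + 2) * m k) * a (i - 2))
        - (t / 8) • (a (i - 3) * (m (k + 1) * m (k + 2) + m (k + 2) * m (k + 1))
          + (m (k + 1) * m (k + 2) + m (k + 2) * m (k + 1)) * a (i - 3))
        - (1 / 16 : ℂ) • (a (i - 4) * (m (k + 2) * m (k + 2))
          - m (k + 2) * m (k + 2) * a (i - 4)) := by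
  have e0 := h.shift k i (by omega) (by omega)
  have e1 := h.shift k (i - 1) (by omega) (by omega)
  have e2 := h.shift k (i - 2) (by omega) (by omega)
  rw [show i - 1 - 1 = i - 2 by ring, show i - 1 - 2 = i - 3 by ring] at e1
  rw [show i - 2 - 1 = i - 3 by ring, show i - 2 - 2 = i - 4 by ring] at e2
  linear_combination (norm := skip) e0 * m k + m k * e0
    - (t / 2) • (e1 * m (k + 1) - m (k + 1) * e1) - (1 / 4 : ℂ) • (e2 * m (k + 2) + m (k + 2) * e2)
  simp only [mul_add, add_mul, mul_sub, sub_mul, smul_mul_assoc, mul_smul_comm, mul_assoc,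
    smul_sub, smul_add]
  module

/-- The combination `D{b_{i-1}, m_0} - 2t[m_0, b_i]`, applied at level `k`. -/
theorem cross (h : Step D t m a b n) (k : ℕ) (i : ℤ) (hi : i + 2 * k = n) :
    D (D^[k] (b (i - 1)) * m k + m k * D^[k] (b (i - 1)))
        - (2 * t) • (m k * D^[k] (b i) - D^[k] (b i) * m k)
      + (1 / 4 : ℂ) • (D (D^[k + 1] (b (i - 2 - 1)) * m (k + 1) + m (k + 1) * D^[k + 1] (b (i
        - 2 - 1)))
        - (2 * t) • (m (k + 1) * D^[k + 1] (b (i - 2)) - D^[k + 1] (b (i - 2)) * m (k + 1)))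
      = t ^ 2 • (a i * (m k * m k) - m k * m k * a i)
        + t • (a (i - 1) * (m k * m (k + 1) + m (k + 1) * m k)
          + (m k * m (k + 1) + m (k + 1) * m k) * a (i - 1)) := by
  have f0 := h.iter_r2 k i (by omega) (by omega)
  have f1 := h.iter_r2 k (i - 1) (by omega) (by omega)
  have g1 := h.iter_r1 k (i - 1) (by omega) (by omega)
  have g2 := h.iter_r1 k (i - 2) (by omega) (by omega)
  have hd := h.da (i - 1) (by omega)
  have hc := h.h2 (i - 2) k (by omega)
  rw [show i - 1 - 1 = i - 2 by ring] at g1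
  rw [show i - 1 - 2 = i - 2 - 1 by ring] at f1
  have hd2 : D (D (a (i - 2) * (m k * m k) - m k * m k * a (i - 2))) = 0 := by rw [hc]; simp
  have e : D^[k + 2] (b (i - 2)) = D (D^[k + 1] (b (i - 2))) := Function.iterate_succ_apply' D _ _
  have e' : D^[k + 2] (b (i - 2 - 1)) = D (D^[k + 1] (b (i - 2 - 1))) :=
    Function.iterate_succ_apply' D _ _
  rw [e] at f0
  rw [e'] at f1
  generalize D^[k] (b i) = s at *
  generalize D^[k] (b (i - 1)) = s1 at *
  generalize D^[k + 1] (b (i - 2)) = u at *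
  generalize D^[k + 1] (b (i - 2 - 1)) = w at *
  subst f0 f1
  have hw : D (D (w * m k + m k * w)) = 0 := by
    rw [← hd2, ← g2]; congr 2; noncomm_ring
  subst g1 g2
  simp only [map_add, map_sub, map_smul, h.leib, h.dm, hd, mul_add, add_mul, mul_sub, sub_mul,
    smul_mul_assoc, mul_smul_comm, mul_assoc, smul_sub, smul_add, zero_mul, mul_zero, zero_add,
    add_zero] at hw ⊢
  linear_combination (norm := skip) (1 / 4 : ℂ) • hw
  module

theorem anti_two (h : Step D t m a b n) (k : ℕ) (hk : 2 * (k : ℤ) + 1 < n) :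
    m k * m (k + 2) + m (k + 2) * m k = (-2 : ℂ) • (m (k + 1) * m (k + 1)) := by
  have e := congrArg D (h.h3 k hk)
  simp only [map_add, h.leib, h.dm, map_zero] at e
  linear_combination (norm := skip) e
  module

theorem square_one (h : Step D t m a b n) (k : ℕ) (hi : 1 + 2 * (k : ℤ) = n) :
    a 1 * (m k * m k) - m k * m k * a 1 = m k * m (k + 1) + m (k + 1) * m k := by
  have ht := h.ht
  rw [h.square k 1 hi, sub_self, h.a_zero, h.a_neg (1 - 2) (by norm_num), h.a_neg (1
    - 3) (by norm_num),
    h.a_neg (1 - 4) (by norm_num)]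
  simp only [smul_mul_assoc, mul_smul_comm, one_mul, mul_one, zero_mul, mul_zero]
  match_scalars <;> field_simp <;> ring

theorem square_three (h : Step D t m a b n) (k : ℕ) (hi : 3 + 2 * (k : ℤ) = n) :
    a 3 * (m k * m k) - m k * m k * a 3
      = (-((t ^ 2 + 2) / 4)) • (a 1 * (m (k + 1) * m (k + 1)) - m (k + 1) * m (k + 1) * a 1)
        - (1 / 4 : ℂ) • (m (k + 1) * m (k + 2) + m (k + 2) * m (k + 1)) := by
  have ht := h.ht
  rw [h.square k 3 hi, h.h3 k (by omega), h.anti_two k (by omega), sub_self, h.a_zero,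
    h.a_neg (3 - 4) (by norm_num), show (3 : ℤ) - 2 = 1 by norm_num]
  simp only [smul_mul_assoc, mul_smul_comm, one_mul, mul_one, zero_mul, mul_zero]
  match_scalars <;> field_simp <;> ring

theorem square_rec (h : Step D t m a b n) (k : ℕ) (i : ℤ) (hi : i + 2 * (k : ℤ) = n)
    (h1 : i ≠ 1) (h3 : i ≠ 3) :
    a i * (m k * m k) - m k * m k * a i
      = (-((t ^ 2 + 2) / 4)) • (a (i - 2) * (m (k + 1) * m (k + 1))
          - m (k + 1) * m (k + 1) * a (i - 2))
        - (1 / 16 : ℂ) • (a (i - 4) * (m (k + 2) * m (k + 2))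
          - m (k + 2) * m (k + 2) * a (i - 4)) := by
  obtain hi2 | hi2 := lt_or_ge i 2
  · rw [h.square k i hi, h.a_neg (i - 1) (by omega), h.a_neg (i - 2) (by omega),
      h.a_neg (i - 3) (by omega), h.a_neg (i - 4) (by omega)]
    simp
  have e3 : a (i - 3) * (m (k + 1) * m (k + 2) + m (k + 2) * m (k + 1))
          + (m (k + 1) * m (k + 2) + m (k + 2) * m (k + 1)) * a (i - 3) = 0 := by
    obtain hi4 | hi4 := lt_or_ge i 4
    · rw [h.a_neg (i - 3) (by omega)]; simp
    · rw [h.h3 (k + 1) (by push_cast; omega)]; simp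
  rw [h.square k i hi, e3, h.h3 k (by omega), h.anti_two k (by omega)]
  simp only [smul_mul_assoc, mul_smul_comm, zero_mul, mul_zero]
  module

theorem square_even (h : Step D t m a b n) : ∀ j k : ℕ, 2 * (j : ℤ) + 2 * k = n →
    a (2 * (j : ℤ)) * (m k * m k) - m k * m k * a (2 * (j : ℤ)) = 0
  | 0, k, hk => by
    rw [h.square_rec k _ hk (by simp) (by simp), h.a_neg _ (by simp), h.a_neg _ (by simp)]; simp
  | 1, k, hk => by
    rw [h.square_rec k _ hk (by simp) (by simp),
      show 2 * ((1 : ℕ) : ℤ) - 2 = 2 * ((0 : ℕ) : ℤ) by simp,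
      h.square_even 0 (k + 1) (by push_cast at hk ⊢; omega), h.a_neg _ (by simp)]; simp
  | j + 2, k, hk => by
    rw [h.square_rec k _ hk (by omega) (by omega),
      show 2 * ((j + 2 : ℕ) : ℤ) - 2 = 2 * ((j + 1 : ℕ) : ℤ) by push_cast; ring,
      show 2 * ((j + 2 : ℕ) : ℤ) - 4 = 2 * (j : ℤ) by push_cast; ring,
      h.square_even (j + 1) (k + 1) (by push_cast at hk ⊢; omega),
      h.square_even j (k + 2) (by push_cast at hk ⊢; omega)]; simp

theorem square_odd (h : Step D t m a b n) {p : ℕ} (hp : 2 * (p : ℤ) + 1 = n) :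
    ∀ j k : ℕ, j + k = p →
    a (2 * (j : ℤ) + 1) * (m k * m k) - m k * m k * a (2 * (j : ℤ) + 1)
      = ((-1 / 4) ^ j * (rho t (j + 1) + rho t j)) • (m p * m (p + 1) + m (p + 1) * m p)
  | 0, k, hk => by
    obtain rfl : k = p := by omega
    have := h.square_one k (by omega)
    simpa [rho] using this
  | 1, k, hk => by
    obtain rfl : p = k + 1 := by omega
    have e1 := h.square_one (k + 1) (by push_cast at hp ⊢; omega)
    have e := h.square_three k (by push_cast at hp ⊢; omega)
    rw [e1] at e
    rw [show 2 * ((1 : ℕ) : ℤ) + 1 = 3 by norm_num, e]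
    simp only [rho]
    module
  | j + 2, k, hk => by
    rw [h.square_rec k _ (by push_cast; omega) (by omega) (by omega),
      show 2 * ((j + 2 : ℕ) : ℤ) + 1 - 2 = 2 * ((j + 1 : ℕ) : ℤ) + 1 by push_cast; ring,
      show 2 * ((j + 2 : ℕ) : ℤ) + 1 - 4 = 2 * (j : ℤ) + 1 by push_cast; ring,
      h.square_odd hp (j + 1) (k + 1) (by omega), h.square_odd hp j (k + 2) (by omega)]
    simp only [rho]
    module

theorem cross_odd (h : Step D t m a b n) {p : ℕ} (hp : 2 * (p : ℤ) + 1 = n) :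
    ∀ j k : ℕ, j + k = p →
    D (D^[k] (b (2 * (j : ℤ) + 1 - 1)) * m k + m k * D^[k] (b (2 * (j : ℤ) + 1 - 1)))
        - (2 * t) • (m k * D^[k] (b (2 * (j : ℤ) + 1)) - D^[k] (b (2 * (j : ℤ) + 1)) * m k)
      = ((-1 / 4) ^ j * (rho t (j + 2) - rho t j)) • (m p * m (p + 1) + m (p + 1) * m p)
  | 0, k, hk => by
    obtain rfl : k = p := by omega
    have e := h.cross k 1 (by omega)
    have ht := h.ht
    have hz : ∀ k : ℕ, D^[k] 0 = 0 := fun k => Function.iterate_fixed (map_zero D) k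
    rw [h.square_one k (by omega), h.b_neg (1 - 2 - 1) (by norm_num), h.b_neg (1 - 2) (by norm_num),
      hz, sub_self, h.a_zero] at e
    simp only [mul_zero, zero_mul, add_zero, map_zero, sub_zero, smul_zero, smul_mul_assoc,
      mul_smul_comm, one_mul, mul_one] at e
    simp only [Nat.cast_zero, mul_zero, zero_add, sub_self, rho]
    rw [e]
    match_scalars <;> field_simp <;> ring
  | j + 1, k, hk => by
    have e := h.cross k (2 * ((j + 1 : ℕ) : ℤ) + 1) (by push_cast; omega)
    rw [h.square_odd hp (j + 1) k (by omega), h.h3 k (by omega),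
      show 2 * ((j + 1 : ℕ) : ℤ) + 1 - 2 = 2 * (j : ℤ) + 1 by push_cast; ring,
      h.cross_odd hp j (k + 1) (by omega)] at e
    simp only [mul_zero, zero_mul, add_zero, smul_zero] at e
    rw [eq_sub_of_add_eq e]
    simp only [rho]
    module

theorem anti_succ (h : Step D t m a b n) {p : ℕ} (hp : 2 * (p : ℤ) + 1 = n)
    (hr : rho t (p + 1) ≠ 0) (ht : t ^ 2 + 4 ≠ 0)
    (hX : D (b (n - 1) * m 0 + m 0 * b (n - 1)) - (2 * t) • (m 0 * b n - b n * m 0)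
      = (-2 : ℂ) • (a n * (m 0 * m 0) - m 0 * m 0 * a n)) :
    m p * m (p + 1) + m (p + 1) * m p = 0 := by
  have e1 := h.cross_odd hp p 0 (by simp)
  have e2 := h.square_odd hp p 0 (by simp)
  rw [hp] at e1 e2
  simp only [Function.iterate_zero, id_eq] at e1
  rw [hX, e2, smul_smul, ← sub_eq_zero, ← sub_smul, smul_eq_zero] at e1
  refine e1.resolve_left ?_
  have : (-2) * ((-1 / 4) ^ p * (rho t (p + 1) + rho t p)) - (-1 / 4) ^ p * (rho t (p + 2)
    - rho t p)
      = -((-1 / 4) ^ p * (rho t (p + 1) * (t ^ 2 + 4))) := by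
    simp only [rho]; ring
  rw [this]
  exact neg_ne_zero.2 (mul_ne_zero (pow_ne_zero _ (by norm_num)) (mul_ne_zero hr ht))

theorem square_and_anti_eq_zero (h : Step D t m a b n) (hr : ∀ p, rho t (p + 1) ≠ 0) (ht : t ^ 2
  + 4 ≠ 0)
    (hX : D (b (n - 1) * m 0 + m 0 * b (n - 1)) - (2 * t) • (m 0 * b n - b n * m 0)
      = (-2 : ℂ) • (a n * (m 0 * m 0) - m 0 * m 0 * a n)) :
    (∀ (i : ℤ) (k : ℕ), i + 2 * k = n → a i * (m k * m k) - m k * m k * a i = 0) ∧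
    ∀ k : ℕ, 2 * (k : ℤ) + 1 = n → m k * m (k + 1) + m (k + 1) * m k = 0 := by
  refine ⟨fun i k hi => ?_, fun k hk => h.anti_succ hk (hr k) ht hX⟩
  obtain hi0 | hi0 := lt_or_ge i 0
  · rw [h.a_neg i hi0]; simp
  lift i to ℕ using hi0
  obtain ⟨j, rfl | rfl⟩ := Nat.even_or_odd' i
  · simpa using h.square_even j k (by push_cast at hi; omega)
  · have hp : 2 * ((j + k : ℕ) : ℤ) + 1 = n := by push_cast at hi ⊢; omega
    have e := h.square_odd hp j k rfl
    rw [h.anti_succ hp (hr _) ht hX, smul_zero] at e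
    simpa using e

end Step
end Abstract

section Induction
variable {R : Type*} [Ring R] [Algebra ℂ R]

/-- The inner derivation `u ↦ Lu - uL`. -/
def adL (L : R) : R →ₗ[ℂ] R := LinearMap.mulLeft ℂ L - LinearMap.mulRight ℂ L

theorem adL_apply (L u : R) : adL L u = L * u - u * L := rfl

/-- The sequence `a_i`: zero for `i < 0`, `a_0 = t⁻¹`, `a_{k+1} = (A1 k + A2 k)/2`. -/
def seqA (t : ℂ) (A1 A2 : ℕ → R) : ℤ → R
  | .ofNat 0 => t⁻¹ • 1
  | .ofNat (k + 1) => (1 / 2 : ℂ) • (A1 k + A2 k)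
  | .negSucc _ => 0

/-- The sequence `b_i`: zero for `i < 0`, `b_0 = B1 0`, `b_{k+1} = (B1 (k+1) + B2 k)/2`. -/
def seqB (B1 B2 : ℕ → R) : ℤ → R
  | .ofNat 0 => B1 0
  | .ofNat (k + 1) => (1 / 2 : ℂ) • (B1 (k + 1) + B2 k)
  | .negSucc _ => 0

namespace Tower
variable {q : ℂ} {l L : R} {A1 A2 B1 B2 K1 K2 : ℕ → R}

theorem K1_eq (h : Tower q l L A1 A2 B1 B2 K1 K2) {j : ℕ}
    (hB : l * l * B1 j - B1 j * (l * l) = 0) : K1 j = B1 (j + 1) :=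
  (sub_eq_zero.1 ((h.p1 j).symm.trans hB)).symm

theorem K2_eq (h : Tower q l L A1 A2 B1 B2 K1 K2) {j : ℕ}
    (hA : l * l * A1 j - A1 j * (l * l) = 0) : K2 j = A1 (j + 1) :=
  (sub_eq_zero.1 ((h.p2 j).symm.trans hA)).symm

theorem r1_succ (h : Tower q l L A1 A2 B1 B2 K1 K2) {j : ℕ}
    (hA : l * l * A1 j - A1 j * (l * l) = 0)
    (hB : l * l * B1 (j + 1) - B1 (j + 1) * (l * l) = 0) :
    (1 / 2 : ℂ) • (A1 (j + 1) + A2 (j + 1)) * l - l * (1 / 2 : ℂ) • (A1 (j + 1) + A2 (j + 1))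
      = adL L ((1 / 2 : ℂ) • (B1 (j + 1) + B2 j)) := by
  have d1 := h.d1 (j + 1)
  have d3 := h.d3 j
  rw [h.K1_eq hB, h.t1] at d1
  rw [h.K2_eq hA, h.t1, h.t2 (j + 1)] at d3
  rw [h.t1, adL_apply]
  linear_combination (norm := skip) (-(1 / 2) : ℂ) • d1 + (-(1 / 2) : ℂ) • d3
    - ((q + q⁻¹ - 1) / 2) • hB
  simp only [mul_add, add_mul, mul_sub, sub_mul, smul_mul_assoc, mul_smul_comm, mul_assoc,
    smul_sub, smul_add]
  module

theorem ad_a (h : Tower q l L A1 A2 B1 B2 K1 K2) {j : ℕ}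
    (hB : l * l * B1 j - B1 j * (l * l) = 0) :
    (1 / 2 : ℂ) • (A1 j + A2 j) * l - l * (1 / 2 : ℂ) • (A1 j + A2 j) = B2 j - B1 (j + 1) := by
  rw [h.t1, h.t2]
  linear_combination (norm := skip) (1 / 2 : ℂ) • hB
  simp only [mul_add, add_mul, mul_sub, sub_mul, smul_mul_assoc, mul_smul_comm, mul_assoc,
    smul_sub, smul_add]
  module

theorem r2_succ (h : Tower q l L A1 A2 B1 B2 K1 K2) {j : ℕ}
    (hA : l * l * A1 j - A1 j * (l * l) = 0)
    (hB : l * l * B1 j - B1 j * (l * l) = 0)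
    (hB' : l * l * B1 (j + 1) - B1 (j + 1) * (l * l) = 0) :
    (1 / 2 : ℂ) • (B1 (j + 2) + B2 (j + 1))
      = ((q - q⁻¹) / 2) • ((1 / 2 : ℂ) • (A1 (j + 1) + A2 (j + 1)) * l
          + l * (1 / 2 : ℂ) • (A1 (j + 1) + A2 (j + 1)))
        + (1 / 4 : ℂ) • adL L ((1 / 2 : ℂ) • (A1 j + A2 j) * l
          - l * (1 / 2 : ℂ) • (A1 j + A2 j)) := by
  have d1 := h.d1 (j + 1)
  have d3 := h.d3 j
  rw [h.K1_eq hB'] at d1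
  rw [h.K2_eq hA] at d3
  rw [h.ad_a hB, adL_apply]
  linear_combination (norm := skip) (1 / 4 : ℂ) • d1 - (1 / 4 : ℂ) • d3
  simp only [mul_add, add_mul, mul_sub, sub_mul, smul_mul_assoc, mul_smul_comm, smul_sub, smul_add]
  module

theorem r1_zero (h : Tower q l L A1 A2 B1 B2 K1 K2) :
    (1 / 2 : ℂ) • (A1 0 + A2 0) * l - l * (1 / 2 : ℂ) • (A1 0 + A2 0) = adL L (B1 0) := by
  rw [h.t1, h.hA, h.hB, adL_apply]
  simp only [mul_add, add_mul, mul_sub, sub_mul, smul_mul_assoc, mul_smul_comm, mul_assoc]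
  module

theorem r2_zero (h : Tower q l L A1 A2 B1 B2 K1 K2) :
    (1 / 2 : ℂ) • (B1 1 + B2 0)
      = ((q - q⁻¹) / 2) • ((1 / 2 : ℂ) • (A1 0 + A2 0) * l
          + l * (1 / 2 : ℂ) • (A1 0 + A2 0)) := by
  have d1 := h.d1 0
  have hB : l * l * B1 0 - B1 0 * (l * l) = 0 := by rw [h.hB]; noncomm_ring
  rw [h.K1_eq hB, h.t1, h.hA, h.hB] at d1
  rw [h.t2, h.t1, h.hA, h.hB]
  linear_combination (norm := skip) (1 / 2 : ℂ) • d1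
  simp only [mul_add, add_mul, mul_sub, sub_mul, smul_mul_assoc, mul_smul_comm, mul_assoc,
    smul_sub, smul_add]
  module

theorem cross_rel (h : Tower q l L A1 A2 B1 B2 K1 K2) {p : ℕ} {b : R}
    (hB : l * l * B1 p - B1 p * (l * l) = 0) (hb : b * l + l * b = B1 p * l + l * B1 p) :
    adL L (b * l + l * b) - (2 * (q - q⁻¹)) • (l * (1 / 2 : ℂ) • (B1 (p + 1) + B2 p)
        - (1 / 2 : ℂ) • (B1 (p + 1) + B2 p) * l)
      = (-2 : ℂ) • ((1 / 2 : ℂ) • (A1 p + A2 p) * (l * l)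
        - l * l * (1 / 2 : ℂ) • (A1 p + A2 p)) := by
  have d2 := h.d2 p
  have d4 := h.d4 p
  have p2 := h.p2 p
  rw [h.K1_eq hB] at d4
  rw [h.t1] at d4 ⊢
  rw [hb, adL_apply]
  linear_combination (norm := skip) d2 - d4 - (2 : ℂ) • p2 + (l * hB + hB * l)
  simp only [mul_add, add_mul, mul_sub, sub_mul, smul_mul_assoc, mul_smul_comm, mul_assoc,
    smul_sub, smul_add, mul_zero, zero_mul]
  module

theorem commute_A1 (h : Tower q l L A1 A2 B1 B2 K1 K2) {p : ℕ}
    (hB : l * l * B1 p - B1 p * (l * l) = 0)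
    (he : (1 / 2 : ℂ) • (A1 p + A2 p) * (l * l) - l * l * (1 / 2 : ℂ) • (A1 p + A2 p) = 0) :
    l * l * A1 p - A1 p * (l * l) = 0 := by
  rw [h.t1] at he
  linear_combination (norm := skip) -he + (1 / 2 : ℂ) • (l * hB + hB * l)
  simp only [mul_add, add_mul, mul_sub, sub_mul, smul_mul_assoc, mul_smul_comm, mul_assoc,
    smul_sub, smul_add, mul_zero, zero_mul]
  module

theorem ad_a_eq_zero (h : Tower q l L A1 A2 B1 B2 K1 K2) {p : ℕ}
    (hB : l * l * B1 p - B1 p * (l * l) = 0) (hA : l * l * A1 p - A1 p * (l * l) = 0) :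
    adL L ((1 / 2 : ℂ) • (A1 p + A2 p)) = 0 := by
  have d2 := h.d2 p
  have d4 := h.d4 p
  have p2 := h.p2 p
  rw [h.K1_eq hB, h.t2] at d4
  rw [h.K2_eq hA, h.t2] at d2
  rw [adL_apply]
  linear_combination (norm := skip) (1 / 2 : ℂ) • d2 + (1 / 2 : ℂ) • d4 + ((q + q⁻¹) / 2) • hA
  simp only [mul_add, add_mul, mul_sub, sub_mul, smul_mul_assoc, mul_smul_comm, mul_assoc,
    smul_sub, smul_add]
  module

theorem commute_B1_succ (h : Tower q l L A1 A2 B1 B2 K1 K2) {p : ℕ}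
    (hB : l * l * B1 p - B1 p * (l * l) = 0) (hA : l * l * A1 p - A1 p * (l * l) = 0) :
    l * l * B1 (p + 1) - B1 (p + 1) * (l * l) = 0 := by
  have d1 := h.d1 p
  rw [h.K1_eq hB, h.t1] at d1
  have hl : Commute (l * l) l := (Commute.refl l).mul_left (Commute.refl l)
  have hL : Commute (l * l) L := h.sq
  have hA' : Commute (l * l) (A1 p) := sub_eq_zero.1 hA
  have hB' : Commute (l * l) (B1 p) := sub_eq_zero.1 hB
  have hg := (hB'.mul_right hl).add_right (hl.mul_right hB')
  have e : B1 (p + 1) = (1 / 2 : ℂ) • (q • ((A1 p - (B1 p * l + l * B1 p)) * l)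
      - q⁻¹ • (l * (A1 p - (B1 p * l + l * B1 p))) + q • (l * A1 p) - q⁻¹ • (A1 p * l)
      - (L * B1 p - B1 p * L)) := by
    rw [d1]; module
  rw [e, sub_eq_zero]
  exact ((((((((hA'.sub_right hg).mul_right hl).smul_right q).sub_right
    ((hl.mul_right (hA'.sub_right hg)).smul_right q⁻¹)).add_right
    ((hl.mul_right hA').smul_right q)).sub_right ((hA'.mul_right hl).smul_right q⁻¹)).sub_right
    ((hL.mul_right hB').sub_right (hB'.mul_right hL))).smul_right _).eq

end Tower

/-- The commutation facts known after `p` steps. -/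
structure Inv (q : ℂ) (l L : R) (A1 A2 B1 B2 : ℕ → R) (p : ℕ) : Prop where
  cA : ∀ j < p, l * l * A1 j - A1 j * (l * l) = 0
  cB : ∀ j ≤ p, l * l * B1 j - B1 j * (l * l) = 0
  da : ∀ i < (p : ℤ) + 1, adL L (seqA (q - q⁻¹) A1 A2 i) = 0
  h2 : ∀ (i : ℤ) (k : ℕ), i + 2 * k < (p : ℤ) + 1 →
    seqA (q - q⁻¹) A1 A2 i * ((adL L)^[k] l * (adL L)^[k] l)
      - (adL L)^[k] l * (adL L)^[k] l * seqA (q - q⁻¹) A1 A2 i = 0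
  h3 : ∀ k : ℕ, 2 * (k : ℤ) + 1 < (p : ℤ) + 1 →
    (adL L)^[k] l * (adL L)^[k + 1] l + (adL L)^[k + 1] l * (adL L)^[k] l = 0

theorem seqA_neg (t : ℂ) (A1 A2 : ℕ → R) : ∀ i : ℤ, i < 0 → seqA t A1 A2 i = 0
  | .negSucc _, _ => rfl

theorem seqB_neg (B1 B2 : ℕ → R) : ∀ i : ℤ, i < 0 → seqB B1 B2 i = 0
  | .negSucc _, _ => rfl

theorem seqA_zero (t : ℂ) (A1 A2 : ℕ → R) : seqA t A1 A2 0 = t⁻¹ • 1 := rfl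

theorem seqB_zero (B1 B2 : ℕ → R) : seqB B1 B2 0 = B1 0 := rfl

theorem seqA_succ (t : ℂ) (A1 A2 : ℕ → R) (k : ℕ) :
    seqA t A1 A2 ((k : ℤ) + 1) = (1 / 2 : ℂ) • (A1 k + A2 k) := rfl

theorem seqB_succ (B1 B2 : ℕ → R) (k : ℕ) :
    seqB B1 B2 ((k : ℤ) + 1) = (1 / 2 : ℂ) • (B1 (k + 1) + B2 k) := rfl

namespace Tower
variable {q : ℂ} {l L : R} {A1 A2 B1 B2 K1 K2 : ℕ → R}

theorem r1 (h : Tower q l L A1 A2 B1 B2 K1 K2) {p : ℕ} (H : Inv q l L A1 A2 B1 B2 p) (i : ℤ)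
    (hi : i ≤ (p : ℤ) + 1) : seqA (q - q⁻¹) A1 A2 i * l - l * seqA (q - q⁻¹) A1 A2 i
      = adL L (seqB B1 B2 (i - 1)) := by
  obtain hi0 | rfl | hi0 := lt_trichotomy i 0
  · rw [seqA_neg _ _ _ i hi0, seqB_neg _ _ _ (by omega)]; simp
  · rw [seqA_zero, seqB_neg _ _ _ (by omega)]; simp
  · obtain ⟨k, rfl⟩ : ∃ k : ℕ, i = k + 1 := ⟨(i - 1).toNat, by omega⟩
    rw [seqA_succ, add_sub_cancel_right]
    cases k with
    | zero => exact h.r1_zero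
    | succ k => exact h.r1_succ (H.cA k (by omega)) (H.cB _ (by omega))

theorem r2 (h : Tower q l L A1 A2 B1 B2 K1 K2) (ht : q - q⁻¹ ≠ 0) {p : ℕ}
    (H : Inv q l L A1 A2 B1 B2 p) (i : ℤ) (hi : i ≤ (p : ℤ) + 1) :
    seqB B1 B2 i = ((q - q⁻¹) / 2) • (seqA (q - q⁻¹) A1 A2 i * l + l * seqA (q - q⁻¹) A1 A2 i)
      + (1 / 4 : ℂ) • adL L (adL L (seqB B1 B2 (i - 2))) := by
  obtain hi0 | rfl | hi0 := lt_trichotomy i 0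
  · rw [seqA_neg _ _ _ i hi0, seqB_neg _ _ _ hi0, seqB_neg _ _ _ (by omega)]; simp
  · rw [seqA_zero, seqB_neg _ _ (0 - 2) (by omega), seqB_zero, h.hB]
    simp only [smul_mul_assoc, mul_smul_comm, one_mul, mul_one, map_zero, smul_zero]
    generalize q - q⁻¹ = t at ht
    match_scalars
    field_simp
    norm_num
  · obtain ⟨k, rfl⟩ : ∃ k : ℕ, i = k + 1 := ⟨(i - 1).toNat, by omega⟩
    rw [show (k : ℤ) + 1 - 2 = k - 1 by ring, ← h.r1 H k (by omega), seqA_succ, seqB_succ]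
    cases k with
    | zero =>
      rw [h.r2_zero, Nat.cast_zero, seqA_zero]
      simp
    | succ k =>
      rw [Nat.cast_succ, seqA_succ]
      exact h.r2_succ (H.cA k (by omega)) (H.cB _ (by omega)) (H.cB _ (by omega))

theorem step (h : Tower q l L A1 A2 B1 B2 K1 K2) (ht : q - q⁻¹ ≠ 0) {p : ℕ}
    (H : Inv q l L A1 A2 B1 B2 p) :
    Step (adL L) (q - q⁻¹) (fun k => (adL L)^[k] l) (seqA (q - q⁻¹) A1 A2) (seqB B1 B2)
      ((p : ℤ) + 1) where
  leib u v := by simp only [adL_apply]; noncomm_ring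
  dm k := (Function.iterate_succ_apply' _ _ _).symm
  ht := ht
  a_zero := rfl
  a_neg := seqA_neg _ _ _
  b_neg := seqB_neg _ _
  r1 := h.r1 H
  r2 := h.r2 ht H
  da := H.da
  h2 := H.h2
  h3 := H.h3

theorem cross_seq (h : Tower q l L A1 A2 B1 B2 K1 K2) {p : ℕ}
    (H : Inv q l L A1 A2 B1 B2 p) :
    adL L (seqB B1 B2 p * l + l * seqB B1 B2 p)
        - (2 * (q - q⁻¹)) • (l * seqB B1 B2 (p + 1) - seqB B1 B2 (p + 1) * l)
      = (-2 : ℂ) • (seqA (q - q⁻¹) A1 A2 (p + 1) * (l * l)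
        - l * l * seqA (q - q⁻¹) A1 A2 (p + 1)) := by
  rw [seqB_succ, seqA_succ]
  refine h.cross_rel (H.cB p le_rfl) ?_
  cases p with
  | zero => rfl
  | succ k =>
    have hA := H.cA k (by omega)
    rw [Nat.cast_succ, seqB_succ, h.t2]
    linear_combination (norm := skip) (-(1 / 2) : ℂ) • hA
    simp only [mul_add, add_mul, mul_sub, sub_mul, smul_mul_assoc, mul_smul_comm, mul_assoc,
      smul_sub, smul_add]
    module

theorem inv_zero (h : Tower q l L A1 A2 B1 B2 K1 K2) : Inv q l L A1 A2 B1 B2 0 where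
  cA j hj := absurd hj (by omega)
  cB j hj := by
    obtain rfl : j = 0 := by omega
    rw [h.hB, mul_assoc, sub_self]
  da i hi := by
    obtain rfl | hi0 := (show i ≤ 0 by omega).eq_or_lt
    · rw [seqA_zero, adL_apply]; simp
    · rw [seqA_neg _ _ _ i hi0]; simp
  h2 i k hi := by
    obtain rfl | hi0 := (show i ≤ 0 by omega).eq_or_lt
    · rw [seqA_zero]; simp
    · rw [seqA_neg _ _ _ i hi0]; simp
  h3 k hk := absurd hk (by omega)

theorem inv_succ (h : Tower q l L A1 A2 B1 B2 K1 K2) (ht : q - q⁻¹ ≠ 0)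
    (hr : ∀ p, rho (q - q⁻¹) (p + 1) ≠ 0) (ht' : (q - q⁻¹) ^ 2 + 4 ≠ 0) {p : ℕ}
    (H : Inv q l L A1 A2 B1 B2 p) : Inv q l L A1 A2 B1 B2 (p + 1) := by
  obtain ⟨h2, h3⟩ := (h.step ht H).square_and_anti_eq_zero hr ht' (by
    rw [add_sub_cancel_right]; exact h.cross_seq H)
  have he := h2 (p + 1) 0 (by simp)
  have hB := H.cB p le_rfl
  have hA := h.commute_A1 hB he
  refine ⟨fun j hj => ?_, fun j hj => ?_, fun i hi => ?_, fun i k hi => ?_, fun k hk => ?_⟩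
  · obtain rfl | hj' := (show j ≤ p by omega).eq_or_lt
    · exact hA
    · exact H.cA j hj'
  · obtain rfl | hj' := hj.eq_or_lt
    · exact h.commute_B1_succ hB hA
    · exact H.cB j (by omega)
  · obtain rfl | hi' := (show i ≤ p + 1 by omega).eq_or_lt
    · exact h.ad_a_eq_zero hB hA
    · exact H.da i hi'
  · obtain hk' | hk' := (show i + 2 * k ≤ p + 1 by omega).eq_or_lt
    · exact h2 i k hk'
    · exact H.h2 i k hk'
  · obtain hk' | hk' := (show 2 * (k : ℤ) + 1 ≤ p + 1 by omega).eq_or_lt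
    · exact h3 k hk'
    · exact H.h3 k hk'

theorem inv (h : Tower q l L A1 A2 B1 B2 K1 K2) (ht : q - q⁻¹ ≠ 0)
    (hr : ∀ p, rho (q - q⁻¹) (p + 1) ≠ 0) (ht' : (q - q⁻¹) ^ 2 + 4 ≠ 0) (p : ℕ) :
    Inv q l L A1 A2 B1 B2 p := by
  induction p with
  | zero => exact h.inv_zero
  | succ p ih => exact h.inv_succ ht hr ht' ih

end Tower
end Induction

section Conclusion
variable {R : Type*} [Ring R] [Algebra ℂ R]

theorem adL_mul (L u v : R) : adL L (u * v) = adL L u * v + u * adL L v := by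
  simp only [adL_apply]; noncomm_ring

theorem adL_iterate_succ (L u : R) (k : ℕ) :
    adL L ((adL L)^[k] u) = (adL L)^[k + 1] u :=
  (Function.iterate_succ_apply' _ _ _).symm

theorem adL_anticomm (L l : R) (i j : ℕ) :
    adL L ((adL L)^[i] l * (adL L)^[j] l + (adL L)^[j] l * (adL L)^[i] l)
      = ((adL L)^[i + 1] l * (adL L)^[j] l + (adL L)^[j] l * (adL L)^[i + 1] l)
        + ((adL L)^[i] l * (adL L)^[j + 1] l + (adL L)^[j + 1] l * (adL L)^[i] l) := by
  simp only [map_add, adL_mul, adL_iterate_succ]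
  abel

theorem adL_sq_eq_zero {L l : R} {k : ℕ}
    (h3 : (adL L)^[k] l * (adL L)^[k + 1] l + (adL L)^[k + 1] l * (adL L)^[k] l = 0) :
    adL L ((adL L)^[k] l * (adL L)^[k] l) = 0 := by
  rw [adL_mul, adL_iterate_succ, add_comm, h3]

theorem anticomm_iterate {L l : R}
    (h3 : ∀ k, (adL L)^[k] l * (adL L)^[k + 1] l + (adL L)^[k + 1] l * (adL L)^[k] l = 0)
    (d : ℕ) : ∀ k,
    (adL L)^[k] l * (adL L)^[k + 2 * d] l + (adL L)^[k + 2 * d] l * (adL L)^[k] l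
        = ((-1 : ℂ) ^ d * 2) • ((adL L)^[k + d] l * (adL L)^[k + d] l) ∧
      (adL L)^[k] l * (adL L)^[k + 2 * d + 1] l + (adL L)^[k + 2 * d + 1] l * (adL L)^[k] l
        = 0 := by
  induction d with
  | zero => exact fun k => ⟨by simp [two_smul], h3 k⟩
  | succ d ih =>
    have even (k : ℕ) := adL_anticomm L l k (k + 2 * d + 1)
    have key : ∀ k, (adL L)^[k] l * (adL L)^[k + 2 * (d + 1)] l
        + (adL L)^[k + 2 * (d + 1)] l * (adL L)^[k] l
        = ((-1 : ℂ) ^ (d + 1) * 2) • ((adL L)^[k + (d + 1)] l * (adL L)^[k + (d + 1)] l) := by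
      intro k
      have e := even k
      have e' := (ih (k + 1)).1
      rw [(ih k).2, map_zero] at e
      rw [show k + 1 + 2 * d = k + 2 * d + 1 by ring, show k + 1 + d = k + (d + 1) by ring] at e'
      rw [e'] at e
      rw [show k + 2 * (d + 1) = k + 2 * d + 1 + 1 by ring, pow_succ]
      linear_combination (norm := module) -e
    refine fun k => ⟨key k, ?_⟩
    have e := adL_anticomm L l k (k + 2 * (d + 1))
    have e' := (ih (k + 1)).2
    rw [key k, map_smul, adL_sq_eq_zero (h3 _), smul_zero] at e
    rw [show k + 1 + 2 * d + 1 = k + 2 * (d + 1) by ring] at e'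
    rw [e', zero_add] at e
    exact e.symm

theorem anticomm_odd {L l : R}
    (h3 : ∀ k, (adL L)^[k] l * (adL L)^[k + 1] l + (adL L)^[k + 1] l * (adL L)^[k] l = 0)
    {m n : ℕ} (hmn : Odd (m + n)) :
    (adL L)^[m] l * (adL L)^[n] l + (adL L)^[n] l * (adL L)^[m] l = 0 := by
  wlog h : m ≤ n generalizing m n
  · rw [add_comm]; exact this (by rwa [add_comm]) (by omega)
  obtain ⟨r, hr⟩ := hmn
  obtain ⟨d, rfl⟩ : ∃ d, n = m + 2 * d + 1 := ⟨r - m, by omega⟩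
  exact (anticomm_iterate h3 d m).2

theorem anticomm_even {L l : R}
    (h3 : ∀ k, (adL L)^[k] l * (adL L)^[k + 1] l + (adL L)^[k + 1] l * (adL L)^[k] l = 0)
    {m n : ℕ} (hmn : Even (m + n)) :
    (adL L)^[m] l * (adL L)^[n] l + (adL L)^[n] l * (adL L)^[m] l
      = ((-1 : ℂ) ^ (((m : ℤ) - (n : ℤ)) / 2) * 2) • ((adL L)^[(m + n) / 2] l) ^ 2 := by
  wlog h : m ≤ n generalizing m n
  · have e := this (m := n) (n := m) (by rwa [add_comm]) (by omega)
    obtain ⟨r, hr⟩ := hmn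
    rw [add_comm, e, add_comm n m, show ((n : ℤ) - m) / 2 = -(((m : ℤ) - n) / 2) by omega,
      zpow_neg, ← inv_zpow, inv_neg, inv_one]
  obtain ⟨r, hr⟩ := hmn
  obtain ⟨d, rfl⟩ : ∃ d, n = m + 2 * d := ⟨r - m, by omega⟩
  rw [(anticomm_iterate h3 d m).1, show (m + (m + 2 * d)) / 2 = m + d by omega,
    show ((m : ℤ) - ((m + 2 * d : ℕ) : ℤ)) / 2 = -(d : ℤ) by omega,
    zpow_neg, ← inv_zpow, inv_neg, inv_one, zpow_natCast, sq]

theorem commute_adL {c L u : R} (h : Commute c u) (hc : adL L c = 0) :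
    Commute c (adL L u) := by
  have hc' : Commute c L := (sub_eq_zero.1 hc).symm
  rw [adL_apply]
  exact (hc'.mul_right h).sub_right (h.mul_right hc')

theorem commute_sq_iterate {L l : R} (hsq : Commute (l * l) L)
    (h3 : ∀ k, (adL L)^[k] l * (adL L)^[k + 1] l + (adL L)^[k + 1] l * (adL L)^[k] l = 0)
    (k : ℕ) : Commute ((adL L)^[k] l * (adL L)^[k] l) l := by
  have h0 : ∀ j, Commute (l * l) ((adL L)^[j] l) := fun j => by
    induction j with
    | zero => exact (Commute.refl l).mul_left (Commute.refl l)
    | succ j ih =>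
      rw [← adL_iterate_succ]
      exact commute_adL ih (sub_eq_zero.2 hsq.symm)
  have e := (anticomm_iterate h3 k 0).1
  rw [zero_add, zero_add, Function.iterate_zero, id] at e
  have hne : ((-1 : ℂ) ^ k * 2) ≠ 0 := by simp
  rw [← inv_smul_smul₀ hne ((adL L)^[k] l * (adL L)^[k] l), ← e]
  refine Commute.smul_left ?_ _
  have := (h0 (2 * k)).eq
  rw [commute_iff_eq, add_mul, mul_add, mul_assoc _ l l, ← this]
  simp only [mul_assoc]
  abel

namespace Tower
variable {q : ℂ} {l L : R} {A1 A2 B1 B2 K1 K2 : ℕ → R}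

theorem commute_sq (h : Tower q l L A1 A2 B1 B2 K1 K2) (ht : q - q⁻¹ ≠ 0)
    (H : ∀ p, Inv q l L A1 A2 B1 B2 p) (j k : ℕ) :
    Commute ((adL L)^[j] l * (adL L)^[j] l) (A1 k) ∧
      Commute ((adL L)^[j] l * (adL L)^[j] l) (B1 k) := by
  have h3 : ∀ k, (adL L)^[k] l * (adL L)^[k + 1] l + (adL L)^[k + 1] l * (adL L)^[k] l = 0 :=
    fun k => (H (2 * k + 1)).h3 k (by omega)
  have hl := commute_sq_iterate h.sq h3 j
  have hc := adL_sq_eq_zero (h3 j)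
  set c := (adL L)^[j] l * (adL L)^[j] l
  have ha (i : ℤ) : Commute c (seqA (q - q⁻¹) A1 A2 i) :=
    (sub_eq_zero.1 ((H (i + 2 * j).toNat).h2 i j (by omega))).symm
  have hb (i : ℕ) : Commute c (seqB B1 B2 i) := by
    induction i using Nat.strong_induction_on with
    | _ i ih =>
      rw [h.r2 ht (H i) i (by omega)]
      refine ((((ha _).mul_right hl).add_right (hl.mul_right (ha _))).smul_right _).add_right
        ((commute_adL (commute_adL ?_ hc) hc).smul_right _)
      obtain hi | hi := lt_or_ge ((i : ℤ) - 2) 0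
      · rw [seqB_neg _ _ _ hi]; exact Commute.zero_right c
      · obtain ⟨i', rfl⟩ : ∃ i', i = i' + 2 := ⟨i - 2, by omega⟩
        rw [show ((i' + 2 : ℕ) : ℤ) - 2 = i' by push_cast; ring]
        exact ih i' (by omega)
  have hA {k : ℕ} (hB : Commute c (B1 k)) : Commute c (A1 k) := by
    have e : A1 k = seqA (q - q⁻¹) A1 A2 ((k : ℤ) + 1)
        + (1 / 2 : ℂ) • (B1 k * l + l * B1 k) := by
      rw [seqA_succ, h.t1]; module
    rw [e]
    exact (ha _).add_right (((hB.mul_right hl).add_right (hl.mul_right hB)).smul_right _)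
  have hB (k : ℕ) : Commute c (B1 k) := by
    induction k with
    | zero => rw [h.hB]; exact hl
    | succ k ih =>
      have e : B1 (k + 1) = seqB B1 B2 ((k + 1 : ℕ) : ℤ) - (1 / 2 : ℂ) • (A1 k * l - l * A1 k) := by
        rw [Nat.cast_succ, seqB_succ, h.t2]; module
      rw [e]
      exact (hb _).sub_right ((((hA ih).mul_right hl).sub_right (hl.mul_right (hA ih))).smul_right
        _)
  exact ⟨hA (hB k), hB k⟩

end Tower
end Conclusion

section Scalars
variable {q : ℂ}

theorem rho_mul (hq0 : q ≠ 0) : ∀ p : ℕ,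
    rho (q - q⁻¹) p * (q ^ 2 - q⁻¹ ^ 2) = q ^ (2 * p) - q⁻¹ ^ (2 * p)
  | 0 => by simp [rho]
  | 1 => by simp [rho]
  | p + 2 => by
    have e0 := rho_mul hq0 p
    have e1 := rho_mul hq0 (p + 1)
    have hi : q * q⁻¹ = 1 := mul_inv_cancel₀ hq0
    have hp : q ^ (2 * p) * q ^ 2 * q⁻¹ ^ 2 = q ^ (2 * p) := by
      rw [mul_assoc, ← mul_pow, hi, one_pow, mul_one]
    have hp' : q⁻¹ ^ (2 * p) * q ^ 2 * q⁻¹ ^ 2 = q⁻¹ ^ (2 * p) := by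
      rw [mul_assoc, ← mul_pow, hi, one_pow, mul_one]
    rw [rho]
    linear_combination (q ^ 2 + q⁻¹ ^ 2) * e1 - e0 + hp - hp'
      - 2 * rho (q - q⁻¹) (p + 1) * (q ^ 2 - q⁻¹ ^ 2) * hi

theorem rho_ne_zero (hq0 : q ≠ 0) (hq : NotRootOfUnity q) (p : ℕ) :
    rho (q - q⁻¹) (p + 1) ≠ 0 := fun h => by
  have e := rho_mul hq0 (p + 1)
  rw [h, zero_mul, inv_pow, eq_comm, sub_eq_zero] at e
  refine hq (2 * (p + 1) + 2 * (p + 1)) (by omega) ?_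
  rw [pow_add]
  nth_rewrite 2 [e]
  exact mul_inv_cancel₀ (pow_ne_zero _ hq0)

theorem sub_inv_ne_zero (hq0 : q ≠ 0) (hq : NotRootOfUnity q) : q - q⁻¹ ≠ 0 := fun h => by
  refine hq 2 two_ne_zero ?_
  linear_combination q * h + mul_inv_cancel₀ hq0

theorem sub_inv_sq_add_four_ne_zero (hq0 : q ≠ 0) (hq : NotRootOfUnity q) :
    (q - q⁻¹) ^ 2 + 4 ≠ 0 := fun h => by
  have hi := mul_inv_cancel₀ hq0
  have e : q + q⁻¹ = 0 := by
    refine pow_eq_zero_iff two_ne_zero |>.1 ?_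
    linear_combination h + 4 * hi
  refine hq 4 (by norm_num) ?_
  linear_combination (q ^ 2 - 1) * (q * e - hi)

end Scalars

theorem sub_neg_one_smul {R : Type*} [Ring R] [Algebra ℂ R] (a b : R) :
    a - (-1 : ℂ) • b = a + b := by
  rw [neg_smul, one_smul, sub_neg_eq_add]

section Instance
variable (q : ℂ)

theorem serre_U (hq0 : q ≠ 0) (hq : NotRootOfUnity q) :
    Serre q (π q x1) (π q x2) (L1U q) (π q x1 * L1U q - L1U q * π q x1)
      ((π q x1 * L1U q - L1U q * π q x1) * L1U q + L1U q * (π q x1 * L1U q - L1U q * π q x1))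
      (QAff.L q 2) where
  hq0 := hq0
  hq2 h := hq 3 (by norm_num) (by linear_combination (q - 1) * h)
  hq3 h := hq 6 (by norm_num) (by linear_combination (q ^ 3 - 1) * (q + 1) * h)
  hq4 h := hq 4 (by norm_num) (by linear_combination (q ^ 2 - 1) * h)
  hl := rfl
  hX2 := rfl
  hX3 := rfl
  hL := by
    have e : QAff.Y q 2 = L1U q * π q x2 + π q x2 * L1U q := by
      rw [QAff.Y, pow_succ, pow_zero, one_mul]
      exact sub_neg_one_smul _ _
    rw [QAff.L, e]; rfl
  s1 := by
    have e : π q (serre1 q) = 0 := by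
      rw [π, RingQuot.mkAlgHom_rel ℂ Rel.one, map_zero]
    simpa [serre1, X2F, L1F, L1U, sub_eq_zero] using e
  s2 := by
    have e : π q (serre2 q) = 0 := by
      rw [π, RingQuot.mkAlgHom_rel ℂ Rel.two, map_zero]
    simpa [serre2, Y2F, L1F, L1U, sub_eq_zero] using e

theorem Y_eq (k : ℕ) : QAff.Y q (2 * k + 1) = Yo (L1U q) (π q x2) k ∧
    QAff.Y q (2 * k + 2) = Ye (L1U q) (π q x2) k := by
  have step {k : ℕ} (h : QAff.Y q (2 * k + 1) = Yo (L1U q) (π q x2) k) :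
      QAff.Y q (2 * k + 2) = Ye (L1U q) (π q x2) k := by
    rw [QAff.Y, h, pow_succ, pow_mul, neg_one_sq, one_pow, one_mul, Ye]
    exact sub_neg_one_smul _ _
  induction k with
  | zero => exact ⟨rfl, step rfl⟩
  | succ k ih =>
    have h : QAff.Y q (2 * (k + 1) + 1) = Yo (L1U q) (π q x2) (k + 1) := by
      rw [show 2 * (k + 1) + 1 = 2 * k + 1 + 2 by ring, QAff.Y, ih.2, Yo_succ,
        show 2 * k + 1 + 1 = 2 * (k + 1) by ring, pow_mul]
      simp
    exact ⟨h, step h⟩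

theorem L_odd (k : ℕ) :
    QAff.L q (2 * k + 1) = br q⁻¹ (π q x1) (Yo (L1U q) (π q x2) k) := by
  rw [QAff.L, (Y_eq q k).1]; rfl

theorem L_even (k : ℕ) :
    QAff.L q (2 * k + 2) = br q⁻¹ (π q x1) (Ye (L1U q) (π q x2) k) := by
  rw [QAff.L, (Y_eq q k).2]; rfl

theorem M_eq (k : ℕ) : QAff.M q k = (adL (QAff.L q 2))^[k] (L1U q) := by
  induction k with
  | zero => rfl
  | succ k ih => rw [QAff.M, ih, ← adL_iterate_succ, adL_apply]

end Instance
end QAffAux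

/-- In `U = U_q(A(0,2)^{(4)})^+` (with `M q k = M_{2k+1}`): for all `m, n ≥ 0`,
if `m+n` is odd then `M_{2m+1}M_{2n+1} + M_{2n+1}M_{2m+1} = 0`; if `m+n` is even then
`M_{2m+1}M_{2n+1} + M_{2n+1}M_{2m+1} = (-1)^((m-n)/2)·2·M_{m+n+1}²`; and for all `m ≥ 0`,
`n ≥ 1`, `M_{2m+1}²` commutes with `L_n`. -/
theorem stmt12 (q : ℂ) (hq0 : q ≠ 0) (hq : NotRootOfUnity q) :
    (∀ m n : ℕ, Odd (m + n) → M q m * M q n + M q n * M q m = 0) ∧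
    (∀ m n : ℕ, Even (m + n) →
      M q m * M q n + M q n * M q m
        = ((-1 : ℂ) ^ (((m : ℤ) - (n : ℤ)) / 2) * 2) • (M q ((m + n) / 2))^2) ∧
    (∀ m n : ℕ, 1 ≤ n → (M q m)^2 * L q n = L q n * (M q m)^2) := by
  have T := (QAffAux.serre_U q hq0 hq).tower
  have H := T.inv (QAffAux.sub_inv_ne_zero hq0 hq) (QAffAux.rho_ne_zero hq0 hq)
    (QAffAux.sub_inv_sq_add_four_ne_zero hq0 hq)
  have h3 (k : ℕ) := (H (2 * k + 1)).h3 k (by omega)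
  refine ⟨fun m n h => ?_, fun m n h => ?_, fun m n hn => ?_⟩
  · simp only [QAffAux.M_eq]
    exact QAffAux.anticomm_odd h3 h
  · simp only [QAffAux.M_eq]
    exact QAffAux.anticomm_even h3 h
  · rw [QAffAux.M_eq, sq]
    obtain ⟨k, rfl | rfl⟩ : ∃ k, n = 2 * k + 1 ∨ n = 2 * k + 2 := ⟨(n - 1) / 2, by omega⟩
    · rw [QAffAux.L_odd]
      exact (T.commute_sq (QAffAux.sub_inv_ne_zero hq0 hq) H m k).2.eq
    · rw [QAffAux.L_even]
      exact (T.commute_sq (QAffAux.sub_inv_ne_zero hq0 hq) H m k).1.eq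
end
end

section
/- In U = U_q(A(0,2)^{(4)})^+: for every n ≥ 1, L_n ≠ 0 and L_n′ ≠ 0; and for every n ≥ 2, the pair {L_n, L_n′} is linearly independent over ℂ. -/
noncomputable section

namespace QAff

/-! ### Skew derivations encoded as homomorphisms into triangular matrices -/

section Triangular

variable {A B : Type*} [Ring A] [Algebra ℂ A] [Ring B] [Algebra ℂ B]

/-- `D u` is upper triangular with diagonal `φ u, c • φ u` and corner `v`: for a homogeneous
element `u`, the corner is the value at `u` of the skew derivation encoded by `D`. -/
def IsCorner (D : A →ₐ[ℂ] Matrix (Fin 2) (Fin 2) B) (φ : A →ₐ[ℂ] B) (c : ℂ) (u : A) (v : B) :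
    Prop :=
  D u = !![φ u, v; 0, c • φ u]

variable {D : A →ₐ[ℂ] Matrix (Fin 2) (Fin 2) B} {φ : A →ₐ[ℂ] B} {c c' : ℂ} {u u' : A} {v v' : B}

theorem IsCorner.congr (h : IsCorner D φ c u v) (hc : c = c') (hv : v = v') :
    IsCorner D φ c' u v' := by
  subst hc hv
  exact h

theorem IsCorner.zero (c : ℂ) : IsCorner D φ c 0 0 := by
  unfold IsCorner
  ext i j
  fin_cases i <;> fin_cases j <;> simp

theorem IsCorner.one : IsCorner D φ 1 1 0 := by
  unfold IsCorner
  ext i j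
  fin_cases i <;> fin_cases j <;> simp

theorem IsCorner.add (h : IsCorner D φ c u v) (h' : IsCorner D φ c u' v') :
    IsCorner D φ c (u + u') (v + v') := by
  unfold IsCorner at *
  rw [map_add, h, h']
  ext i j
  fin_cases i <;> fin_cases j <;> simp

theorem IsCorner.sub (h : IsCorner D φ c u v) (h' : IsCorner D φ c u' v') :
    IsCorner D φ c (u - u') (v - v') := by
  unfold IsCorner at *
  rw [map_sub, h, h']
  ext i j
  fin_cases i <;> fin_cases j <;> simp [smul_sub]

theorem IsCorner.smul (h : IsCorner D φ c u v) (a : ℂ) :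
    IsCorner D φ c (a • u) (a • v) := by
  unfold IsCorner at *
  rw [map_smul, h]
  ext i j
  fin_cases i <;> fin_cases j <;> simp [smul_smul, mul_comm]

theorem IsCorner.mul (h : IsCorner D φ c u v) (h' : IsCorner D φ c' u' v') :
    IsCorner D φ (c * c') (u * u') (φ u * v' + c' • (v * φ u')) := by
  unfold IsCorner at *
  rw [map_mul, h, h']
  ext i j
  fin_cases i <;> fin_cases j <;> simp [smul_smul]

theorem IsCorner.eq_zero (h : IsCorner D φ c 0 v) : v = 0 := by
  have := congrFun (congrFun h 0) 1
  simpa using this.symm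

end Triangular

/-- Skew derivation `∂ᵢ` on the free algebra, with `∂ᵢ xᵢ = 1`, `∂ᵢ xⱼ = 0` for `j ≠ i`, and with
values in `U`; `c j` is the braiding scalar `χ(αᵢ, αⱼ)` and `d j = ∂ᵢ xⱼ`. -/
def freeDer (q : ℂ) (c : Fin 2 → ℂ) (d : Fin 2 → U q) : F →ₐ[ℂ] Matrix (Fin 2) (Fin 2) (U q) :=
  FreeAlgebra.lift ℂ fun j =>
    !![π q (FreeAlgebra.ι ℂ j), d j; 0, c j • π q (FreeAlgebra.ι ℂ j)]

theorem isCorner_freeDer_x1 (q : ℂ) (c : Fin 2 → ℂ) (d : Fin 2 → U q) :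
    IsCorner (freeDer q c d) (π q) (c 0) x1 (d 0) := by
  simp [IsCorner, freeDer, x1]

theorem isCorner_freeDer_x2 (q : ℂ) (c : Fin 2 → ℂ) (d : Fin 2 → U q) :
    IsCorner (freeDer q c d) (π q) (c 1) x2 (d 1) := by
  simp [IsCorner, freeDer, x2]

theorem π_serre1 (q : ℂ) : π q (serre1 q) = 0 := by
  have := RingQuot.mkAlgHom_rel ℂ (Rel.one (q := q))
  simpa [π] using this

theorem π_serre2 (q : ℂ) : π q (serre2 q) = 0 := by
  have := RingQuot.mkAlgHom_rel ℂ (Rel.two (q := q))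
  simpa [π] using this

theorem IsCorner.map_eq_zero {q c : ℂ} {D : F →ₐ[ℂ] Matrix (Fin 2) (Fin 2) (U q)} {u : F} {v : U q}
    (h : IsCorner D (π q) c u v) (hu : π q u = 0) (hv : v = 0) : D u = 0 := by
  rw [h, hu, hv]
  ext i j
  fin_cases i <;> fin_cases j <;> simp

theorem freeDer_one_rel {q : ℂ} (hq0 : q ≠ 0) ⦃a b : F⦄ (h : Rel q a b) :
    freeDer q ![q, q⁻¹] ![1, 0] a = freeDer q ![q, q⁻¹] ![1, 0] b := by
  have e1 := isCorner_freeDer_x1 q ![q, q⁻¹] ![1, 0]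
  have e2 := isCorner_freeDer_x2 q ![q, q⁻¹] ![1, 0]
  have l1 := (e1.mul e2).sub (((e2.mul e1).congr (mul_comm _ _) rfl).smul q⁻¹)
  have l2 := (e1.mul l1).sub ((l1.mul e1).congr (mul_comm _ _) rfl)
  have l3 := (l1.mul e2).add ((e2.mul l1).congr (mul_comm _ _) rfl)
  have l4 := (e1.mul l2).sub (((l2.mul e1).congr (mul_comm _ _) rfl).smul q)
  have l5 := (l3.mul e2).sub (((e2.mul l3).congr (mul_comm _ _) rfl).smul q)
  cases h
  · rw [map_zero]
    refine l4.map_eq_zero (π_serre1 q) ?_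
    simp [mul_sub, sub_mul, smul_smul, mul_assoc, smul_sub, hq0]
  · rw [map_zero]
    refine l5.map_eq_zero (π_serre2 q) ?_
    simp [mul_sub, sub_mul, mul_add, mul_assoc, hq0]

theorem freeDer_two_rel {q : ℂ} (hq0 : q ≠ 0) ⦃a b : F⦄ (h : Rel q a b) :
    freeDer q ![q⁻¹, -q] ![0, 1] a = freeDer q ![q⁻¹, -q] ![0, 1] b := by
  have e1 := isCorner_freeDer_x1 q ![q⁻¹, -q] ![0, 1]
  have e2 := isCorner_freeDer_x2 q ![q⁻¹, -q] ![0, 1]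
  have l1 := (e1.mul e2).sub (((e2.mul e1).congr (mul_comm _ _) rfl).smul q⁻¹)
  have l2 := (e1.mul l1).sub ((l1.mul e1).congr (mul_comm _ _) rfl)
  have l3 := (l1.mul e2).add ((e2.mul l1).congr (mul_comm _ _) rfl)
  have l4 := (e1.mul l2).sub (((l2.mul e1).congr (mul_comm _ _) rfl).smul q)
  have l5 := (l3.mul e2).sub (((e2.mul l3).congr (mul_comm _ _) rfl).smul q)
  cases h
  · rw [map_zero]
    refine l4.map_eq_zero (π_serre1 q) ?_
    simp [mul_sub, sub_mul, smul_smul, mul_assoc, smul_sub, hq0]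
  · rw [map_zero]
    refine l5.map_eq_zero (π_serre2 q) ?_
    simp only [map_add, map_sub, map_smul, map_mul, Matrix.cons_val_zero, Matrix.cons_val_one,
      mul_sub, sub_mul, mul_add, add_mul, smul_smul, mul_assoc, smul_sub, smul_add, mul_one,
      one_mul, mul_zero, zero_mul, smul_zero, mul_smul_comm, smul_mul_assoc]
    match_scalars <;> field_simp <;> ring

/-- The skew derivation `∂₁` of `U`. -/
def derOne {q : ℂ} (hq0 : q ≠ 0) : U q →ₐ[ℂ] Matrix (Fin 2) (Fin 2) (U q) :=
  RingQuot.liftAlgHom ℂ ⟨freeDer q ![q, q⁻¹] ![1, 0], freeDer_one_rel hq0⟩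

/-- The skew derivation `∂₂` of `U`. -/
def derTwo {q : ℂ} (hq0 : q ≠ 0) : U q →ₐ[ℂ] Matrix (Fin 2) (Fin 2) (U q) :=
  RingQuot.liftAlgHom ℂ ⟨freeDer q ![q⁻¹, -q] ![0, 1], freeDer_two_rel hq0⟩

/-- For homogeneous `u`: `∂₁ u = v`, where `c` is the braiding scalar `χ(α₁, deg u)`. -/
def IsDerOne {q : ℂ} (hq0 : q ≠ 0) (c : ℂ) (u v : U q) : Prop :=
  IsCorner (derOne hq0) (AlgHom.id ℂ (U q)) c u v

/-- For homogeneous `u`: `∂₂ u = v`, where `c` is the braiding scalar `χ(α₂, deg u)`. -/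
def IsDerTwo {q : ℂ} (hq0 : q ≠ 0) (c : ℂ) (u v : U q) : Prop :=
  IsCorner (derTwo hq0) (AlgHom.id ℂ (U q)) c u v

section Derivations

variable {q : ℂ} {hq0 : q ≠ 0} {c c' : ℂ} {u u' v v' : U q}

theorem IsDerOne.mul (h : IsDerOne hq0 c u v) (h' : IsDerOne hq0 c' u' v') :
    IsDerOne hq0 (c * c') (u * u') (u * v' + c' • (v * u')) :=
  IsCorner.mul h h'

theorem IsDerTwo.mul (h : IsDerTwo hq0 c u v) (h' : IsDerTwo hq0 c' u' v') :
    IsDerTwo hq0 (c * c') (u * u') (u * v' + c' • (v * u')) :=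
  IsCorner.mul h h'

/-- The derivative of a braided bracket `u u' - a u' u`. -/
theorem IsDerOne.bracket (h : IsDerOne hq0 c u v) (h' : IsDerOne hq0 c' u' v') (a : ℂ) :
    IsDerOne hq0 (c * c') (u * u' - a • (u' * u))
      ((u * v' + c' • (v * u')) - a • (u' * v + c • (v' * u))) :=
  IsCorner.sub (h.mul h') (((h'.mul h).congr (mul_comm _ _) rfl).smul a)

/-- The derivative of a braided bracket `u u' - a u' u`. -/
theorem IsDerTwo.bracket (h : IsDerTwo hq0 c u v) (h' : IsDerTwo hq0 c' u' v') (a : ℂ) :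
    IsDerTwo hq0 (c * c') (u * u' - a • (u' * u))
      ((u * v' + c' • (v * u')) - a • (u' * v + c • (v' * u))) :=
  IsCorner.sub (h.mul h') (((h'.mul h).congr (mul_comm _ _) rfl).smul a)

theorem isDerOne_x1 : IsDerOne hq0 q (π q x1) 1 := by
  have h := isCorner_freeDer_x1 q ![q, q⁻¹] ![1, 0]
  unfold IsDerOne IsCorner derOne π
  rw [RingQuot.liftAlgHom_mkAlgHom_apply]
  exact h

theorem isDerOne_x2 : IsDerOne hq0 q⁻¹ (π q x2) 0 := by
  have h := isCorner_freeDer_x2 q ![q, q⁻¹] ![1, 0]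
  unfold IsDerOne IsCorner derOne π
  rw [RingQuot.liftAlgHom_mkAlgHom_apply]
  exact h

theorem isDerTwo_x1 : IsDerTwo hq0 q⁻¹ (π q x1) 0 := by
  have h := isCorner_freeDer_x1 q ![q⁻¹, -q] ![0, 1]
  unfold IsDerTwo IsCorner derTwo π
  rw [RingQuot.liftAlgHom_mkAlgHom_apply]
  exact h

theorem isDerTwo_x2 : IsDerTwo hq0 (-q) (π q x2) 1 := by
  have h := isCorner_freeDer_x2 q ![q⁻¹, -q] ![0, 1]
  unfold IsDerTwo IsCorner derTwo π
  rw [RingQuot.liftAlgHom_mkAlgHom_apply]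
  exact h

theorem isDerOne_L1U : IsDerOne hq0 1 (L1U q) 0 := by
  refine (isDerOne_x1.bracket isDerOne_x2 q⁻¹).congr (mul_inv_cancel₀ hq0) ?_
  simp

theorem isDerTwo_L1U : IsDerTwo hq0 (-1) (L1U q) ((q⁻¹ * θ q) • π q x1) := by
  refine (isDerTwo_x1.bracket isDerTwo_x2 q⁻¹).congr (by field_simp) ?_
  simp only [θ, zero_mul, mul_zero, smul_zero, mul_one, one_mul]
  match_scalars
  field_simp

theorem isDerOne_X_two : IsDerOne hq0 q (X q 2) 0 := by
  refine (isDerOne_x1.bracket isDerOne_L1U ((-1) ^ 0)).congr (mul_one q) ?_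
  simp

theorem isDerTwo_X_two :
    IsDerTwo hq0 (-q⁻¹) (X q 2) ((q⁻¹ * θ q * (1 - q⁻¹)) • (π q x1 * π q x1)) := by
  refine (isDerTwo_x1.bracket isDerTwo_L1U ((-1) ^ 0)).congr (by ring) ?_
  simp only [zero_mul, mul_zero, smul_zero, mul_smul_comm, smul_mul_assoc]
  match_scalars
  ring

/-- `u` is homogeneous of degree a multiple of `δ = α₁ + α₂`, with `ε = χ(δ, deg u)`,
`∂₁ u = 0` and `∂₁ ∂₂ u = e`. -/
def IsDerDelta {q : ℂ} (hq0 : q ≠ 0) (ε : ℂ) (u e : U q) : Prop :=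
  ∃ v, IsDerOne hq0 1 u 0 ∧ IsDerTwo hq0 ε u v ∧ IsDerOne hq0 q v e

variable {ε ε' : ℂ} {e e' : U q}

theorem IsDerDelta.congr (h : IsDerDelta hq0 ε u e) (hε : ε = ε') (he : e = e') :
    IsDerDelta hq0 ε' u e' := by
  subst hε he
  exact h

theorem IsDerDelta.zero (ε : ℂ) : IsDerDelta hq0 ε 0 0 :=
  ⟨0, IsCorner.zero 1, IsCorner.zero ε, IsCorner.zero q⟩

theorem IsDerDelta.one : IsDerDelta hq0 1 1 0 :=
  ⟨0, IsCorner.one, IsCorner.one, IsCorner.zero q⟩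

theorem IsDerDelta.add (h : IsDerDelta hq0 ε u e) (h' : IsDerDelta hq0 ε u' e') :
    IsDerDelta hq0 ε (u + u') (e + e') := by
  obtain ⟨v, h1, h2, h3⟩ := h
  obtain ⟨v', h1', h2', h3'⟩ := h'
  exact ⟨v + v', (IsCorner.add h1 h1').congr rfl (add_zero 0), IsCorner.add h2 h2',
    IsCorner.add h3 h3'⟩

theorem IsDerDelta.smul (h : IsDerDelta hq0 ε u e) (a : ℂ) :
    IsDerDelta hq0 ε (a • u) (a • e) := by
  obtain ⟨v, h1, h2, h3⟩ := h
  exact ⟨a • v, (IsCorner.smul h1 a).congr rfl (smul_zero a), IsCorner.smul h2 a,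
    IsCorner.smul h3 a⟩

theorem IsDerDelta.eq_zero (h : IsDerDelta hq0 ε 0 e) : e = 0 := by
  obtain ⟨v, -, h2, h3⟩ := h
  rw [IsCorner.eq_zero h2] at h3
  exact IsCorner.eq_zero h3

/-- `∂₁ ∂₂` commutes with the braided bracket with `L₁`. -/
theorem IsDerDelta.bracket_L1U (h : IsDerDelta hq0 ε u e) :
    IsDerDelta hq0 (-ε) (L1U q * u - ε • (u * L1U q)) (L1U q * e - (-ε) • (e * L1U q)) := by
  obtain ⟨v, h1, h2, h3⟩ := h
  refine ⟨_, (isDerOne_L1U.bracket h1 ε).congr (one_mul 1) (by simp),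
    (isDerTwo_L1U.bracket h2 ε).congr (by ring) rfl, ?_⟩
  have a1 : IsDerOne hq0 q (L1U q * v) (L1U q * e) :=
    (isDerOne_L1U.mul h3).congr (one_mul q) (by simp)
  have a2 : IsDerOne hq0 q (v * L1U q) (e * L1U q) :=
    (h3.mul isDerOne_L1U).congr (mul_one q) (by simp)
  have a3 : IsDerOne hq0 q (π q x1 * u) u :=
    (isDerOne_x1.mul h1).congr (mul_one q) (by simp)
  have a4 : IsDerOne hq0 q (u * π q x1) u :=
    (h1.mul isDerOne_x1).congr (one_mul q) (by simp)
  have a5 := IsCorner.sub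
    (IsCorner.add a1 (IsCorner.smul (IsCorner.smul a3 (q⁻¹ * θ q)) ε))
    (IsCorner.smul (IsCorner.add (IsCorner.smul a4 (q⁻¹ * θ q)) (IsCorner.smul a2 (-1))) ε)
  have a6 := IsCorner.congr a5 rfl
    (v' := L1U q * e - (-ε) • (e * L1U q)) (by match_scalars <;> ring)
  simpa only [IsDerOne, smul_mul_assoc, mul_smul_comm] using a6

end Derivations

/-- `iterDer q M j` is the value at `Y_{M+1}` of `(∂₁ ∂₂)^j ∂₂`, see `isDerTwo_Y` and
`isDerDelta_iterDer`. -/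
def iterDer (q : ℂ) : ℕ → ℕ → U q
  | 0, 0 => 1
  | 0, _ + 1 => 0
  | M + 1, 0 =>
    (L1U q * iterDer q M 0 - ((-1 : ℂ) ^ M) • (iterDer q M 0 * L1U q))
      + ((-1 : ℂ) ^ (M + 1) * θ q) • L q (M + 1)
  | M + 1, j + 1 =>
    (L1U q * iterDer q M (j + 1) - ((-1 : ℂ) ^ (M + j + 1)) • (iterDer q M (j + 1) * L1U q))
      + ((-1 : ℂ) ^ (M + 1) * (q⁻¹ * θ q ^ 2)) • iterDer q M j

theorem iterDer_eq_zero (q : ℂ) (M j : ℕ) (h : M < j) : iterDer q M j = 0 := by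
  induction M generalizing j with
  | zero =>
    obtain ⟨j, rfl⟩ := Nat.exists_eq_succ_of_ne_zero h.ne'
    rw [iterDer]
  | succ M ih =>
    obtain ⟨j, rfl⟩ := Nat.exists_eq_succ_of_ne_zero (by omega : j ≠ 0)
    rw [iterDer, ih _ (by omega), ih _ (by omega)]
    simp

theorem exists_iterDer_self {q : ℂ} (hq0 : q ≠ 0) (hθ : θ q ≠ 0) (M : ℕ) :
    ∃ a : ℂ, a ≠ 0 ∧ iterDer q M M = a • 1 := by
  induction M with
  | zero => exact ⟨1, one_ne_zero, by rw [iterDer, one_smul]⟩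
  | succ M ih =>
    obtain ⟨a, ha, h⟩ := ih
    refine ⟨(-1 : ℂ) ^ (M + 1) * (q⁻¹ * θ q ^ 2) * a, by simp [hq0, hθ, ha], ?_⟩
    rw [iterDer, iterDer_eq_zero q M (M + 1) (by omega), h, smul_smul]
    simp

theorem exists_iterDer_succ_self {q : ℂ} (hq0 : q ≠ 0) (hθ : θ q ≠ 0) (M : ℕ) :
    ∃ a : ℂ, a ≠ 0 ∧ iterDer q (M + 1) M = a • L1U q := by
  induction M with
  | zero =>
    refine ⟨-θ q, neg_ne_zero.mpr hθ, ?_⟩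
    simp [iterDer, L, X, Y, L1U]
  | succ M ih =>
    obtain ⟨a, ha, h⟩ := ih
    obtain ⟨b, -, hb⟩ := exists_iterDer_self hq0 hθ (M + 1)
    refine ⟨(-1 : ℂ) ^ (M + 2) * (q⁻¹ * θ q ^ 2) * a, by simp [hq0, hθ, ha], ?_⟩
    have hs : ((-1 : ℂ) ^ (M + 1 + M + 1)) = 1 := Even.neg_one_pow ⟨M + 1, by ring⟩
    rw [iterDer, h, hb, hs, smul_smul]
    simp

theorem isDerOne_Y {q : ℂ} (hq0 : q ≠ 0) (M : ℕ) : IsDerOne hq0 q⁻¹ (Y q (M + 1)) 0 := by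
  induction M with
  | zero => exact isDerOne_x2
  | succ M ih =>
    refine (isDerOne_L1U.bracket ih ((-1) ^ (M + 1))).congr (one_mul _) ?_
    simp

theorem isDerTwo_Y {q : ℂ} (hq0 : q ≠ 0) (M : ℕ) :
    IsDerTwo hq0 ((-1) ^ (M + 1) * q) (Y q (M + 1)) (iterDer q M 0) := by
  induction M with
  | zero =>
    rw [iterDer]
    exact isDerTwo_x2.congr (by ring) rfl
  | succ M ih =>
    refine (isDerTwo_L1U.bracket ih ((-1) ^ (M + 1))).congr (by ring) ?_
    simp only [iterDer, L, X, mul_smul_comm, smul_mul_assoc, smul_add, smul_sub, smul_smul]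
    match_scalars <;> field_simp
    ring

theorem isDerDelta_L_of_isDerOne {q : ℂ} {hq0 : q ≠ 0} {M : ℕ}
    (h : IsDerOne hq0 1 (iterDer q M 0) 0) :
    IsDerDelta hq0 ((-1) ^ (M + 1)) (L q (M + 1)) ((q⁻¹ * θ q) • iterDer q M 0) := by
  have b := isDerTwo_x1.bracket (isDerTwo_Y hq0 M) q⁻¹
  refine ⟨_, (isDerOne_x1.bracket (isDerOne_Y hq0 M) q⁻¹).congr (mul_inv_cancel₀ hq0) (by simp),
    b.congr (by field_simp) rfl, ?_⟩
  have a1 := (isDerOne_x1.mul h).congr (mul_one q) rfl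
  have a2 := (h.mul (isDerOne_x1 (hq0 := hq0))).congr (one_mul q) rfl
  have a3 := (a1.sub (a2.smul (q⁻¹ * q⁻¹))).congr (v' := (q⁻¹ * θ q) • iterDer q M 0) rfl (by
    simp only [mul_zero, zero_mul, smul_zero, mul_one, one_mul, θ]
    match_scalars
    field_simp)
  simpa [IsDerOne, smul_smul] using a3

theorem isDerDelta_iterDer {q : ℂ} (hq0 : q ≠ 0) (M j : ℕ) :
    IsDerDelta hq0 ((-1) ^ (M + j)) (iterDer q M j) (iterDer q M (j + 1)) := by
  induction M generalizing j with
  | zero =>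
    cases j with
    | zero => simpa [iterDer] using IsDerDelta.one (hq0 := hq0)
    | succ j => simpa [iterDer] using IsDerDelta.zero (hq0 := hq0) _
  | succ M ih =>
    cases j with
    | zero =>
      obtain ⟨v, h1, -⟩ := ih 0
      refine ((ih 0).bracket_L1U.congr (by ring) rfl).add
        ((isDerDelta_L_of_isDerOne h1).smul ((-1 : ℂ) ^ (M + 1) * θ q)) |>.congr rfl ?_
      rw [iterDer, smul_smul]
      match_scalars <;> ring
    | succ j =>
      refine (((ih (j + 1)).bracket_L1U.congr (by ring) rfl).add
        (((ih j).smul ((-1 : ℂ) ^ (M + 1) * (q⁻¹ * θ q ^ 2))).congr (by ring) rfl)).congr rfl ?_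
      rw [iterDer]
      match_scalars <;> ring

theorem isDerDelta_L {q : ℂ} (hq0 : q ≠ 0) (M : ℕ) :
    IsDerDelta hq0 ((-1) ^ (M + 1)) (L q (M + 1)) ((q⁻¹ * θ q) • iterDer q M 0) := by
  obtain ⟨v, h, -⟩ := isDerDelta_iterDer hq0 M 0
  exact isDerDelta_L_of_isDerOne h

theorem isDerTwo_L' {q : ℂ} (hq0 : q ≠ 0) (M : ℕ) :
    IsDerTwo hq0 ((-1) ^ (M + 2)) (L' q (M + 2))
      ((X q 2 * iterDer q M 0 + ((-1) ^ (M + 1) * q⁻¹ ^ 2) • (iterDer q M 0 * X q 2)) +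
        ((-1) ^ (M + 1) * (q⁻¹ * θ q * (1 - q⁻¹))) • (q • (π q x1 * π q x1 * Y q (M + 1)) -
          q⁻¹ • (Y q (M + 1) * (π q x1 * π q x1)))) := by
  refine (isDerTwo_X_two.bracket (isDerTwo_Y hq0 M) ((-1) ^ (M + 1) * q⁻¹)).congr
    (by field_simp; ring) ?_
  simp only [mul_smul_comm, smul_mul_assoc]
  match_scalars <;> ring

theorem isDerDelta_L' {q : ℂ} (hq0 : q ≠ 0) (M : ℕ) :
    IsDerDelta hq0 ((-1) ^ (M + 2)) (L' q (M + 2))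
      (((-1) ^ (M + 1) * (q⁻¹ * θ q ^ 2)) • L q (M + 1)) := by
  obtain ⟨-, h, -⟩ := isDerDelta_iterDer hq0 M 0
  have hY := isDerOne_Y hq0 M
  refine ⟨_, (isDerOne_X_two.bracket hY ((-1) ^ (M + 1) * q⁻¹)).congr (mul_inv_cancel₀ hq0)
    (by simp), isDerTwo_L' hq0 M, ?_⟩
  have hx : IsDerOne hq0 q (π q x1) 1 := isDerOne_x1
  have a1 := (isDerOne_X_two.mul h).congr (mul_one q) rfl
  have a2 := (h.mul (isDerOne_X_two (hq0 := hq0))).congr (one_mul q) rfl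
  have a3 := ((hx.mul hx).mul hY).congr (c' := q) (by field_simp) rfl
  have a4 := (hY.mul (hx.mul hx)).congr (c' := q) (by field_simp) rfl
  refine ((a1.add (a2.smul _)).add (((a3.smul q).sub (a4.smul q⁻¹)).smul _)).congr rfl ?_
  simp only [L, X, θ, mul_zero, zero_mul, smul_zero, mul_one, one_mul, zero_add, add_zero,
    add_mul, mul_add, smul_mul_assoc, mul_smul_comm]
  match_scalars <;> field_simp <;> ring

/-- The augmentation of `U`. -/
def aug (q : ℂ) : U q →ₐ[ℂ] ℂ :=
  RingQuot.liftAlgHom ℂ ⟨FreeAlgebra.lift ℂ 0, by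
    intro a b h
    cases h <;> simp [serre1, serre2, X2F, Y2F, L1F, x1, x2]⟩

theorem nontrivial_U (q : ℂ) : Nontrivial (U q) :=
  (aug q).toRingHom.domain_nontrivial

theorem X_two_ne_zero {q : ℂ} (hq0 : q ≠ 0) (hθ : θ q ≠ 0) : X q 2 ≠ 0 := by
  have := nontrivial_U q
  have h1 : 1 - q⁻¹ ≠ 0 := fun h => hθ (by
    have : q⁻¹ = 1 := by linear_combination -h
    rw [inv_eq_one] at this
    simp [θ, this])
  have h2 : 1 + q ≠ 0 := fun h => hθ (by
    have : q = -1 := by linear_combination h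
    simp [θ, this])
  intro h
  have d2 := isDerTwo_X_two (hq0 := hq0)
  rw [h] at d2
  have h3 := d2.eq_zero
  rw [smul_eq_zero_iff_right (mul_ne_zero (mul_ne_zero (inv_ne_zero hq0) hθ) h1)] at h3
  have hx : IsDerOne hq0 q (π q x1) 1 := isDerOne_x1
  have d1 := hx.mul hx
  rw [h3] at d1
  have h4 : (1 + q) • π q x1 = 0 := by simpa [add_smul] using d1.eq_zero
  rw [smul_eq_zero_iff_right h2] at h4
  rw [h4] at hx
  exact one_ne_zero hx.eq_zero

theorem L1U_sq_ne_zero {q : ℂ} (hq0 : q ≠ 0) (hθ : θ q ≠ 0) : L1U q * L1U q ≠ 0 := by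
  intro h
  have d := (isDerTwo_L1U (hq0 := hq0)).mul isDerTwo_L1U
  rw [h] at d
  have h1 : (q⁻¹ * θ q) • X q 2 = 0 := by
    rw [← neg_eq_zero, ← d.eq_zero]
    simp only [X, mul_smul_comm, smul_mul_assoc]
    match_scalars <;> ring
  rw [smul_eq_zero_iff_right (mul_ne_zero (inv_ne_zero hq0) hθ)] at h1
  exact X_two_ne_zero hq0 hθ h1

theorem L_two_ne_L'_two {q : ℂ} (hq0 : q ≠ 0) (hθ : θ q ≠ 0) : L q 2 ≠ L' q 2 := by
  intro h
  have d := isDerTwo_x1.bracket (isDerTwo_Y hq0 1) q⁻¹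
  have d' := (isDerTwo_L' hq0 0).congr (c' := q⁻¹ * ((-1) ^ (1 + 1) * q)) (by field_simp) rfl
  have e := d.sub d'
  have h0 : π q x1 * Y q (1 + 1) - q⁻¹ • (Y q (1 + 1) * π q x1) - L' q (0 + 2) = 0 :=
    sub_eq_zero.mpr h
  rw [h0] at e
  have h1 : (2 * (q⁻¹ * θ q)) • X q 2 = 0 := by
    rw [← neg_eq_zero, ← e.eq_zero]
    simp only [iterDer, X, Y, L, L1U, θ, mul_sub, sub_mul, mul_add, add_mul, mul_smul_comm,
      smul_mul_assoc, mul_one, one_mul, mul_zero, zero_mul, mul_assoc]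
    match_scalars <;> field_simp <;> ring
  rw [smul_eq_zero_iff_right (by simp [hq0, hθ])] at h1
  exact X_two_ne_zero hq0 hθ h1

/-- The braided bracket of `L₁` with `iterDer q M 0` does not vanish for `M ≥ 1`. -/
theorem bracket_iterDer_ne_zero {q : ℂ} (hq0 : q ≠ 0) (hθ : θ q ≠ 0) (M : ℕ) :
    L1U q * iterDer q (M + 1) 0 - ((-1 : ℂ) ^ (M + 1)) • (iterDer q (M + 1) 0 * L1U q) ≠ 0 := by
  intro h
  have key (j : ℕ) : L1U q * iterDer q (M + 1) j -
      ((-1 : ℂ) ^ (M + 1 + j)) • (iterDer q (M + 1) j * L1U q) = 0 := by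
    induction j with
    | zero => exact h
    | succ j ih =>
      have d := (isDerDelta_iterDer hq0 (M + 1) j).bracket_L1U
      rw [ih] at d
      rw [← d.eq_zero, ← add_assoc (M + 1) j 1, pow_succ]
      simp
  obtain ⟨a, ha, h'⟩ := exists_iterDer_succ_self hq0 hθ M
  have h1 := key M
  rw [h', Odd.neg_one_pow ⟨M, by ring⟩] at h1
  have h2 : (2 * a) • (L1U q * L1U q) = 0 := by
    rw [← h1, mul_smul_comm, smul_mul_assoc]
    module
  rw [smul_eq_zero_iff_right (mul_ne_zero two_ne_zero ha)] at h2
  exact L1U_sq_ne_zero hq0 hθ h2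

theorem coeff_add_eq_zero {q : ℂ} (hq0 : q ≠ 0) (hθ : θ q ≠ 0) (M : ℕ) (a b : ℂ)
    (h : a • (L1U q * iterDer q M 0 - ((-1 : ℂ) ^ M) • (iterDer q M 0 * L1U q)) +
      b • L q (M + 1) = 0) : b = 0 := by
  have := nontrivial_U q
  have h0 := (((isDerDelta_iterDer hq0 M 0).bracket_L1U.smul a).congr
    (ε' := (-1) ^ (M + 1)) (by ring) rfl).add ((isDerDelta_L hq0 M).smul b)
  have key (j : ℕ) : a • (L1U q * iterDer q M (j + 1) -
      ((-1 : ℂ) ^ (M + j + 1)) • (iterDer q M (j + 1) * L1U q)) +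
      (b * (q⁻¹ * θ q)) • iterDer q M j = 0 := by
    induction j with
    | zero =>
      rw [add_zero, h] at h0
      rw [← h0.eq_zero, smul_smul]
      simp [pow_succ]
    | succ j ih =>
      have d := ((isDerDelta_iterDer hq0 M (j + 1)).bracket_L1U.smul a).add
        (((isDerDelta_iterDer hq0 M j).smul (b * (q⁻¹ * θ q))).congr (by ring) rfl)
      rw [← add_assoc M j 1, ih] at d
      rw [← d.eq_zero]
      simp [pow_succ, ← add_assoc]
  obtain ⟨c, hc, h'⟩ := exists_iterDer_self hq0 hθ M
  have h1 := key M
  rw [iterDer_eq_zero q M (M + 1) (by omega), h', smul_smul] at h1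
  simpa [hq0, hθ, hc] using h1

theorem linearIndependent_L_L' {q : ℂ} (hq0 : q ≠ 0) (hθ : θ q ≠ 0) (M : ℕ) :
    LinearIndependent ℂ ![L q (M + 2), L' q (M + 2)] := by
  rw [LinearIndependent.pair_iff]
  intro a b h
  have hκ : q⁻¹ * θ q ≠ 0 := mul_ne_zero (inv_ne_zero hq0) hθ
  have d := ((isDerDelta_L hq0 (M + 1)).smul a).add ((isDerDelta_L' hq0 M).smul b)
  rw [h] at d
  have h1 : (q⁻¹ * θ q) • (a • (L1U q * iterDer q M 0 -
      ((-1 : ℂ) ^ M) • (iterDer q M 0 * L1U q)) +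
      ((a + b) * ((-1) ^ (M + 1) * θ q)) • L q (M + 1)) = 0 := by
    rw [← d.eq_zero, iterDer]
    module
  rw [smul_eq_zero_iff_right hκ] at h1
  have hab : a + b = 0 := by
    simpa [hθ] using coeff_add_eq_zero hq0 hθ M _ _ h1
  have hb : b = -a := by linear_combination hab
  suffices a = 0 by simp [hb, this]
  by_contra ha
  cases M with
  | zero =>
    rw [hb, neg_smul, ← sub_eq_add_neg, ← smul_sub, smul_eq_zero_iff_right ha, sub_eq_zero] at h
    exact L_two_ne_L'_two hq0 hθ h
  | succ M =>
    rw [hab, zero_mul, zero_smul, add_zero, smul_eq_zero_iff_right ha] at h1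
    exact bracket_iterDer_ne_zero hq0 hθ M h1

theorem L_one_ne_zero {q : ℂ} (hq0 : q ≠ 0) (hθ : θ q ≠ 0) : L q 1 ≠ 0 := by
  have := nontrivial_U q
  intro h
  have d := isDerDelta_L hq0 0
  rw [h] at d
  simpa [iterDer, hq0, hθ] using d.eq_zero

theorem NotRootOfUnity.θ_ne_zero {q : ℂ} (hq0 : q ≠ 0) (hq : NotRootOfUnity q) : θ q ≠ 0 := by
  intro h
  refine hq 2 two_ne_zero ?_
  have h1 : q = q⁻¹ := sub_eq_zero.mp h
  calc q ^ 2 = q * q := sq q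
    _ = q * q⁻¹ := by rw [← h1]
    _ = 1 := mul_inv_cancel₀ hq0

end QAff

open QAff

/-- In `U = U_q(A(0,2)^{(4)})^+`: for every `n ≥ 1`, `L_n ≠ 0` and `L_n′ ≠ 0`, and for every
`n ≥ 2` the pair `{L_n, L_n′}` is linearly independent over `ℂ`. -/
theorem stmt13 (q : ℂ) (hq0 : q ≠ 0) (hq : NotRootOfUnity q) :
    (∀ n : ℕ, 1 ≤ n → L q n ≠ 0 ∧ L' q n ≠ 0) ∧
    (∀ n : ℕ, 2 ≤ n → LinearIndependent ℂ ![L q n, L' q n]) := by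
  have hθ := hq.θ_ne_zero hq0
  have hli (n : ℕ) (hn : 2 ≤ n) : LinearIndependent ℂ ![L q n, L' q n] := by
    obtain ⟨M, rfl⟩ := Nat.exists_eq_add_of_le' hn
    exact linearIndependent_L_L' hq0 hθ M
  refine ⟨fun n hn => ?_, hli⟩
  obtain rfl | hn := hn.eq_or_lt
  · exact ⟨L_one_ne_zero hq0 hθ, L_one_ne_zero hq0 hθ⟩
  · exact ⟨(hli n hn).ne_zero 0, (hli n hn).ne_zero 1⟩
end
end
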